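/- arXiv:2508.13643 — 5 statements merged into one kernel-verified Lean document; each statement's English description precedes it below -/
import Mathlib

section
/- Let k ≥ 2, 3 ≤ r ≤ 2k and n ≥ 712k be integers. If G is an n-vertex C_{2k+1}-free simple graph with chromatic number χ(G) ≥ r, then λ(G) ≤ λ(T_{n−r+1,2}∘K_r), with equality if and only if G is isomorphic to T_{n−r+1,2}∘K_r. -/
/-- A graph is `m`-cycle-free if it contains no cycle of length `m`. -/
def SimpleGraph.CycleFree {V : Type*} (G : SimpleGraph V) (m : ℕ) : Prop :=
  ∀ ⦃v : V⦄ (w : G.Walk v v), w.IsCycle → w.length ≠ m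

/-- The spectral radius of a finite graph: the largest (real) eigenvalue of its
adjacency matrix, i.e. the supremum of the set of real eigenvalues. -/
noncomputable def SimpleGraph.specRad {V : Type*} [Fintype V] (G : SimpleGraph V) : ℝ :=
  letI : DecidableRel G.Adj := Classical.decRel _
  sSup {μ : ℝ | ∃ x : V → ℝ, x ≠ 0 ∧ (SimpleGraph.adjMatrix ℝ G).mulVec x = μ • x}

/-- A graph is 2-connected if it has at least 3 vertices, is connected, and removing
any single vertex leaves it connected. -/
def SimpleGraph.TwoConnected {V : Type*} (G : SimpleGraph V) : Prop :=
  3 ≤ Nat.card V ∧ G.Connected ∧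
    ∀ v : V, (G.induce (({v} : Set V)ᶜ)).Connected

/-- `turanSuspAt n q v0`: the `n`-vertex graph obtained from the complete bipartite graph
with parts `{0, …, q/2 - 1}` and `{q/2, …, q-1}` (the bipartite Turán graph `T_{q,2}`)
by putting a clique on `{v0} ∪ {q, …, n-1}`; for `v0 < q` this is `T_{q,2}` with a
clique `K_{n-q+1}` suspended at the vertex `v0`. -/
def turanSuspAt (n q v0 : ℕ) : SimpleGraph (Fin n) :=
  SimpleGraph.fromRel (fun i j =>
    ((i : ℕ) < q / 2 ∧ q / 2 ≤ (j : ℕ) ∧ (j : ℕ) < q) ∨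
    (((i : ℕ) = v0 ∨ q ≤ (i : ℕ)) ∧ ((j : ℕ) = v0 ∨ q ≤ (j : ℕ))))

/-- The family `𝒢_{n,r}`: graphs obtained from a bipartite graph by suspending graphs
`G_1, …, G_s` whose parts outside the bipartite graph have at most `r - 2` vertices
in total. -/
def FamilyG (n r : ℕ) (G : SimpleGraph (Fin n)) : Prop :=
  ∃ (s : ℕ) (W : Fin s → Finset (Fin n)) (v : Fin s → Fin n),
    (∀ i j, i ≠ j → Disjoint (W i) (W j)) ∧
    (Finset.univ.biUnion W).card ≤ r - 2 ∧
    (∀ i, v i ∉ Finset.univ.biUnion W) ∧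
    (∃ A : Set (Fin n), ∀ x y, G.Adj x y →
        x ∉ Finset.univ.biUnion W → y ∉ Finset.univ.biUnion W →
        ((x ∈ A ∧ y ∉ A) ∨ (x ∉ A ∧ y ∈ A))) ∧
    (∀ i j, i ≠ j → ∀ x ∈ W i, ∀ y ∈ W j, ¬ G.Adj x y) ∧
    (∀ i, ∀ x ∈ W i, ∀ y, G.Adj x y → y ∉ Finset.univ.biUnion W → y = v i)

/-- The family `𝒢*_{n,r}`: as `FamilyG`, but with exactly `r - 2` vertices outside the
bipartite part. -/
def FamilyGStar (n r : ℕ) (G : SimpleGraph (Fin n)) : Prop :=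
  ∃ (s : ℕ) (W : Fin s → Finset (Fin n)) (v : Fin s → Fin n),
    (∀ i j, i ≠ j → Disjoint (W i) (W j)) ∧
    (Finset.univ.biUnion W).card = r - 2 ∧
    (∀ i, v i ∉ Finset.univ.biUnion W) ∧
    (∃ A : Set (Fin n), ∀ x y, G.Adj x y →
        x ∉ Finset.univ.biUnion W → y ∉ Finset.univ.biUnion W →
        ((x ∈ A ∧ y ∉ A) ∨ (x ∉ A ∧ y ∈ A))) ∧
    (∀ i j, i ≠ j → ∀ x ∈ W i, ∀ y ∈ W j, ¬ G.Adj x y) ∧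
    (∀ i, ∀ x ∈ W i, ∀ y, G.Adj x y → y ∉ Finset.univ.biUnion W → y = v i)

/-- `H` is a `k`-dense bipartite graph: bipartite, 2-connected, any two distinct vertices
in the same part are joined by paths of every odd order `5 ≤ h ≤ 2k+1`, and any two
vertices in different parts are joined by paths of every even order `6 ≤ s ≤ 2k+2`. -/
def KDenseBip {V : Type*} (k : ℕ) (H : SimpleGraph V) : Prop :=
  H.TwoConnected ∧
  ∃ A : Set V,
    (∀ ⦃x y : V⦄, H.Adj x y → ((x ∈ A ∧ y ∉ A) ∨ (x ∉ A ∧ y ∈ A))) ∧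
    (∀ u v : V, u ≠ v → (u ∈ A ↔ v ∈ A) → ∀ h : ℕ, Odd h → 5 ≤ h → h ≤ 2 * k + 1 →
      ∃ p : H.Walk u v, p.IsPath ∧ p.length + 1 = h) ∧
    (∀ u v : V, ¬(u ∈ A ↔ v ∈ A) → ∀ s : ℕ, Even s → 6 ≤ s → s ≤ 2 * k + 2 →
      ∃ p : H.Walk u v, p.IsPath ∧ p.length + 1 = s)

/-- The graph obtained from the complete bipartite graph with parts `{0, …, a}` (size `a+1`)
and `{a+1, …, a+b}` (size `b`) by identifying the vertex `0` with one vertex of a clique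
on `r-1` vertices whose remaining `r-2` vertices `{a+b+1, …, a+b+r-2}` are new. -/
def bipCliqueGraph (a b r : ℕ) : SimpleGraph (Fin (a + b + r - 1)) :=
  SimpleGraph.fromRel (fun i j =>
    ((i : ℕ) ≤ a ∧ a + 1 ≤ (j : ℕ) ∧ (j : ℕ) ≤ a + b) ∨
    (((i : ℕ) = 0 ∨ a + b + 1 ≤ (i : ℕ)) ∧ ((j : ℕ) = 0 ∨ a + b + 1 ≤ (j : ℕ))))

open Finset SimpleGraph

open scoped Classical in
/-- The neighbours of `v` inside `S`. -/
noncomputable def nbrIn {V : Type*} (G : SimpleGraph V) (v : V) (S : Finset V) : Finset V :=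
  S.filter (G.Adj v)

/-- `x` is an eigenvector of the adjacency matrix of `G` with eigenvalue `μ`. -/
def IsEigPair {V : Type*} [Fintype V] (G : SimpleGraph V) (μ : ℝ) (x : V → ℝ) : Prop :=
  x ≠ 0 ∧ ∀ v, ∑ w ∈ nbrIn G v univ, x w = μ * x v

section Eigen
variable {V : Type*}

@[simp] lemma mem_nbrIn {G : SimpleGraph V} {v w : V} {S : Finset V} :
    w ∈ nbrIn G v S ↔ w ∈ S ∧ G.Adj v w := by simp [nbrIn]

variable [Fintype V]

lemma specRad_eq (G : SimpleGraph V) : G.specRad = sSup {μ : ℝ | ∃ x, IsEigPair G μ x} := by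
  classical
  unfold SimpleGraph.specRad IsEigPair
  congr 1
  ext μ
  simp only [Set.mem_ofPred_eq]
  refine exists_congr fun x => and_congr_right fun _ => ?_
  rw [funext_iff]
  refine forall_congr' fun v => ?_
  have : nbrIn G v univ = Finset.univ.filter (G.Adj v) := by ext; simp
  rw [this, Finset.sum_filter]
  simp [Matrix.mulVec, dotProduct, SimpleGraph.adjMatrix_apply]

lemma finite_eigenvalues (G : SimpleGraph V) : {μ : ℝ | ∃ x, IsEigPair G μ x}.Finite := by
  classical
  refine (Module.End.finite_hasEigenvalue (Matrix.toLin' (G.adjMatrix ℝ))).subset ?_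
  rintro μ ⟨x, hx0, hx⟩
  refine Module.End.hasEigenvalue_of_hasEigenvector (x := x) ?_
  refine ⟨Module.End.mem_eigenspace_iff.2 ?_, hx0⟩
  ext v
  have : nbrIn G v univ = Finset.univ.filter (G.Adj v) := by ext; simp
  have h := hx v
  rw [this, Finset.sum_filter] at h
  simpa [Matrix.mulVec, dotProduct, SimpleGraph.adjMatrix_apply] using h

lemma IsEigPair.le_specRad {G : SimpleGraph V} {μ : ℝ} {x : V → ℝ} (h : IsEigPair G μ x) :
    μ ≤ G.specRad := by
  rw [specRad_eq]
  exact le_csSup (finite_eigenvalues G).bddAbove ⟨x, h⟩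

lemma exists_isEigPair_specRad {G : SimpleGraph V} (h : 0 < G.specRad) :
    ∃ x, IsEigPair G G.specRad x := by
  have hne : {μ : ℝ | ∃ x, IsEigPair G μ x}.Nonempty := by
    by_contra hn
    rw [Set.not_nonempty_iff_eq_empty] at hn
    rw [specRad_eq, hn, Real.sSup_empty] at h
    exact lt_irrefl _ h
  have := hne.csSup_mem (finite_eigenvalues G)
  rw [← specRad_eq] at this
  exact this

lemma IsEigPair.map {W : Type*} [Fintype W] {G : SimpleGraph V} {H : SimpleGraph W} (e : G ≃g H)
    {μ : ℝ} {x : V → ℝ} (hx : IsEigPair G μ x) : IsEigPair H μ (x ∘ e.symm) := by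
  refine ⟨fun h' => hx.1 ?_, fun w => ?_⟩
  · ext v
    simpa using congrFun h' (e v)
  · rw [Function.comp_apply, ← hx.2 (e.symm w)]
    refine (Finset.sum_bij (fun v _ => e v) ?_ ?_ ?_ ?_).symm
    · intro v hv
      have : G.Adj (e.symm w) v := (mem_nbrIn.1 hv).2
      have := e.map_adj_iff.2 this
      simpa using this
    · intro a _ b _ hab
      exact e.injective hab
    · intro b hb
      refine ⟨e.symm b, ?_, by simp⟩
      simpa [e.symm.map_adj_iff] using hb
    · intro a _
      simp

lemma specRad_congr {W : Type*} [Fintype W] {G : SimpleGraph V} {H : SimpleGraph W}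
    (e : G ≃g H) : G.specRad = H.specRad := by
  rw [specRad_eq, specRad_eq]
  congr 1
  ext μ
  exact ⟨fun ⟨x, hx⟩ => ⟨_, hx.map e⟩, fun ⟨x, hx⟩ => ⟨_, hx.map e.symm⟩⟩

/-- The vertex maximizing `|x v| / z v`. -/
lemma exists_max_ratio {x z : V → ℝ} (hx : x ≠ 0) (hz : ∀ v, 0 < z v) :
    ∃ c : ℝ, 0 < c ∧ (∀ w, |x w| ≤ c * z w) ∧ ∃ v, |x v| = c * z v := by
  obtain ⟨v0, hv0⟩ : ∃ v, x v ≠ 0 := by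
    by_contra! h
    exact hx (funext h)
  obtain ⟨v, -, hv⟩ := Finset.exists_max_image univ (fun v => |x v| / z v) ⟨v0, mem_univ _⟩
  refine ⟨|x v| / z v, ?_, fun w => ?_, v, ?_⟩
  · exact lt_of_lt_of_le (div_pos (abs_pos.2 hv0) (hz v0)) (hv v0 (mem_univ _))
  · have := hv w (mem_univ _)
    rwa [div_le_iff₀ (hz w)] at this
  · field_simp [(hz v).ne']

lemma IsEigPair.abs_mul_le {G : SimpleGraph V} {μ : ℝ} {x : V → ℝ} (h : IsEigPair G μ x) (v : V) :
    μ * |x v| ≤ ∑ w ∈ nbrIn G v univ, |x w| := by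
  calc μ * |x v| ≤ |μ * x v| := by rw [abs_mul]; gcongr; exact le_abs_self μ
    _ = |∑ w ∈ nbrIn G v univ, x w| := by rw [h.2]
    _ ≤ _ := Finset.abs_sum_le_sum_abs _ _

/-- The Collatz–Wielandt upper bound. -/
lemma IsEigPair.le_of_sum_le {G : SimpleGraph V} {μ M : ℝ} {x z : V → ℝ} (h : IsEigPair G μ x)
    (hz : ∀ v, 0 < z v) (hM : ∀ v, ∑ w ∈ nbrIn G v univ, z w ≤ M * z v) : μ ≤ M := by
  obtain ⟨c, hc, hle, v, hv⟩ := exists_max_ratio h.1 hz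
  have h1 := h.abs_mul_le v
  have h2 : ∑ w ∈ nbrIn G v univ, |x w| ≤ c * (M * z v) := by
    calc _ ≤ ∑ w ∈ nbrIn G v univ, c * z w := Finset.sum_le_sum fun w _ => hle w
      _ = c * ∑ w ∈ nbrIn G v univ, z w := by rw [Finset.mul_sum]
      _ ≤ _ := by gcongr; exact hM v
  rw [hv] at h1
  have : μ * (c * z v) ≤ M * (c * z v) := by linarith
  exact le_of_mul_le_mul_right this (mul_pos hc (hz v))

/-- Strict form of the Collatz–Wielandt bound for subgraphs of a connected graph. -/
lemma IsEigPair.eq_of_le_connected {G H : SimpleGraph V} (hGH : G ≤ H) (hH : H.Connected)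
    {μ M : ℝ} {x z : V → ℝ} (h : IsEigPair G μ x) (hμ : M ≤ μ)
    (hz : ∀ v, 0 < z v) (hM : ∀ v, ∑ w ∈ nbrIn H v univ, z w ≤ M * z v) :
    G = H ∧ ∀ v, ∑ w ∈ nbrIn H v univ, z w = M * z v := by
  obtain ⟨c, hc, hle, v0, hv0⟩ := exists_max_ratio h.1 hz
  have hsub : ∀ v, nbrIn G v univ ⊆ nbrIn H v univ := fun v w hw => by
    simp only [mem_nbrIn, mem_univ, true_and] at hw ⊢
    exact hGH hw
  have step : ∀ v, |x v| = c * z v → (∑ w ∈ nbrIn H v univ, z w = M * z v) ∧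
      ∀ w, H.Adj v w → G.Adj v w ∧ |x w| = c * z w := by
    intro v hv
    have h1 := h.abs_mul_le v
    rw [hv] at h1
    have h2 : M * (c * z v) ≤ μ * (c * z v) := by
      have := mul_pos hc (hz v)
      gcongr
    have h3 : ∑ w ∈ nbrIn G v univ, |x w| ≤ ∑ w ∈ nbrIn G v univ, c * z w :=
      Finset.sum_le_sum fun w _ => hle w
    have h4 : ∑ w ∈ nbrIn G v univ, c * z w ≤ ∑ w ∈ nbrIn H v univ, c * z w :=
      Finset.sum_le_sum_of_subset_of_nonneg (hsub v) fun w _ _ => (mul_pos hc (hz w)).le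
    have h5 : ∑ w ∈ nbrIn H v univ, c * z w = c * ∑ w ∈ nbrIn H v univ, z w := by
      rw [Finset.mul_sum]
    have h6 := mul_le_mul_of_nonneg_left (hM v) hc.le
    refine ⟨?_, ?_⟩
    · refine le_antisymm (hM v) ?_
      have : c * (M * z v) ≤ c * ∑ w ∈ nbrIn H v univ, z w := by linarith
      exact le_of_mul_le_mul_left this hc
    · intro w hw
      have hwG : w ∈ nbrIn G v univ := by
        by_contra hn
        have hlt : ∑ w ∈ nbrIn G v univ, c * z w < ∑ w ∈ nbrIn H v univ, c * z w :=
          Finset.sum_lt_sum_of_subset (hsub v) (i := w) (by simpa using hw) hn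
            (mul_pos hc (hz w)) fun j _ _ => (mul_pos hc (hz j)).le
        linarith
      refine ⟨by simpa using hwG, ?_⟩
      have heq : ∑ w ∈ nbrIn G v univ, |x w| = ∑ w ∈ nbrIn G v univ, c * z w := by linarith
      exact (Finset.sum_eq_sum_iff_of_le fun w _ => hle w).1 heq w hwG
  have all : ∀ v, |x v| = c * z v := by
    intro v
    obtain ⟨p⟩ := hH.preconnected v0 v
    induction p with
    | nil => exact hv0
    | cons hadj _ ih => exact ih ((step _ hv0).2 _ hadj).2
  refine ⟨le_antisymm hGH fun v w hvw => ((step v (all v)).2 w hvw).1, fun v => (step v (all v)).1⟩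

/-- The square of an eigenvalue is at most the largest number of walks of length two
starting at a vertex. -/
lemma IsEigPair.exists_sq_le {G : SimpleGraph V} {μ : ℝ} {x : V → ℝ} (h : IsEigPair G μ x)
    (hμ : 0 ≤ μ) : ∃ u, μ ^ 2 ≤ ∑ v ∈ nbrIn G u univ, ((nbrIn G v univ).card : ℝ) := by
  obtain ⟨c, hc, hle, u, hu⟩ := exists_max_ratio (z := fun _ => 1) h.1 (fun _ => one_pos)
  simp only [mul_one] at hle hu
  refine ⟨u, ?_⟩
  have h1 : μ ^ 2 * c ≤ (∑ v ∈ nbrIn G u univ, ((nbrIn G v univ).card : ℝ)) * c := by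
    calc μ ^ 2 * c = μ * (μ * |x u|) := by rw [hu]; ring
      _ ≤ μ * ∑ w ∈ nbrIn G u univ, |x w| := by gcongr; exact h.abs_mul_le u
      _ = ∑ w ∈ nbrIn G u univ, μ * |x w| := by rw [Finset.mul_sum]
      _ ≤ ∑ w ∈ nbrIn G u univ, ((nbrIn G w univ).card : ℝ) * c := by
        refine Finset.sum_le_sum fun w _ => (h.abs_mul_le w).trans ?_
        refine (Finset.sum_le_sum fun y _ => hle y).trans ?_
        simp
      _ = _ := by rw [Finset.sum_mul]
  exact le_of_mul_le_mul_right h1 hc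

end Eigen

section Paths
variable {V : Type*} {G : SimpleGraph V}

lemma SimpleGraph.CycleFree.not_adj_of_isPath {k : ℕ} (hfree : G.CycleFree (2 * k + 1))
    {u v : V} {p : G.Walk u v} (hp : p.IsPath) (hl : p.length = 2 * k) :
    ¬ G.Adj v u := by
  intro h
  refine hfree (Walk.cons h p) ?_ (by simp [hl])
  rw [Walk.cons_isCycle_iff]
  refine ⟨hp, fun he => ?_⟩
  rw [Sym2.eq_swap] at he
  have := hp.length_eq_one_of_mem_edges he
  omega

lemma nbrIn_subset (v : V) (S : Finset V) : nbrIn G v S ⊆ S := fun _ h => (mem_nbrIn.1 h).1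

lemma nbrIn_card_le (v : V) (S : Finset V) : (nbrIn G v S).card ≤ S.card :=
  card_le_card (nbrIn_subset v S)

lemma sum_nbrIn_card_comm (S T : Finset V) :
    ∑ v ∈ S, (nbrIn G v T).card = ∑ v ∈ T, (nbrIn G v S).card := by
  classical
  have h : ∀ S T : Finset V, ∑ v ∈ S, (nbrIn G v T).card =
      ∑ v ∈ S, ∑ w ∈ T, if G.Adj v w then 1 else 0 := by
    intro S T
    refine sum_congr rfl fun v _ => ?_
    have : nbrIn G v T = T.filter (G.Adj v) := by ext; simp
    rw [this, card_filter]
  rw [h, h, sum_comm]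
  simp only [G.adj_comm]

variable [DecidableEq V]

lemma exists_notMem_of_card_lt {S T : Finset V} (h : T.card < S.card) : ∃ x ∈ S, x ∉ T := by
  by_contra! hn
  exact absurd (card_le_card hn) (by omega)

/-- A set all of whose vertices have at least `m` neighbours inside it spans a path with
`m` vertices. -/
lemma exists_path_of_min_degree {S : Finset V} {m : ℕ} (hS : S.Nonempty)
    (hdeg : ∀ v ∈ S, m ≤ (nbrIn G v S).card) :
    ∀ j, j + 1 ≤ m → ∃ u v : V, ∃ p : G.Walk u v, p.IsPath ∧ p.length = j ∧
      ∀ x ∈ p.support, x ∈ S := by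
  intro j
  induction j with
  | zero =>
    intro _
    obtain ⟨u, hu⟩ := hS
    exact ⟨u, u, Walk.nil, by simp, by simp, by simpa using hu⟩
  | succ j ih =>
    intro hj
    obtain ⟨u, v, p, hp, hpl, hps⟩ := ih (by omega)
    have hu : u ∈ S := hps u p.start_mem_support
    have hcard : (p.support.toFinset.erase u).card < (nbrIn G u S).card := by
      rw [card_erase_of_mem (by simp)]
      have := p.support.toFinset_card_le
      rw [Walk.length_support] at this
      have := hdeg u hu
      omega
    obtain ⟨w, hw, hwn⟩ := exists_notMem_of_card_lt hcard
    rw [mem_nbrIn] at hw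
    have hwp : w ∉ p.support := by
      intro hmem
      exact hwn (by simp [hmem, hw.2.ne'])
    refine ⟨w, v, Walk.cons hw.2.symm p, ?_, by simp [hpl], ?_⟩
    · rw [Walk.cons_isPath_iff]
      exact ⟨hp, hwp⟩
    · intro x hx
      rw [Walk.support_cons, List.mem_cons] at hx
      rcases hx with rfl | hx
      · exact hw.1
      · exact hps x hx

lemma nbrIn_union_card (v : V) {S T : Finset V} (h : Disjoint S T) :
    (nbrIn G v (S ∪ T)).card = (nbrIn G v S).card + (nbrIn G v T).card := by
  have : nbrIn G v (S ∪ T) = nbrIn G v S ∪ nbrIn G v T := by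
    ext; simp [or_and_right]
  rw [this, card_union_of_disjoint]
  exact h.mono (nbrIn_subset v S) (nbrIn_subset v T)

/-- A graph without a path on `m` vertices is sparse. -/
lemma sum_nbrIn_card_le_of_no_path {m : ℕ} (hm : 1 ≤ m) (S : Finset V)
    (hno : ∀ u v : V, ∀ p : G.Walk u v, p.IsPath → (∀ x ∈ p.support, x ∈ S) → p.length + 1 ≠ m) :
    ∑ v ∈ S, (nbrIn G v S).card ≤ 2 * m * S.card := by
  induction hc : S.card generalizing S with
  | zero =>
    rw [card_eq_zero] at hc
    simp [hc]
  | succ c ih =>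
    have hne : S.Nonempty := by rw [← card_pos]; omega
    obtain ⟨v, hv, hdeg⟩ : ∃ v ∈ S, (nbrIn G v S).card < m := by
      by_contra! hdeg
      obtain ⟨u, v, p, hp, hl, hs⟩ := exists_path_of_min_degree hne hdeg (m - 1) (by omega)
      exact hno u v p hp hs (by omega)
    have hT : (S.erase v).card = c := by rw [card_erase_of_mem hv]; omega
    have ih' := ih (S.erase v) (fun a b p hp hs => hno a b p hp
      fun x hx => mem_of_mem_erase (hs x hx)) hT
    have hdis : Disjoint (S.erase v) {v} := by simp
    have hSe : S = S.erase v ∪ {v} := by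
      ext x; by_cases hx : x = v <;> simp [hx, hv]
    have h0 : nbrIn G v {v} = ∅ := by
      ext x
      simp +contextual
    have h1 : (nbrIn G v S).card = (nbrIn G v (S.erase v)).card := by
      conv_lhs => rw [hSe]
      rw [nbrIn_union_card v hdis, h0, card_empty, add_zero]
    have h2 : ∑ w ∈ S.erase v, (nbrIn G w S).card =
        ∑ w ∈ S.erase v, (nbrIn G w (S.erase v)).card + (nbrIn G v (S.erase v)).card := by
      have : ∀ w, (nbrIn G w S).card = (nbrIn G w (S.erase v)).card + (nbrIn G w {v}).card := by
        intro w
        conv_lhs => rw [hSe]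
        rw [nbrIn_union_card w hdis]
      simp only [this]
      rw [sum_add_distrib, sum_nbrIn_card_comm (S.erase v) {v}, sum_singleton]
    rw [← sum_erase_add _ _ hv, h2]
    have e1 : 2 * m * (c + 1) = 2 * m * c + 2 * m := by ring
    rw [e1]
    omega

/-- Neighbourhoods in `C_{2k+1}`-free graphs are sparse. -/
lemma SimpleGraph.CycleFree.sum_nbrIn_card_le {k : ℕ} (hfree : G.CycleFree (2 * k + 1))
    (hk : 1 ≤ k) (u : V) (S : Finset V) (hS : ∀ v ∈ S, G.Adj u v) :
    ∑ v ∈ S, (nbrIn G v S).card ≤ 4 * k * S.card := by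
  have := sum_nbrIn_card_le_of_no_path (G := G) (m := 2 * k) (by omega) S ?_
  · calc _ ≤ _ := this
      _ = _ := by ring
  · intro a b p hp hs hl
    have hup : u ∉ p.support := fun h => G.irrefl (hS u (hs u h))
    have hcp : (Walk.cons (hS a (hs a p.start_mem_support)) p).IsPath := by
      rw [Walk.cons_isPath_iff]
      exact ⟨hp, hup⟩
    exact hfree.not_adj_of_isPath hcp (by simp [hl]) (hS b (hs b p.end_mem_support)).symm

/-- A pair of disjoint vertex sets such that any two vertices of the same set have many
common neighbours in the other set. -/
structure IsCore (G : SimpleGraph V) (m : ℕ) (P Q : Finset V) : Prop where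
  disj : Disjoint P Q
  left : ∀ u ∈ P, ∀ v ∈ P, m ≤ (nbrIn G u Q ∩ nbrIn G v Q).card
  right : ∀ u ∈ Q, ∀ v ∈ Q, m ≤ (nbrIn G u P ∩ nbrIn G v P).card
  left_nonempty : P.Nonempty
  right_nonempty : Q.Nonempty

namespace IsCore
variable {m : ℕ} {P Q : Finset V}

lemma symm (h : IsCore G m P Q) : IsCore G m Q P :=
  ⟨h.disj.symm, h.right, h.left, h.right_nonempty, h.left_nonempty⟩

lemma card_left (h : IsCore G m P Q) : m ≤ P.card := by
  obtain ⟨q, hq⟩ := h.right_nonempty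
  exact (h.right q hq q hq).trans
    (card_le_card (inter_subset_left.trans (nbrIn_subset _ _)))

lemma exists_even_path (h : IsCore G m P Q) (j : ℕ) : ∀ (S : Finset V), S.card + 2 * j + 2 ≤ m →
    ∀ u ∈ P, ∀ v ∈ P, u ≠ v → u ∉ S → v ∉ S →
    ∃ p : G.Walk u v, p.IsPath ∧ p.length = 2 * (j + 1) ∧ ∀ x ∈ p.support, x ∉ S := by
  induction j with
  | zero =>
    intro S hS u hu v hv huv huS hvS
    obtain ⟨q, hq, hqS⟩ := exists_notMem_of_card_lt (T := S)
      (lt_of_lt_of_le (by omega) (h.left u hu v hv))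
    simp only [mem_inter, mem_nbrIn] at hq
    refine ⟨Walk.cons hq.1.2 (Walk.cons hq.2.2.symm Walk.nil), ?_, by simp, ?_⟩
    · simp [Walk.cons_isPath_iff, huv, hq.1.2.ne, hq.2.2.ne']
    · simp [huS, hvS, hqS]
  | succ j ih =>
    intro S hS u hu v hv huv huS hvS
    obtain ⟨p', hp', hp'S⟩ := exists_notMem_of_card_lt (S := P) (T := insert u (insert v S))
      (lt_of_lt_of_le (lt_of_le_of_lt ((card_insert_le _ _).trans
        (Nat.add_le_add_right (card_insert_le _ _) 1)) (by omega)) h.card_left)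
    simp only [mem_insert, not_or] at hp'S
    obtain ⟨q, hq, hqS⟩ := exists_notMem_of_card_lt (T := insert v S)
      (lt_of_lt_of_le (lt_of_le_of_lt (card_insert_le _ _) (by omega)) (h.left u hu p' hp'))
    simp only [mem_inter, mem_nbrIn, mem_insert, not_or] at hq hqS
    obtain ⟨p, hp, hl, hps⟩ := ih (insert u (insert q S))
      (by
        have h1 := card_insert_le u (insert q S)
        have h2 := card_insert_le q S
        omega)
      p' hp' v hv hp'S.2.1
      (by simp [hp'S.1, hp'S.2.2, hq.2.2.ne])
      (by simp [hvS, huv.symm, Ne.symm hqS.1])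
    have hu' : u ∉ p.support := fun hx => hps u hx (by simp)
    have hq' : q ∉ p.support := fun hx => hps q hx (by simp)
    refine ⟨Walk.cons hq.1.2 (Walk.cons hq.2.2.symm p), ?_, by simp [hl]; ring, ?_⟩
    · simp [Walk.cons_isPath_iff, hp, hu', hq', hq.1.2.ne]
    · intro x hx
      simp only [Walk.support_cons, List.mem_cons] at hx
      rcases hx with rfl | rfl | hx
      · exact huS
      · exact hqS.2
      · exact fun hxS => hps x hx (by simp [hxS])

lemma exists_odd_path (h : IsCore G m P Q) (j : ℕ) (S : Finset V) (hS : S.card + 2 * j + 4 ≤ m)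
    {u v : V} (hu : u ∈ P) (hv : v ∈ Q) (huS : u ∉ S) (hvS : v ∉ S) :
    ∃ p : G.Walk u v, p.IsPath ∧ p.length = 2 * (j + 1) + 1 ∧ ∀ x ∈ p.support, x ∉ S := by
  have huv : u ≠ v := fun e => (Finset.disjoint_left.1 h.disj hu) (e ▸ hv)
  obtain ⟨p', hp', hp'S⟩ := exists_notMem_of_card_lt (T := insert u S)
    (lt_of_lt_of_le (lt_of_le_of_lt (card_insert_le _ _) (by omega)) (h.right v hv v hv))
  simp only [mem_inter, mem_nbrIn, mem_insert, not_or] at hp' hp'S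
  obtain ⟨p, hp, hl, hps⟩ := h.exists_even_path j (insert v S)
    (by
      have h1 := card_insert_le v S
      omega)
    u hu p' hp'.1.1 (Ne.symm hp'S.1) (by simp [huv, huS])
    (by simp [hp'S.2, hp'.1.2.ne'])
  have hv' : v ∉ p.support := fun hx => hps v hx (by simp)
  refine ⟨(Walk.cons hp'.1.2 p.reverse).reverse, ?_, by simp [hl], ?_⟩
  · rw [Walk.isPath_reverse_iff, Walk.cons_isPath_iff]
    exact ⟨(Walk.isPath_reverse_iff p).2 hp, by simpa using hv'⟩
  · intro x hx
    simp only [Walk.support_reverse, Walk.support_cons, List.mem_reverse, List.mem_cons] at hx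
    rcases hx with rfl | hx
    · exact hvS
    · exact fun hxS => hps x hx (by simp [hxS])

variable {k : ℕ}

lemma left_indep (h : IsCore G m P Q) (hm : 2 * k + 8 ≤ m) (hk : 2 ≤ k)
    (hfree : G.CycleFree (2 * k + 1)) : ∀ u ∈ P, ∀ v ∈ P, ¬ G.Adj u v := by
  intro u hu v hv huv
  obtain ⟨p, hp, hl, -⟩ := h.exists_even_path (k - 1) ∅ (by simp; omega) u hu v hv huv.ne
    (by simp) (by simp)
  exact hfree.not_adj_of_isPath hp (by omega) huv.symm

/-- A vertex outside the core has neighbours on at most one side. -/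
lemma not_adj_both (h : IsCore G m P Q) (hm : 2 * k + 8 ≤ m) (hk : 2 ≤ k)
    (hfree : G.CycleFree (2 * k + 1)) {w a b : V} (ha : a ∈ P) (hb : b ∈ Q)
    (hwa : G.Adj w a) (hwb : G.Adj w b) : False := by
  obtain ⟨p, hp, hl, hs⟩ := h.exists_odd_path (k - 2) {w} (by simp; omega) ha hb
    (by simpa using hwa.ne') (by simpa using hwb.ne')
  have hw' : w ∉ p.support := fun hx => hs w hx (by simp)
  have hcp : (Walk.cons hwa p).IsPath := by
    rw [Walk.cons_isPath_iff]
    exact ⟨hp, hw'⟩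
  exact hfree.not_adj_of_isPath hcp (by simp [hl]; omega) hwb.symm

/-- Adjacent vertices outside the core have no distinct neighbours on the same side. -/
lemma not_adj_of_nbrs_ne (h : IsCore G m P Q) (hm : 2 * k + 8 ≤ m) (hk : 2 ≤ k)
    (hfree : G.CycleFree (2 * k + 1)) {w w' a b : V} (hw : w ∉ P) (hw' : w' ∉ P)
    (ha : a ∈ P) (hb : b ∈ P) (hab : a ≠ b) (hwa : G.Adj w a) (hwb : G.Adj w' b) :
    ¬ G.Adj w w' := by
  intro hww
  have e1 : a ≠ w := fun e => hw (e ▸ ha)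
  have e2 : a ≠ w' := fun e => hw' (e ▸ ha)
  have e3 : b ≠ w := fun e => hw (e ▸ hb)
  have e4 : b ≠ w' := fun e => hw' (e ▸ hb)
  obtain ⟨p, hp, hl, hs⟩ := h.exists_even_path (k - 2) {w, w'}
    (by have := card_le_two (a := w) (b := w'); omega) a ha b hb hab
    (by simp [e1, e2]) (by simp [e3, e4])
  have hcp : (Walk.cons hwb (Walk.cons hwa p).reverse).IsPath := by
    rw [Walk.cons_isPath_iff, Walk.isPath_reverse_iff, Walk.cons_isPath_iff]
    refine ⟨⟨hp, fun hx => hs w hx (by simp)⟩, ?_⟩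
    simp only [Walk.support_reverse, Walk.support_cons, List.mem_reverse, List.mem_cons, not_or]
    exact ⟨hww.ne', fun hx => hs w' hx (by simp)⟩
  exact hfree.not_adj_of_isPath hcp (by simp [hl]; omega) hww

end IsCore
end Paths

/-- The adjacency pattern of a complete bipartite graph with a suspended clique: the classes are
the cut vertex `0`, the rest `1` of its part, the other part `2`, and the rest `3` of the
clique. -/
def suspRel (i j : Fin 4) : Prop :=
  (i ≤ 1 ∧ j = 2) ∨ (i = 2 ∧ j ≤ 1) ∨ ((i = 0 ∨ i = 3) ∧ (j = 0 ∨ j = 3))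

instance : DecidableRel suspRel := fun i j => by unfold suspRel; infer_instance

lemma suspRel_symm {i j : Fin 4} (h : suspRel i j) : suspRel j i := by
  revert i j; decide

/-- The complete bipartite graph with a suspended clique whose classes are given by `col`. -/
def suspGraph {V : Type*} (col : V → Fin 4) : SimpleGraph V where
  Adj u v := u ≠ v ∧ suspRel (col u) (col v)
  symm := ⟨fun _ _ h => ⟨h.1.symm, suspRel_symm h.2⟩⟩
  loopless := ⟨fun _ h => h.1 rfl⟩

section Susp
variable {V : Type*} [Fintype V] {col : V → Fin 4}

/-- The class sizes of `col` are those of `K_{b,a}` with a suspended `K_r` at a vertex of the part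
of size `b`. -/
structure HasSuspSizes (col : V → Fin 4) (a b r : ℕ) : Prop where
  zero : (univ.filter fun v => col v = 0).card = 1
  one : (univ.filter fun v => col v = 1).card + 1 = b
  two : (univ.filter fun v => col v = 2).card = a
  three : (univ.filter fun v => col v = 3).card + 1 = r

lemma suspGraph_sum_nbrIn [DecidableEq V] (f : Fin 4 → ℝ) (v : V) :
    ∑ w ∈ nbrIn (suspGraph col) v univ, f (col w) =
      ∑ j, (if suspRel (col v) j then ((univ.filter fun w => col w = j).card : ℝ) * f j else 0) -
        if suspRel (col v) (col v) then f (col v) else 0 := by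
  have h1 : ∑ w, (if suspRel (col v) (col w) then f (col w) else 0) =
      ∑ j, (if suspRel (col v) j then ((univ.filter fun w => col w = j).card : ℝ) * f j else 0) := by
    rw [← Finset.sum_fiberwise (s := univ) (g := col)]
    refine sum_congr rfl fun j _ => ?_
    have : ∀ w ∈ univ.filter (fun w => col w = j),
        (if suspRel (col v) (col w) then f (col w) else 0) =
          if suspRel (col v) j then f j else 0 := by
      intro w hw
      rw [(mem_filter.1 hw).2]
    rw [sum_congr rfl this, sum_const, nsmul_eq_mul]
    split_ifs <;> simp
  have h2 : nbrIn (suspGraph col) v univ =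
      (univ.filter fun w => suspRel (col v) (col w)).erase v := by
    ext w
    simp [suspGraph, eq_comm]
  rw [← h1, h2, ← sum_filter]
  split_ifs with h
  · rw [← add_sum_erase _ _ (show v ∈ univ.filter fun w => suspRel (col v) (col w) by simpa)]
    ring
  · rw [erase_eq_of_notMem (by simpa), sub_zero]

/-- A positive weight on the classes which is an eigenvector when `t` is the spectral radius. -/
def suspWeight (b r t : ℝ) : Fin 4 → ℝ :=
  ![t ^ 2 * (t - r + 2), t * ((t - r + 2) * t - (r - 1)),
    t * (t - r + 2) * b - (b - 1) * (r - 1), t ^ 2]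

/-- The polynomial whose largest root is the spectral radius of `suspGraph`. -/
def suspPoly (a b r t : ℝ) : ℝ :=
  t ^ 3 * (t - r + 2) - (r - 1) * t ^ 2 - a * (t * (t - r + 2) * b - (b - 1) * (r - 1))

lemma suspWeight_pos {b r t : ℝ} (hb : 1 ≤ b) (hr : 1 ≤ r) (ht : r ≤ t) (i : Fin 4) :
    0 < suspWeight b r t i := by
  have ht0 : 0 < t := by linarith
  have hh : 2 ≤ t - r + 2 := by linarith
  have h1 : r - 1 < (t - r + 2) * t := by nlinarith
  have h2 : 0 < t * (t - r + 2) * b - (b - 1) * (r - 1) := by nlinarith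
  have h3 : 0 < (t - r + 2) * t - (r - 1) := by linarith
  fin_cases i
  · exact mul_pos (pow_pos ht0 2) (by linarith)
  · exact mul_pos ht0 h3
  · exact h2
  · exact pow_pos ht0 2

lemma HasSuspSizes.sum_nbrIn_weight {a b r : ℕ} (h : HasSuspSizes col a b r) (t : ℝ) (v : V) :
    ∑ w ∈ nbrIn (suspGraph col) v univ, suspWeight b r t (col w) =
      t * suspWeight b r t (col v) - if col v ≤ 1 then suspPoly a b r t else 0 := by
  classical
  rw [suspGraph_sum_nbrIn]
  have h0 : ((univ.filter fun v => col v = 0).card : ℝ) = 1 := by rw [h.zero]; simp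
  have h1 : ((univ.filter fun v => col v = 1).card : ℝ) = b - 1 := by rw [← h.one]; simp
  have h2 : ((univ.filter fun v => col v = 2).card : ℝ) = a := by rw [h.two]
  have h3 : ((univ.filter fun v => col v = 3).card : ℝ) = r - 1 := by rw [← h.three]; simp
  simp only [Fin.sum_univ_four, h0, h1, h2, h3]
  generalize col v = i
  fin_cases i <;> simp [suspRel, suspWeight, suspPoly] <;> ring

lemma HasSuspSizes.connected {a b r : ℕ} (h : HasSuspSizes col a b r) (ha : 1 ≤ a) :
    (suspGraph col).Connected := by
  obtain ⟨x, hx⟩ : ∃ x, col x = 0 := by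
    have : (univ.filter fun v => col v = 0).Nonempty := by rw [← card_pos, h.zero]; simp
    obtain ⟨x, hx⟩ := this
    exact ⟨x, by simpa using hx⟩
  obtain ⟨y, hy⟩ : ∃ y, col y = 2 := by
    have : (univ.filter fun v => col v = 2).Nonempty := by rw [← card_pos, h.two]; omega
    obtain ⟨y, hy⟩ := this
    exact ⟨y, by simpa using hy⟩
  have adj : ∀ u v, u ≠ v → suspRel (col u) (col v) → (suspGraph col).Reachable u v :=
    fun u v h1 h2 => Adj.reachable (show (suspGraph col).Adj u v from ⟨h1, h2⟩)
  have main : ∀ v, (suspGraph col).Reachable x v := by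
    intro v
    by_cases hvx : x = v
    · exact hvx ▸ Reachable.refl _
    have hxy : (suspGraph col).Reachable x y := by
      refine adj x y ?_ ?_
      · rintro rfl; simp [hx] at hy
      · rw [hx, hy]; decide
    by_cases h1 : col v = 1
    · refine hxy.trans (adj y v ?_ ?_)
      · rintro rfl; simp [h1] at hy
      · rw [hy, h1]; decide
    · refine adj x v hvx ?_
      rw [hx]
      revert h1
      generalize col v = i
      revert i
      decide
  have : Nonempty V := ⟨x⟩
  exact ⟨fun u v => (main u).symm.trans (main v)⟩

lemma HasSuspSizes.specRad_eq_of_root {a b r : ℕ} (h : HasSuspSizes col a b r) (hb : 1 ≤ b)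
    (hr : 1 ≤ r) {t : ℝ} (ht : (r : ℝ) ≤ t) (hroot : suspPoly a b r t = 0) :
    (suspGraph col).specRad = t := by
  have hpos : ∀ v, 0 < suspWeight b r t (col v) := fun v =>
    suspWeight_pos (by exact_mod_cast hb) (by exact_mod_cast hr) ht _
  have heq : ∀ v, ∑ w ∈ nbrIn (suspGraph col) v univ, suspWeight b r t (col w) =
      t * suspWeight b r t (col v) := fun v => by
    rw [h.sum_nbrIn_weight, hroot]; simp
  have hne : Nonempty V := by
    have : (univ.filter fun v => col v = 0).Nonempty := by rw [← card_pos, h.zero]; simp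
    exact ⟨this.choose⟩
  have hpair : IsEigPair (suspGraph col) t (fun v => suspWeight b r t (col v)) := by
    refine ⟨fun h0 => ?_, heq⟩
    obtain ⟨v⟩ := hne
    exact (hpos v).ne' (congrFun h0 v)
  have hle := hpair.le_specRad
  have ht0 : (0 : ℝ) < t := by
    have : (1 : ℝ) ≤ r := by exact_mod_cast hr
    linarith
  obtain ⟨x, hx⟩ := exists_isEigPair_specRad (ht0.trans_le hle)
  exact le_antisymm (hx.le_of_sum_le hpos fun v => (heq v).le) hle

lemma exists_suspPoly_root {a b r : ℕ} (ha : 1 ≤ a) (hb : 1 ≤ b) (hr : 2 ≤ r)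
    (hrab : (r : ℝ) ≤ Real.sqrt (a * b)) :
    ∃ t : ℝ, (a * b : ℝ) < t ^ 2 ∧ (r : ℝ) ≤ t ∧ suspPoly a b r t = 0 := by
  set s := Real.sqrt (a * b) with hs
  have ha' : (1 : ℝ) ≤ a := by exact_mod_cast ha
  have hb' : (1 : ℝ) ≤ b := by exact_mod_cast hb
  have hr' : (2 : ℝ) ≤ r := by exact_mod_cast hr
  have hs2 : s ^ 2 = a * b := Real.sq_sqrt (by positivity)
  have hs0 : 0 < s := by linarith
  have hneg : suspPoly a b r s < 0 := by
    have : suspPoly a b r s = (s ^ 2 - a * b) * (s * (s - r + 2) - (r - 1)) - a * (r - 1) := by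
      unfold suspPoly; ring
    rw [this, hs2, sub_self, zero_mul]
    nlinarith
  have hpos : 0 ≤ suspPoly a b r (2 * s) := by
    have h1 : suspPoly a b r (2 * s) =
        ((2 * s) ^ 2 - a * b) * (2 * s * (2 * s - r + 2) - (r - 1)) - a * (r - 1) := by
      unfold suspPoly; ring
    have h2 : a * b ≤ (2 * s) ^ 2 - a * b := by nlinarith
    have h3 : r - 1 ≤ 2 * s * (2 * s - r + 2) - (r - 1) := by nlinarith
    have h4 : (a : ℝ) ≤ (2 * s) ^ 2 - a * b := le_trans (by nlinarith) h2
    rw [h1, sub_nonneg]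
    exact mul_le_mul h4 h3 (by linarith) (by linarith)
  obtain ⟨t, ⟨hst, -⟩, ht⟩ := intermediate_value_Icc (show s ≤ 2 * s by linarith)
    (f := suspPoly a b r) (by unfold suspPoly; fun_prop) ⟨hneg.le, hpos⟩
  have hne : s ≠ t := by
    rintro rfl
    linarith
  have hlt : s < t := lt_of_le_of_ne hst hne
  refine ⟨t, ?_, by linarith, ht⟩
  rw [← hs2]
  gcongr

/-- Among the splittings of `a + b`, the balanced one has the largest spectral radius. -/
lemma suspPoly_nonneg {a b a' b' r : ℕ} (hab : a + b = a' + b') (h1 : b' ≤ a') (h2 : a' ≤ b' + 1)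
    (hr : 2 ≤ r) {t : ℝ} (ht : (r : ℝ) ≤ t) (hroot : suspPoly a' b' r t = 0) :
    0 ≤ suspPoly a b r t ∧ (suspPoly a b r t = 0 → a = a') := by
  have hr' : (2 : ℝ) ≤ r := by exact_mod_cast hr
  have hab' : (a : ℝ) + b = a' + b' := by exact_mod_cast hab
  have h1' : (b' : ℝ) ≤ a' := by exact_mod_cast h1
  have h2' : (a' : ℝ) ≤ b' + 1 := by exact_mod_cast h2
  have hdiff : suspPoly a b r t = (t * (t - r + 2) - (r - 1)) * (a' * b' - a * b) +
      (r - 1) * (a' - a) := by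
    have : suspPoly a b r t = suspPoly a b r t - suspPoly a' b' r t := by rw [hroot, sub_zero]
    rw [this]
    unfold suspPoly
    ring
  have hc : (r : ℝ) - 1 < t * (t - r + 2) - (r - 1) := by nlinarith
  have hb : (b : ℝ) = a' + b' - a := by linarith
  have hprod : (a' * b' - a * b : ℝ) = (a - a') * (a - a') + (a - a') * (a' - b') := by
    rw [hb]; ring
  rcases lt_trichotomy a a' with hlt | heq | hgt
  · have hlt' : (a : ℝ) + 1 ≤ a' := by exact_mod_cast hlt
    have hp : 0 ≤ (a' * b' - a * b : ℝ) := by rw [hprod]; nlinarith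
    have : 0 < suspPoly a b r t := by
      rw [hdiff]
      have := mul_nonneg (show (0 : ℝ) ≤ t * (t - r + 2) - (r - 1) by linarith) hp
      nlinarith
    exact ⟨this.le, fun h => absurd h this.ne'⟩
  · refine ⟨?_, fun _ => heq⟩
    have hbb : b = b' := by omega
    rw [heq, hbb, hroot]
  · have hgt' : (a' : ℝ) + 1 ≤ a := by exact_mod_cast hgt
    have hp : (a - a' : ℝ) ≤ a' * b' - a * b := by rw [hprod]; nlinarith
    have : 0 < suspPoly a b r t := by
      rw [hdiff]
      have h3 : (t * (t - r + 2) - (r - 1)) * (a - a' : ℝ) ≤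
          (t * (t - r + 2) - (r - 1)) * (a' * b' - a * b) :=
        mul_le_mul_of_nonneg_left hp (by linarith)
      nlinarith
    exact ⟨this.le, fun h => absurd h this.ne'⟩

lemma HasSuspSizes.nonempty_iso {W : Type*} [Fintype W] {col' : W → Fin 4} {a b r : ℕ}
    (h : HasSuspSizes col a b r) (h' : HasSuspSizes col' a b r) :
    Nonempty (suspGraph col ≃g suspGraph col') := by
  classical
  have hcard : ∀ i : Fin 4, Fintype.card {v // col v = i} = Fintype.card {w // col' w = i} := by
    intro i
    rw [Fintype.card_subtype, Fintype.card_subtype]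
    have e0 := h.zero.trans h'.zero.symm
    have e1 := h.one.trans h'.one.symm
    have e2 := h.two.trans h'.two.symm
    have e3 := h.three.trans h'.three.symm
    fin_cases i
    · exact e0
    · exact Nat.add_right_cancel e1
    · exact e2
    · exact Nat.add_right_cancel e3
  let e : V ≃ W := Equiv.ofFiberEquiv fun i => Fintype.equivOfCardEq (hcard i)
  have he : ∀ v, col' (e v) = col v := fun v => Equiv.ofFiberEquiv_map _ v
  refine ⟨⟨e, ?_⟩⟩
  intro u v
  simp [suspGraph, he]

end Susp

section CoreExistence
variable {V : Type*} {G : SimpleGraph V}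

/-- A weight whose maximizers among pairs of disjoint sets are dense bipartite graphs. -/
noncomputable def pairWeight (G : SimpleGraph V) (n : ℕ) (P Q : Finset V) : ℝ :=
  10 * ∑ v ∈ P, ((nbrIn G v Q).card : ℝ) - 3 * n * (P.card + Q.card)

lemma pairWeight_comm (n : ℕ) (P Q : Finset V) :
    pairWeight G n P Q = pairWeight G n Q P := by
  unfold pairWeight
  have := congrArg (Nat.cast (R := ℝ)) (sum_nbrIn_card_comm (G := G) P Q)
  push_cast at this
  rw [this]
  ring

variable [DecidableEq V]

lemma pairWeight_insert (n : ℕ) {P Q : Finset V} {x : V} (hx : x ∉ P) :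
    pairWeight G n (insert x P) Q =
      pairWeight G n P Q + 10 * ((nbrIn G x Q).card : ℝ) - 3 * n := by
  unfold pairWeight
  rw [sum_insert hx, card_insert_of_notMem hx]
  push_cast
  ring

/-- A dense bipartite subgraph contains one which is locally dense, and outside of which the
vertices have few neighbours in each part. -/
lemma exists_dense_pair [Fintype V] (n : ℕ) (hn : Fintype.card V = n) (A : Finset V)
    (hA : 0.24297 * (n : ℝ) ^ 2 ≤ ∑ v ∈ A, ((nbrIn G v Aᶜ).card : ℝ)) (hn1 : 50 ≤ n) :
    ∃ P Q : Finset V, Disjoint P Q ∧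
      (n - 0.037 * n : ℝ) ≤ P.card + Q.card ∧
      (P.card : ℝ) ≤ 0.584 * n ∧ (Q.card : ℝ) ≤ 0.584 * n ∧
      (0.395 * n : ℝ) ≤ P.card ∧ (0.395 * n : ℝ) ≤ Q.card ∧
      (∀ v ∈ P, (0.3 * n : ℝ) ≤ (nbrIn G v Q).card) ∧
      (∀ v ∈ Q, (0.3 * n : ℝ) ≤ (nbrIn G v P).card) ∧
      (∀ v, v ∉ P ∪ Q → ((nbrIn G v P).card : ℝ) ≤ 0.3 * n ∧
        ((nbrIn G v Q).card : ℝ) ≤ 0.3 * n) := by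
  have hnR : (50 : ℝ) ≤ n := by exact_mod_cast hn1
  let F : Finset (Finset V × Finset V) :=
    univ.filter fun p => Disjoint p.1 p.2 ∧ n ≤ 2 * (p.1.card + p.2.card)
  have hF0 : (A, Aᶜ) ∈ F := by
    simp only [F, mem_filter, mem_univ, true_and]
    refine ⟨disjoint_compl_right, ?_⟩
    rw [card_add_card_compl, hn]
    omega
  obtain ⟨⟨P, Q⟩, hPQ, hmax⟩ := F.exists_max_image (fun p => pairWeight G n p.1 p.2) ⟨_, hF0⟩
  simp only [F, mem_filter, mem_univ, true_and] at hPQ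
  obtain ⟨hdis, hlarge⟩ := hPQ
  have hmax' : ∀ P' Q' : Finset V, Disjoint P' Q' → n ≤ 2 * (P'.card + Q'.card) →
      pairWeight G n P' Q' ≤ pairWeight G n P Q := fun P' Q' h1 h2 =>
    hmax (P', Q') (by simp [F, h1, h2])
  have h0 := hmax _ hF0
  set p : ℝ := (P.card : ℝ) with hp
  set q : ℝ := (Q.card : ℝ) with hq
  have hcardle : P.card + Q.card ≤ n := by
    rw [← card_union_of_disjoint hdis, ← hn]
    exact card_le_univ _
  have hcardle' : p + q ≤ n := by rw [hp, hq]; exact_mod_cast hcardle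
  have hlarge' : (n : ℝ) ≤ 2 * (p + q) := by rw [hp, hq]; exact_mod_cast hlarge
  have hA' : (A.card : ℝ) + (Aᶜ).card = n := by
    rw [← hn]; exact_mod_cast card_add_card_compl A
  have hedge : ∑ v ∈ P, ((nbrIn G v Q).card : ℝ) ≤ p * q := by
    calc _ ≤ ∑ v ∈ P, q := by
            refine sum_le_sum fun v _ => ?_
            rw [hq]
            exact_mod_cast nbrIn_card_le v Q
      _ = _ := by rw [sum_const, nsmul_eq_mul]
  simp only [pairWeight] at h0
  rw [hA'] at h0
  have hmain : 10 * (p * q) - 3 * n * (p + q) ≥ -0.5703 * (n : ℝ) ^ 2 := by nlinarith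
  have hp0 : 0 ≤ p := by rw [hp]; positivity
  have hq0 : 0 ≤ q := by rw [hq]; positivity
  have hsq : 4 * (p * q) = (p + q) ^ 2 - (p - q) ^ 2 := by ring
  obtain ⟨t, ht⟩ : ∃ t : ℝ, p + q = n - t := ⟨n - (p + q), by ring⟩
  have ht0 : 0 ≤ t := by linarith
  have htn : t ≤ 0.5 * n := by linarith
  have hmain' : (p - q) ^ 2 ≤ 0.02812 * (n : ℝ) ^ 2 - 0.8 * n * t + t ^ 2 := by
    rw [ht] at hmain hsq
    nlinarith
  have hnt : ∀ c : ℝ, t ≤ c * n → t ^ 2 ≤ c * n * t := fun c hc => by nlinarith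
  have hn0 : (0 : ℝ) < n := by linarith
  have hb : ∀ c : ℝ, 0 ≤ c → t ≤ c * n → (0.8 - c) * t ≤ 0.02812 * n := fun c hc0 hc => by
    have h1 := hnt c hc
    have h2 := sq_nonneg (p - q)
    have h3 : ((0.8 - c) * t) * n ≤ (0.02812 * n) * n := by nlinarith
    exact le_of_mul_le_mul_right h3 hn0
  have ht1 : t ≤ 0.0938 * n := by linarith [hb 0.5 (by norm_num) htn]
  have ht2 : t ≤ 0.0399 * n := by linarith [hb 0.0938 (by norm_num) ht1]
  have ht3 : t ≤ 0.037 * n := by linarith [hb 0.0399 (by norm_num) ht2]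
  have hd : (p - q) ^ 2 ≤ (0.168 * n) ^ 2 := by
    have := hnt 0.037 ht3
    nlinarith [mul_nonneg ht0 hn0.le]
  have hd' := abs_le_of_sq_le_sq' hd (by positivity)
  have herase : ∀ P Q : Finset V, Disjoint P Q → (n : ℝ) + 2 ≤ 2 * (P.card + Q.card) →
      (∀ P' Q' : Finset V, Disjoint P' Q' → n ≤ 2 * (P'.card + Q'.card) →
        pairWeight G n P' Q' ≤ pairWeight G n P Q) →
      ∀ v ∈ P, (0.3 * n : ℝ) ≤ (nbrIn G v Q).card := by
    intro P Q hdis hlarge hmax v hv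
    have h1 := hmax (P.erase v) Q (hdis.mono_left (erase_subset _ _)) (by
      have h2 : n + 2 ≤ 2 * (P.card + Q.card) := by exact_mod_cast hlarge
      rw [card_erase_of_mem hv]
      have := card_pos.2 ⟨v, hv⟩
      omega)
    have h2 := pairWeight_insert (G := G) n (P := P.erase v) (Q := Q) (notMem_erase v P)
    rw [insert_erase hv] at h2
    linarith
  have hinsert : ∀ P Q : Finset V, Disjoint P Q → n ≤ 2 * (P.card + Q.card) →
      (∀ P' Q' : Finset V, Disjoint P' Q' → n ≤ 2 * (P'.card + Q'.card) →
        pairWeight G n P' Q' ≤ pairWeight G n P Q) →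
      ∀ v, v ∉ P → v ∉ Q → ((nbrIn G v Q).card : ℝ) ≤ 0.3 * n := by
    intro P Q hdis hlarge hmax v hv hvQ
    have h1 := hmax (insert v P) Q (by simp [hdis, hvQ]) (by
      rw [card_insert_of_notMem hv]
      omega)
    rw [pairWeight_insert n hv] at h1
    linarith
  have hmaxs : ∀ P' Q' : Finset V, Disjoint P' Q' → n ≤ 2 * (P'.card + Q'.card) →
        pairWeight G n P' Q' ≤ pairWeight G n Q P := fun P' Q' h1 h2 => by
    rw [pairWeight_comm n Q P]
    exact hmax' P' Q' h1 h2
  have hlarge2 : (n : ℝ) + 2 ≤ 2 * (p + q) := by linarith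
  refine ⟨P, Q, hdis, by linarith, by linarith, by linarith, by linarith, by linarith, ?_, ?_,
    fun v hv => ?_⟩
  · exact herase P Q hdis hlarge2 hmax'
  · exact herase Q P hdis.symm (by rw [add_comm (Q.card : ℝ)]; exact hlarge2) hmaxs
  · simp only [mem_union, not_or] at hv
    exact ⟨hinsert Q P hdis.symm (by rw [add_comm]; exact hlarge) hmaxs v hv.2 hv.1,
      hinsert P Q hdis hlarge hmax' v hv.1 hv.2⟩

lemma isCore_of_dense {n m : ℕ} {P Q : Finset V} (hdis : Disjoint P Q)
    (hP : (P.card : ℝ) ≤ 0.584 * n) (hQ : (Q.card : ℝ) ≤ 0.584 * n)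
    (hPd : ∀ v ∈ P, (0.3 * n : ℝ) ≤ (nbrIn G v Q).card)
    (hQd : ∀ v ∈ Q, (0.3 * n : ℝ) ≤ (nbrIn G v P).card)
    (hPn : P.Nonempty) (hQn : Q.Nonempty) (hm : (m : ℝ) ≤ 0.016 * n) : IsCore G m P Q := by
  have key : ∀ P Q : Finset V, (Q.card : ℝ) ≤ 0.584 * n →
      (∀ v ∈ P, (0.3 * n : ℝ) ≤ (nbrIn G v Q).card) →
      ∀ u ∈ P, ∀ v ∈ P, m ≤ (nbrIn G u Q ∩ nbrIn G v Q).card := by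
    intro P Q hQ hPd u hu v hv
    have h1 := card_union_add_card_inter (nbrIn G u Q) (nbrIn G v Q)
    have h2 : (nbrIn G u Q ∪ nbrIn G v Q).card ≤ Q.card :=
      card_le_card (union_subset (nbrIn_subset _ _) (nbrIn_subset _ _))
    have h3 : (nbrIn G u Q).card + (nbrIn G v Q).card ≤
      Q.card + (nbrIn G u Q ∩ nbrIn G v Q).card := by omega
    have h3' : ((nbrIn G u Q).card : ℝ) + (nbrIn G v Q).card ≤
      Q.card + (nbrIn G u Q ∩ nbrIn G v Q).card := by exact_mod_cast h3
    have := hPd u hu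
    have := hPd v hv
    have : (m : ℝ) ≤ (nbrIn G u Q ∩ nbrIn G v Q).card := by linarith
    exact_mod_cast this
  exact ⟨hdis, key P Q hQ hPd, key Q P hP hQd, hPn, hQn⟩

end CoreExistence

section SpectralBound

set_option maxHeartbeats 400000 in
lemma exists_weights {n M p q lp lq t g : ℝ} (hn : 1424 ≤ n) (hM1 : 0.4985 * n ≤ M)
    (hpq : p + q = 2 * M + 0.05 - g) (hlp : 0 ≤ lp) (hlq : 0 ≤ lq)
    (ht : 0 ≤ t) (hl : lp + lq + t ≤ 0.037 * n) (hg1 : 1 ≤ g) (hg2 : lp + lq ≤ 2 * g)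
    (hp : 0.395 * n ≤ p) (hq : 0.395 * n ≤ q) (hq2 : q ≤ 0.584 * n) :
    ∃ X η : ℝ, 0 < X ∧ 0 < η ∧ X ≤ 0.605 * n ∧ η ≤ 0.45375 * n ∧
      q * M + (lp * (0.3 * n * (0.75 * M)) + t * η) / M ≤ M * X ∧
      p * X + (lq * (0.3 * n * (0.75 * X)) + t * η) / M ≤ M * M ∧
      0.3 * n * (M + (lp + lq + t) * (0.45375 * n) / M) + (lp + lq + t) * (0.45375 * n) ≤
        M * (0.75 * M) ∧
      0.3 * n * (X + (lp + lq + t) * (0.45375 * n) / M) + (lp + lq + t) * (0.45375 * n) ≤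
        M * (0.75 * X) ∧
      0.605 * n + (lp + lq + t) * (0.45375 * n) / M +
        ((lp + lq) * (0.45375 * n) + t * η) ≤ M * η := by
  have hn0 : 0 < n := by linarith
  have hM0 : 0 < M := by linarith
  obtain ⟨l, hldef⟩ : ∃ l, l = lp + lq := ⟨_, rfl⟩
  obtain ⟨η, hη⟩ : ∃ η, η = 1.4 + l := ⟨_, rfl⟩
  obtain ⟨E, hE⟩ : ∃ E, E = (0.27 + 0.2 * l) / n := ⟨_, rfl⟩
  have hEn : E * n = 0.27 + 0.2 * l := by rw [hE]; field_simp
  obtain ⟨c, hc⟩ : ∃ c, c = 0.225 * n / M := ⟨_, rfl⟩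
  have hcM : c * M = 0.225 * n := by rw [hc]; field_simp
  have hc0 : 0 ≤ c := by rw [hc]; positivity
  have hc1 : c ≤ 0.4514 := by
    rw [hc, div_le_iff₀ hM0]; linarith
  obtain ⟨X, hX⟩ : ∃ X, X = q + c * lp + E := ⟨_, rfl⟩
  have hl0 : 0 ≤ l := by linarith
  have hE0 : 0 ≤ E := by rw [hE]; positivity
  have hE1 : E ≤ 0.0002 + 0.00015 * l := by
    rw [hE, div_le_iff₀ hn0]; nlinarith
  have hX1 : 0.395 * n ≤ X := by
    have := mul_nonneg hc0 hlp
    linarith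
  have hX2 : X ≤ 0.605 * n := by
    have : c * lp ≤ 0.4514 * lp := mul_le_mul_of_nonneg_right hc1 hlp
    linarith
  have hX0 : 0 < X := by linarith
  have hη0 : 0 < η := by linarith
  have htη : t * η ≤ 0.037 * n * η := mul_le_mul_of_nonneg_right (by linarith) hη0.le
  have hMM : 0.2485 * n ^ 2 ≤ M ^ 2 := by nlinarith only [hM1, hn0]
  have hMX : 0.1969 * n ^ 2 ≤ M * X := by
    have := mul_le_mul hM1 hX1 (by positivity) hM0.le
    nlinarith only [this, hn0]
  have hEn2 : E * n ^ 2 = (0.27 + 0.2 * l) * n := by rw [← hEn]; ring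
  have h1 : t * η ≤ E * M ^ 2 := by
    have := mul_le_mul_of_nonneg_left hMM hE0
    have h := mul_nonneg hl0 hn0.le
    rw [hη] at htη ⊢
    linarith only [this, h, htη, hEn2, hn0]
  have h2 : t * η ≤ E * (M * X) := by
    have := mul_le_mul_of_nonneg_left hMX hE0
    have h := mul_nonneg hl0 hn0.le
    rw [hη] at htη ⊢
    linarith only [this, h, htη, hEn2, hn0]
  have hnn : 0 < n * n := mul_pos hn0 hn0
  have hT' : (lp + lq + t) * (0.45375 * n) ≤ 0.01679 * (n * n) := by
    have := mul_le_mul_of_nonneg_right hl hn0.le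
    linarith
  have hnM : 0.4985 * (n * n) ≤ n * M := by
    have := mul_le_mul_of_nonneg_left hM1 hn0.le
    linarith
  have hT : (lp + lq + t) * (0.45375 * n) / M ≤ 0.03369 * n := by
    rw [div_le_iff₀ hM0]
    linarith
  have hTn : n * ((lp + lq + t) * (0.45375 * n) / M) ≤ n * (0.03369 * n) :=
    mul_le_mul_of_nonneg_left hT hn0.le
  refine ⟨X, η, hX0, hη0, hX2, by linarith, ?_, ?_, ?_, ?_, ?_⟩
  · have : (lp * (0.3 * n * (0.75 * M)) + t * η) / M ≤ c * M * lp + E * M := by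
      rw [div_le_iff₀ hM0, hcM]
      linarith only [h1]
    rw [hX]
    linarith only [this]
  · have : (lq * (0.3 * n * (0.75 * X)) + t * η) / M ≤ X * (c * lq + E) := by
      rw [div_le_iff₀ hM0]
      have : X * (c * lq + E) * M = X * lq * (c * M) + E * (M * X) := by ring
      rw [this, hcM]
      nlinarith only [h2]
    have hcl : c * l ≤ 0.4514 * l := mul_le_mul_of_nonneg_right hc1 hl0
    have hXY : X + (p + c * lq + E) ≤ 2 * M := by
      have : c * lp + c * lq = c * l := by rw [hldef]; ring
      rcases le_total l 2 with h | h <;> linarith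
    obtain ⟨Y, hY⟩ : ∃ Y, Y = p + c * lq + E := ⟨_, rfl⟩
    rw [← hY] at hXY
    have hY0 : 0 ≤ Y := by
      have := mul_nonneg hc0 hlq
      linarith only [hY, this, hE0, hp, hn0]
    have : X * Y ≤ M * M := by
      nlinarith only [sq_nonneg (X - Y), hXY, hX0, hY0, hM0]
    rw [hY] at this
    linarith only [this, ‹(lq * (0.3 * n * (0.75 * X)) + t * η) / M ≤ X * (c * lq + E)›]
  · have : 0.4985 * (n * M) ≤ M * M := by
      have := mul_le_mul_of_nonneg_right hM1 hM0.le
      linarith only [this]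
    linarith only [this, hTn, hT', hnM, hnn]
  · have h3 : 0.4985 * (n * X) ≤ M * X := by
      have := mul_le_mul_of_nonneg_right hM1 hX0.le
      linarith only [this]
    have h4 : 0.395 * (n * n) ≤ n * X := by
      have := mul_le_mul_of_nonneg_left hX1 hn0.le
      linarith only [this]
    linarith only [h3, h4, hTn, hT', hnn]
  · have h3 : t * η + l * (0.45375 * n) ≤ 0.037 * n * η + 0.45375 * n * l := by
      linarith only [htη]
    have h4 : 0.4985 * n * η ≤ M * η := mul_le_mul_of_nonneg_right hM1 hη0.le
    have := mul_nonneg hl0 hn0.le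
    rw [← hldef] at hT ⊢
    rw [hη] at h3 h4 ⊢
    linarith only [h3, h4, this, hT, hn0]

variable {V : Type*} {G : SimpleGraph V}

lemma sum_sum_nbrIn_comm (S T : Finset V) (f : V → ℝ) :
    ∑ v ∈ S, ∑ w ∈ nbrIn G v T, f w = ∑ w ∈ T, ((nbrIn G w S).card : ℝ) * f w := by
  rw [sum_comm' (t' := T) (s' := fun w => nbrIn G w S)]
  · simp [sum_const]
  · intro v w
    simp only [mem_nbrIn, G.adj_comm w v]
    tauto

lemma sum_nbrIn_le (v : V) (S : Finset V) {f : V → ℝ} {c : ℝ} (h : ∀ w ∈ S, f w ≤ c) :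
    ∑ w ∈ nbrIn G v S, f w ≤ (nbrIn G v S).card * c := by
  rw [← nsmul_eq_mul]
  exact sum_le_card_nsmul _ _ _ fun w hw => h w (mem_nbrIn.1 hw).1

variable [DecidableEq V]

lemma sum_nbrIn_union (v : V) {S T : Finset V} (h : Disjoint S T) (f : V → ℝ) :
    ∑ w ∈ nbrIn G v (S ∪ T), f w = ∑ w ∈ nbrIn G v S, f w + ∑ w ∈ nbrIn G v T, f w := by
  rw [← sum_union]
  · congr 1
    ext w
    simp only [mem_nbrIn, mem_union]
    tauto
  · exact h.mono (nbrIn_subset _ _) (nbrIn_subset _ _)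

variable [Fintype V]

/-- A Collatz-Wielandt bound for a graph with two independent sets `P`, `Q`, vertices `L`, `L'`
attached to one of them, and remaining vertices having at most one neighbour in `P ∪ Q`. -/
lemma IsEigPair.le_of_partition {μ : ℝ} {x : V → ℝ} (h : IsEigPair G μ x)
    {P Q L L' R : Finset V} (hPQ : Disjoint P Q) (hLL : Disjoint L L')
    (hLR : Disjoint (L ∪ L') R) (hO : (P ∪ Q)ᶜ = L ∪ L' ∪ R)
    (hP : ∀ u ∈ P, ∀ v ∈ P, ¬ G.Adj u v) (hQ : ∀ u ∈ Q, ∀ v ∈ Q, ¬ G.Adj u v)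
    (hLP : ∀ w ∈ L, ∀ v ∈ P, ¬ G.Adj w v) (hLQ : ∀ w ∈ L', ∀ v ∈ Q, ¬ G.Adj w v)
    (hR : ∀ w ∈ R, (nbrIn G w (P ∪ Q)).card ≤ 1)
    {M X a b η B D W : ℝ} (hM0 : 0 < M) (hX0 : 0 < X) (ha0 : 0 < a) (hb0 : 0 < b) (hη0 : 0 < η)
    (hXB : X ≤ B) (hMB : M ≤ B) (haW : a ≤ W) (hbW : b ≤ W) (hηW : η ≤ W)
    (hLD : ∀ w ∈ L, ((nbrIn G w Q).card : ℝ) ≤ D)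
    (hLD' : ∀ w ∈ L', ((nbrIn G w P).card : ℝ) ≤ D)
    (h1 : Q.card * M + (L.card * (D * a) + R.card * η) / M ≤ M * X)
    (h2 : P.card * X + (L'.card * (D * b) + R.card * η) / M ≤ M * M)
    (h3 : D * (M + (L.card + L'.card + R.card) * W / M) + (L.card + L'.card + R.card) * W ≤ M * a)
    (h4 : D * (X + (L.card + L'.card + R.card) * W / M) + (L.card + L'.card + R.card) * W ≤ M * b)
    (h5 : B + (L.card + L'.card + R.card) * W / M + ((L.card + L'.card) * W + R.card * η) ≤
      M * η) : μ ≤ M := by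
  classical
  let zO : V → ℝ := fun w => if w ∈ L then a else if w ∈ L' then b else η
  have zO_L : ∀ w ∈ L, zO w = a := fun w hw => if_pos hw
  have zO_L' : ∀ w ∈ L', zO w = b := fun w hw => by
    simp [zO, hw, disjoint_right.1 hLL hw]
  have zO_R : ∀ w ∈ R, zO w = η := fun w hw => by
    have := disjoint_right.1 hLR hw
    simp only [mem_union, not_or] at this
    simp [zO, this]
  have zO_pos : ∀ w, 0 < zO w := fun w => by
    simp only [zO]; split_ifs <;> assumption
  have zO_le : ∀ w, zO w ≤ W := fun w => by
    simp only [zO]; split_ifs <;> assumption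
  have hW0 : 0 < W := ha0.trans_le haW
  obtain ⟨O, hOdef⟩ : ∃ O, O = L ∪ L' ∪ R := ⟨_, rfl⟩
  have hOc : (P ∪ Q)ᶜ = O := by rw [hO, hOdef]
  have hOcard : (O.card : ℝ) = L.card + L'.card + R.card := by
    rw [hOdef, card_union_of_disjoint hLR, card_union_of_disjoint hLL]; push_cast; rfl
  have hPO : ∀ w ∈ O, w ∉ P := fun w hw => by
    rw [← hOc, mem_compl, mem_union, not_or] at hw; exact hw.1
  have hQO : ∀ w ∈ O, w ∉ Q := fun w hw => by
    rw [← hOc, mem_compl, mem_union, not_or] at hw; exact hw.2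
  let S : V → ℝ := fun v => ∑ w ∈ nbrIn G v O, zO w
  have S_nonneg : ∀ v, 0 ≤ S v := fun v => sum_nonneg fun w _ => (zO_pos w).le
  have S_le : ∀ v, S v ≤ (L.card + L'.card + R.card) * W := fun v => by
    refine (sum_nbrIn_le v O fun w _ => zO_le w).trans ?_
    rw [← hOcard]
    exact mul_le_mul_of_nonneg_right (by exact_mod_cast nbrIn_card_le v O) hW0.le
  have S_div : ∀ v, S v / M ≤ (L.card + L'.card + R.card) * W / M := fun v =>
    div_le_div_of_nonneg_right (S_le v) hM0.le
  have sum_O : ∀ T : Finset V, ∑ v ∈ T, S v = ∑ w ∈ L, ((nbrIn G w T).card : ℝ) * zO w +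
      ∑ w ∈ L', ((nbrIn G w T).card : ℝ) * zO w + ∑ w ∈ R, ((nbrIn G w T).card : ℝ) * zO w := by
    intro T
    simp only [S]
    rw [sum_sum_nbrIn_comm, hOdef, sum_union hLR, sum_union hLL]
  have sum_R : ∀ T ⊆ P ∪ Q, ∑ w ∈ R, ((nbrIn G w T).card : ℝ) * zO w ≤ R.card * η := by
    intro T hT
    rw [← nsmul_eq_mul]
    refine sum_le_card_nsmul _ _ _ fun w hw => ?_
    rw [zO_R w hw]
    have h6 : (nbrIn G w T).card ≤ (nbrIn G w (P ∪ Q)).card := card_le_card fun v hv => by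
      rw [mem_nbrIn] at hv ⊢
      exact ⟨hT hv.1, hv.2⟩
    have h7 : ((nbrIn G w T).card : ℝ) ≤ 1 := by exact_mod_cast h6.trans (hR w hw)
    nlinarith
  have nbrIn_empty : ∀ w (T : Finset V), (∀ v ∈ T, ¬ G.Adj w v) → nbrIn G w T = ∅ := by
    intro w T hT
    ext v
    simpa using hT v
  have sum_Q : ∑ v ∈ Q, S v ≤ L.card * (D * a) + R.card * η := by
    rw [sum_O]
    have h6 : ∑ w ∈ L, ((nbrIn G w Q).card : ℝ) * zO w ≤ L.card * (D * a) := by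
      rw [← nsmul_eq_mul]
      refine sum_le_card_nsmul _ _ _ fun w hw => ?_
      rw [zO_L w hw]
      exact mul_le_mul_of_nonneg_right (hLD w hw) ha0.le
    have h7 : ∑ w ∈ L', ((nbrIn G w Q).card : ℝ) * zO w = 0 := sum_eq_zero fun w hw => by
      rw [nbrIn_empty w Q (hLQ w hw)]; simp
    linarith [sum_R Q subset_union_right]
  have sum_P : ∑ v ∈ P, S v ≤ L'.card * (D * b) + R.card * η := by
    rw [sum_O]
    have h6 : ∑ w ∈ L', ((nbrIn G w P).card : ℝ) * zO w ≤ L'.card * (D * b) := by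
      rw [← nsmul_eq_mul]
      refine sum_le_card_nsmul _ _ _ fun w hw => ?_
      rw [zO_L' w hw]
      exact mul_le_mul_of_nonneg_right (hLD' w hw) hb0.le
    have h7 : ∑ w ∈ L, ((nbrIn G w P).card : ℝ) * zO w = 0 := sum_eq_zero fun w hw => by
      rw [nbrIn_empty w P (hLP w hw)]; simp
    linarith [sum_R P subset_union_left]
  let z : V → ℝ := fun v => if v ∈ P then X + S v / M else if v ∈ Q then M + S v / M else zO v
  have z_P : ∀ v ∈ P, z v = X + S v / M := fun v hv => if_pos hv
  have z_Q : ∀ v ∈ Q, z v = M + S v / M := fun v hv => by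
    simp [z, hv, disjoint_right.1 hPQ hv]
  have z_O : ∀ v ∈ O, z v = zO v := fun v hv => by simp [z, hPO v hv, hQO v hv]
  have hS0 : ∀ v, 0 ≤ S v / M := fun v => div_nonneg (S_nonneg v) hM0.le
  have split : ∀ v, ∑ w ∈ nbrIn G v univ, z w =
      ∑ w ∈ nbrIn G v P, (X + S w / M) + ∑ w ∈ nbrIn G v Q, (M + S w / M) + S v := by
    intro v
    have : (univ : Finset V) = (P ∪ Q) ∪ O := by rw [← hOc, union_compl]
    rw [this, sum_nbrIn_union v (by rw [← hOc]; exact disjoint_compl_right),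
      sum_nbrIn_union v hPQ]
    congr 1
    · congr 1
      · exact sum_congr rfl fun w hw => z_P w (mem_nbrIn.1 hw).1
      · exact sum_congr rfl fun w hw => z_Q w (mem_nbrIn.1 hw).1
    · exact sum_congr rfl fun w hw => z_O w (mem_nbrIn.1 hw).1
  refine h.le_of_sum_le (z := z) (fun v => ?_) fun v => ?_
  · simp only [z]
    split_ifs
    · linarith [hS0 v]
    · linarith [hS0 v]
    · exact zO_pos v
  rw [split]
  by_cases hvP : v ∈ P
  · rw [nbrIn_empty v P (hP v hvP), sum_empty, z_P v hvP]
    have h6 : ∑ w ∈ nbrIn G v Q, (M + S w / M) ≤ Q.card * M + (∑ w ∈ Q, S w) / M := by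
      rw [sum_div, ← nsmul_eq_mul, ← sum_const, ← sum_add_distrib]
      exact sum_le_sum_of_subset_of_nonneg (nbrIn_subset v Q) fun w _ _ => by linarith [hS0 w]
    have h7 := div_le_div_of_nonneg_right sum_Q hM0.le
    have h8 : M * (X + S v / M) = M * X + S v := by field_simp
    linarith
  by_cases hvQ : v ∈ Q
  · rw [nbrIn_empty v Q (hQ v hvQ), sum_empty, z_Q v hvQ]
    have h6 : ∑ w ∈ nbrIn G v P, (X + S w / M) ≤ P.card * X + (∑ w ∈ P, S w) / M := by
      rw [sum_div, ← nsmul_eq_mul, ← sum_const, ← sum_add_distrib]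
      exact sum_le_sum_of_subset_of_nonneg (nbrIn_subset v P) fun w _ _ => by linarith [hS0 w]
    have h7 := div_le_div_of_nonneg_right sum_P hM0.le
    have h8 : M * (M + S v / M) = M * M + S v := by field_simp
    linarith
  have hvO : v ∈ O := by rw [← hOc]; simp [hvP, hvQ]
  rw [z_O v hvO]
  have sP : ∑ w ∈ nbrIn G v P, (X + S w / M) ≤
      (nbrIn G v P).card * (X + (L.card + L'.card + R.card) * W / M) :=
    sum_nbrIn_le v P fun w _ => by linarith [S_div w]
  have sQ : ∑ w ∈ nbrIn G v Q, (M + S w / M) ≤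
      (nbrIn G v Q).card * (M + (L.card + L'.card + R.card) * W / M) :=
    sum_nbrIn_le v Q fun w _ => by linarith [S_div w]
  have hT0 : 0 ≤ (L.card + L'.card + R.card) * W / M := by positivity
  rw [hOdef, mem_union, mem_union] at hvO
  rcases hvO with (hv | hv) | hv
  · rw [nbrIn_empty v P (hLP v hv), sum_empty, zO_L v hv]
    have := mul_le_mul_of_nonneg_right (hLD v hv)
      (show 0 ≤ M + (L.card + L'.card + R.card) * W / M by linarith)
    linarith [S_le v]
  · rw [nbrIn_empty v Q (hLQ v hv), sum_empty, zO_L' v hv]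
    have := mul_le_mul_of_nonneg_right (hLD' v hv)
      (show 0 ≤ X + (L.card + L'.card + R.card) * W / M by linarith)
    linarith [S_le v]
  · rw [zO_R v hv]
    have hS : S v ≤ (L.card + L'.card) * W + R.card * η := by
      simp only [S]
      rw [hOdef, sum_nbrIn_union v hLR]
      refine add_le_add ((sum_nbrIn_le v _ fun w _ => zO_le w).trans ?_)
        ((sum_nbrIn_le v _ fun w hw => (zO_R w hw).le).trans ?_)
      · refine mul_le_mul_of_nonneg_right ?_ hW0.le
        rw [← Nat.cast_add, ← card_union_of_disjoint hLL]
        exact_mod_cast nbrIn_card_le v _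
      · exact mul_le_mul_of_nonneg_right (by exact_mod_cast nbrIn_card_le v _) hη0.le
    have hc : ((nbrIn G v P).card : ℝ) + (nbrIn G v Q).card ≤ 1 := by
      have := hR v hv
      rw [nbrIn_union_card v hPQ] at this
      exact_mod_cast this
    have hB0 : 0 ≤ B + (L.card + L'.card + R.card) * W / M := by linarith
    have h6 := mul_le_mul_of_nonneg_left
      (show X + (L.card + L'.card + R.card) * W / M ≤ B + (L.card + L'.card + R.card) * W / M by
        linarith) (Nat.cast_nonneg (α := ℝ) (nbrIn G v P).card)
    have h7 := mul_le_mul_of_nonneg_left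
      (show M + (L.card + L'.card + R.card) * W / M ≤ B + (L.card + L'.card + R.card) * W / M by
        linarith) (Nat.cast_nonneg (α := ℝ) (nbrIn G v Q).card)
    have h8 := mul_le_mul_of_nonneg_right hc hB0
    linarith

end SpectralBound

section Structure
variable {V : Type*} [DecidableEq V] {G : SimpleGraph V}

lemma forall_insert_not_adj {I : Finset V} (hI : ∀ u ∈ I, ∀ v ∈ I, ¬ G.Adj u v) {w : V}
    (hw : ∀ u ∈ I, ¬ G.Adj w u) : ∀ u ∈ insert w I, ∀ v ∈ insert w I, ¬ G.Adj u v := by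
  intro u hu v hv
  rw [mem_insert] at hu hv
  rcases hu with rfl | hu <;> rcases hv with rfl | hv
  · exact G.irrefl
  · exact hw v hv
  · exact fun h => hw u hu h.symm
  · exact hI u hu v hv

variable [Fintype V]

lemma exists_classes {P Q : Finset V} (h : Disjoint P Q) {b : V} (hb : b ∈ Q) :
    ∃ col : V → Fin 4, (∀ v, col v = 0 ↔ v = b) ∧ (∀ v, col v = 1 ↔ v ∈ Q.erase b) ∧
      (∀ v, col v = 2 ↔ v ∈ P) ∧ ∀ v, col v = 3 ↔ v ∈ (P ∪ Q)ᶜ := by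
  have hPQ : ∀ v ∈ P, v ∉ Q := fun v hv => Finset.disjoint_left.1 h hv
  refine ⟨fun v => if v = b then 0 else if v ∈ Q then 1 else if v ∈ P then 2 else 3,
    fun v => ?_, fun v => ?_, fun v => ?_, fun v => ?_⟩ <;>
  · have := hPQ v
    by_cases h1 : v = b
    · subst h1
      have : v ∉ P := fun hv => hPQ v hv hb
      simp [hb, this]
    · by_cases h2 : v ∈ Q <;> by_cases h3 : v ∈ P <;> simp_all

lemma colorable_of_indep {I J : Finset V} (hI : ∀ u ∈ I, ∀ v ∈ I, ¬ G.Adj u v)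
    (hJ : ∀ u ∈ J, ∀ v ∈ J, ¬ G.Adj u v) {j : ℕ} (hj : ((I ∪ J)ᶜ).card ≤ j) :
    G.Colorable (j + 2) := by
  let c : V → Option (Option {v // v ∈ (I ∪ J)ᶜ}) := fun v =>
    if v ∈ I then none else if v ∈ J then some none else
      if hv : v ∈ (I ∪ J)ᶜ then some (some ⟨v, hv⟩) else none
  have hc : ∀ {u v : V}, G.Adj u v → c u ≠ c v := by
    intro u v huv he
    by_cases hu : u ∈ I
    · by_cases hv : v ∈ I
      · exact hI u hu v hv huv
      · by_cases hv' : v ∈ J <;> simp [c, hu, hv, hv'] at he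
    by_cases hu' : u ∈ J
    · by_cases hv : v ∈ I
      · simp [c, hu, hu', hv] at he
      · by_cases hv' : v ∈ J
        · exact hJ u hu' v hv' huv
        · simp [c, hu, hu', hv, hv'] at he
    by_cases hv : v ∈ I
    · simp [c, hu, hu', hv] at he
    by_cases hv' : v ∈ J
    · simp [c, hu, hu', hv, hv'] at he
    simp only [c, hu, hu', hv, hv', mem_compl, mem_union, or_self, not_false_eq_true, if_false,
      dite_true, Option.some.injEq, Subtype.mk.injEq] at he
    exact huv.ne he
  have := (Coloring.mk c hc).colorable
  refine this.mono ?_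
  rw [Fintype.card_option, Fintype.card_option, Fintype.card_coe]
  omega

/-- The vertices outside `P ∪ Q` with at least two neighbours in `Q`. -/
noncomputable def attached (G : SimpleGraph V) (P Q : Finset V) : Finset V :=
  univ.filter fun w => w ∉ P ∧ w ∉ Q ∧ 2 ≤ (nbrIn G w Q).card

lemma mem_attached {P Q : Finset V} {w : V} :
    w ∈ attached G P Q ↔ w ∉ P ∧ w ∉ Q ∧ 2 ≤ (nbrIn G w Q).card := by
  simp [attached]

lemma exists_ne_of_mem_attached {P Q : Finset V} {w : V} (hw : w ∈ attached G P Q) (a : V) :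
    ∃ b ∈ Q, b ≠ a ∧ G.Adj w b := by
  obtain ⟨b, hb, hba⟩ := exists_mem_ne (show 1 < (nbrIn G w Q).card from (mem_attached.1 hw).2.2) a
  rw [mem_nbrIn] at hb
  exact ⟨b, hb.1, hba, hb.2⟩

namespace IsCore
variable {m k r : ℕ} {P Q : Finset V}

lemma not_adj_of_mem_attached (h : IsCore G m P Q) (hm : 2 * k + 8 ≤ m) (hk : 2 ≤ k)
    (hfree : G.CycleFree (2 * k + 1)) : ∀ w ∈ attached G P Q, ∀ v ∈ P, ¬ G.Adj w v := by
  intro w hw v hv hwv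
  obtain ⟨b, hb, -, hwb⟩ := exists_ne_of_mem_attached hw w
  exact h.not_adj_both hm hk hfree hv hb hwv hwb

lemma union_attached_indep (h : IsCore G m P Q) (hm : 2 * k + 8 ≤ m) (hk : 2 ≤ k)
    (hfree : G.CycleFree (2 * k + 1)) :
    ∀ u ∈ P ∪ attached G P Q, ∀ v ∈ P ∪ attached G P Q, ¬ G.Adj u v := by
  intro u hu v hv
  rw [mem_union] at hu hv
  rcases hu with hu | hu <;> rcases hv with hv | hv
  · exact h.left_indep hm hk hfree u hu v hv
  · exact fun huv => h.not_adj_of_mem_attached hm hk hfree v hv u hu huv.symm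
  · exact h.not_adj_of_mem_attached hm hk hfree u hu v hv
  · obtain ⟨a, ha, -, hua⟩ := exists_ne_of_mem_attached hu u
    obtain ⟨b, hb, hba, hvb⟩ := exists_ne_of_mem_attached hv a
    exact h.symm.not_adj_of_nbrs_ne hm hk hfree (mem_attached.1 hu).2.1 (mem_attached.1 hv).2.1
      ha hb hba.symm hua hvb

lemma not_adj_left_attached (h : IsCore G m P Q) (hm : 2 * k + 8 ≤ m) (hk : 2 ≤ k)
    (hfree : G.CycleFree (2 * k + 1)) {w a b : V} (hw : w ∉ P) (ha : a ∈ P)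
    (hb : b ∈ attached G Q P) (hwa : G.Adj w a) (hwb : G.Adj w b) : False := by
  obtain ⟨c, hc, hca, hbc⟩ := exists_ne_of_mem_attached hb a
  exact h.not_adj_of_nbrs_ne hm hk hfree hw (mem_attached.1 hb).2.1 ha hc hca.symm hwa hbc hwb

lemma disjoint_attached (h : IsCore G m P Q) (hm : 2 * k + 8 ≤ m) (hk : 2 ≤ k)
    (hfree : G.CycleFree (2 * k + 1)) : Disjoint (attached G P Q) (attached G Q P) := by
  rw [Finset.disjoint_left]
  intro w hw hw'
  obtain ⟨b, hb, -, hwb⟩ := exists_ne_of_mem_attached hw' w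
  exact h.not_adj_of_mem_attached hm hk hfree w hw b hb hwb

/-- A vertex outside the core that is attached to neither part has at most one neighbour in it. -/
lemma card_nbrIn_le_one (h : IsCore G m P Q) (hm : 2 * k + 8 ≤ m) (hk : 2 ≤ k)
    (hfree : G.CycleFree (2 * k + 1)) {w : V} (hwP : w ∉ P) (hwQ : w ∉ Q)
    (h1 : w ∉ attached G P Q) (h2 : w ∉ attached G Q P) : (nbrIn G w (P ∪ Q)).card ≤ 1 := by
  rw [nbrIn_union_card w h.disj]
  simp only [mem_attached, hwP, hwQ, not_false_eq_true, true_and, not_le] at h1 h2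
  rcases (nbrIn G w P).eq_empty_or_nonempty with h3 | ⟨a, ha⟩
  · rw [h3, card_empty]; omega
  rcases (nbrIn G w Q).eq_empty_or_nonempty with h4 | ⟨b, hb⟩
  · rw [h4, card_empty]; omega
  rw [mem_nbrIn] at ha hb
  exact (h.not_adj_both hm hk hfree ha.1 hb.1 ha.2 hb.2).elim

/-- If there are few vertices outside `P ∪ Q`, then none of them are attached to a part. -/
lemma card_compl_dichotomy (h : IsCore G m P Q) (hm : 2 * k + 8 ≤ m) (hk : 2 ≤ k)
    (hfree : G.CycleFree (2 * k + 1)) (hr : 3 ≤ r) (hcol : ¬ G.Colorable (r - 1)) :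
    (attached G P Q = ∅ ∧ attached G Q P = ∅ ∧ ((P ∪ Q)ᶜ).card + 1 = r) ∨
    (r ≤ ((P ∪ Q)ᶜ).card ∧ (attached G P Q).card + (attached G Q P).card + 2 * r ≤
      2 * ((P ∪ Q)ᶜ).card + 2) := by
  have hI := h.union_attached_indep hm hk hfree
  have hJ := h.symm.union_attached_indep hm hk hfree
  have hdisj := h.disjoint_attached hm hk hfree
  set L := attached G P Q with hL
  set L' := attached G Q P with hL'
  obtain ⟨R, hR⟩ : ∃ R, R = ((P ∪ L) ∪ (Q ∪ L'))ᶜ := ⟨_, rfl⟩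
  have hLR : Disjoint (L ∪ L') R := by
    rw [hR, disjoint_compl_right_iff]
    intro x hx
    simp only [mem_union] at hx ⊢
    tauto
  have hO : (P ∪ Q)ᶜ = L ∪ L' ∪ R := by
    ext x
    have h1 : x ∈ L → x ∉ P ∧ x ∉ Q := fun hx => ⟨(mem_attached.1 hx).1, (mem_attached.1 hx).2.1⟩
    have h2 : x ∈ L' → x ∉ Q ∧ x ∉ P := fun hx => ⟨(mem_attached.1 hx).1, (mem_attached.1 hx).2.1⟩
    simp only [hR, mem_compl, mem_union]
    tauto
  have hcard : ((P ∪ Q)ᶜ).card = L.card + L'.card + R.card := by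
    rw [hO, card_union_of_disjoint hLR, card_union_of_disjoint hdisj]
  have h1 : r ≤ R.card + 2 := by
    by_contra hlt
    refine hcol ((colorable_of_indep hI hJ (j := R.card) (by rw [hR])).mono (by omega))
  have h2 : R.card + 2 = r → 2 ≤ L.card + L'.card := by
    intro hRr
    by_contra hlt
    obtain ⟨w, hw⟩ : R.Nonempty := card_pos.1 (by omega)
    have hw' := hw
    rw [hR] at hw'
    simp only [mem_compl, mem_union, not_or] at hw'
    have hcard' : (R.erase w).card = r - 3 := by rw [card_erase_of_mem hw]; omega
    by_cases hwI : ∀ u ∈ P ∪ L, ¬ G.Adj w u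
    · refine hcol ((colorable_of_indep (forall_insert_not_adj hI hwI) hJ (j := r - 3) ?_).mono
        (by omega))
      rw [← hcard', hR]
      refine card_le_card fun x hx => ?_
      simp only [mem_erase, mem_compl, mem_union, mem_insert, not_or] at hx ⊢
      tauto
    by_cases hwJ : ∀ u ∈ Q ∪ L', ¬ G.Adj w u
    · refine hcol ((colorable_of_indep hI (forall_insert_not_adj hJ hwJ) (j := r - 3) ?_).mono
        (by omega))
      rw [← hcard', hR]
      refine card_le_card fun x hx => ?_
      simp only [mem_erase, mem_compl, mem_union, mem_insert, not_or] at hx ⊢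
      tauto
    push Not at hwI hwJ
    obtain ⟨a, ha, hwa⟩ := hwI
    obtain ⟨b, hb, hwb⟩ := hwJ
    rw [mem_union] at ha hb
    rcases ha with ha | ha <;> rcases hb with hb | hb
    · exact h.not_adj_both hm hk hfree ha hb hwa hwb
    · exact h.not_adj_left_attached hm hk hfree hw'.1.1 ha hb hwa hwb
    · exact h.symm.not_adj_left_attached hm hk hfree hw'.2.1 hb ha hwb hwa
    · have := card_pos.2 ⟨a, ha⟩
      have := card_pos.2 ⟨b, hb⟩
      omega
  by_cases h3 : R.card + 1 = r ∧ L.card + L'.card = 0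
  · left
    refine ⟨card_eq_zero.1 (by omega), card_eq_zero.1 (by omega), by omega⟩
  · right
    omega

/-- If every vertex outside the core has exactly one neighbour in `Q`, then `G` is contained in a
complete bipartite graph with a suspended clique. -/
lemma exists_le_suspGraph_of_right (h : IsCore G m P Q) (hm : 2 * k + 8 ≤ m) (hk : 2 ≤ k)
    (hfree : G.CycleFree (2 * k + 1)) (hr : 3 ≤ r) (hcol : ¬ G.Colorable (r - 1))
    (hL : attached G P Q = ∅) (hO : ((P ∪ Q)ᶜ).card + 1 = r)
    (hQ : ∀ w ∈ (P ∪ Q)ᶜ, ∃ b ∈ Q, G.Adj w b) :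
    ∃ col : V → Fin 4, G ≤ suspGraph col ∧ HasSuspSizes col P.card Q.card r := by
  have hPi := h.left_indep hm hk hfree
  have hQi := h.symm.left_indep hm hk hfree
  have hOmem : ∀ {w}, w ∈ (P ∪ Q)ᶜ ↔ w ∉ P ∧ w ∉ Q := by simp
  have hwP : ∀ w ∈ (P ∪ Q)ᶜ, ∀ v ∈ P, ¬ G.Adj w v := by
    intro w hw v hv hwv
    obtain ⟨b, hb, hwb⟩ := hQ w hw
    exact h.not_adj_both hm hk hfree hv hb hwv hwb
  have hone : ∀ w ∈ (P ∪ Q)ᶜ, ∀ b ∈ Q, ∀ b' ∈ Q, G.Adj w b → G.Adj w b' → b = b' := by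
    intro w hw b hb b' hb' hwb hwb'
    have : w ∉ attached G P Q := by simp [hL]
    simp only [mem_attached, (hOmem.1 hw).1, (hOmem.1 hw).2, not_false_eq_true, true_and,
      not_le] at this
    exact card_le_one.1 (Nat.lt_succ_iff.1 this) b (by simp [hb, hwb]) b' (by simp [hb', hwb'])
  have hclique : ∀ w ∈ (P ∪ Q)ᶜ, ∀ w' ∈ (P ∪ Q)ᶜ, w ≠ w' → G.Adj w w' := by
    intro w hw w' hw' hne
    by_contra hww
    have h1 := forall_insert_not_adj hPi (hwP w hw)
    have h2 : ∀ u ∈ insert w P, ¬ G.Adj w' u := by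
      intro u hu
      rw [mem_insert] at hu
      rcases hu with rfl | hu
      · exact fun hh => hww hh.symm
      · exact hwP w' hw' u hu
    refine hcol ((colorable_of_indep (forall_insert_not_adj h1 h2) hQi (j := r - 3) ?_).mono
      (by omega))
    have h3 : (((P ∪ Q)ᶜ.erase w).erase w').card = r - 3 := by
      rw [card_erase_of_mem (by simp only [mem_erase]; exact ⟨hne.symm, hw'⟩),
        card_erase_of_mem hw]
      omega
    rw [← h3]
    refine card_le_card fun x hx => ?_
    simp only [mem_erase, mem_compl, mem_union, mem_insert, not_or] at hx ⊢
    tauto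
  obtain ⟨w₀, hw₀⟩ : ((P ∪ Q)ᶜ).Nonempty := card_pos.1 (by omega)
  obtain ⟨b, hb, hwb⟩ := hQ w₀ hw₀
  have hb' : ∀ w ∈ (P ∪ Q)ᶜ, ∀ c ∈ Q, G.Adj w c → c = b := by
    intro w hw c hc hwc
    by_contra hcb
    have hne : w ≠ w₀ := by
      rintro rfl
      exact hcb (hone w hw c hc b hb hwc hwb)
    exact h.symm.not_adj_of_nbrs_ne hm hk hfree (hOmem.1 hw).2 (hOmem.1 hw₀).2 hc hb hcb hwc hwb
      (hclique w hw w₀ hw₀ hne)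
  have hbP : b ∉ P := Finset.disjoint_right.1 h.disj hb
  obtain ⟨col, col0, col1, col2, col3⟩ := exists_classes h.disj hb
  have cases : ∀ v, v = b ∨ v ∈ Q.erase b ∨ v ∈ P ∨ v ∈ (P ∪ Q)ᶜ := fun v => by
    rw [hOmem, mem_erase]; tauto
  refine ⟨col, fun u v huv => ⟨huv.ne, ?_⟩, ?_, ?_, ?_, ?_⟩
  · have key : ∀ u v, G.Adj u v → u ∈ (P ∪ Q)ᶜ → suspRel (col u) (col v) := by
      intro u v huv hu
      rw [(col3 u).2 hu]
      rcases cases v with hv | hv | hv | hv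
      · rw [(col0 v).2 hv]; decide
      · exact ((mem_erase.1 hv).1 (hb' u hu v (mem_erase.1 hv).2 huv)).elim
      · exact (hwP u hu v hv huv).elim
      · rw [(col3 v).2 hv]; decide
    have key' : ∀ u v, G.Adj u v → u ∈ P → suspRel (col u) (col v) := by
      intro u v huv hu
      rcases cases v with hv | hv | hv | hv
      · rw [(col2 u).2 hu, (col0 v).2 hv]; decide
      · rw [(col2 u).2 hu, (col1 v).2 hv]; decide
      · exact (hPi u hu v hv huv).elim
      · exact suspRel_symm (key v u huv.symm hv)
    by_cases hu : u ∈ P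
    · exact key' u v huv hu
    by_cases hv : v ∈ P
    · exact suspRel_symm (key' v u huv.symm hv)
    by_cases hu' : u ∈ Q
    · by_cases hv' : v ∈ Q
      · exact (hQi u hu' v hv' huv).elim
      · exact suspRel_symm (key v u huv.symm (hOmem.2 ⟨hv, hv'⟩))
    · exact key u v huv (hOmem.2 ⟨hu, hu'⟩)
  · exact card_eq_one.2 ⟨b, by ext v; simp [col0]⟩
  · rw [filter_congr fun v _ => col1 v, filter_mem_eq_inter, univ_inter, card_erase_of_mem hb]
    have := card_pos.2 ⟨b, hb⟩
    omega
  · rw [filter_congr fun v _ => col2 v, filter_mem_eq_inter, univ_inter]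
  · rw [filter_congr fun v _ => col3 v, filter_mem_eq_inter, univ_inter, hO]

lemma exists_le_suspGraph (h : IsCore G m P Q) (hm : 2 * k + 8 ≤ m) (hk : 2 ≤ k)
    (hfree : G.CycleFree (2 * k + 1)) (hr : 3 ≤ r) (hcol : ¬ G.Colorable (r - 1))
    (hL : attached G P Q = ∅) (hL' : attached G Q P = ∅) (hO : ((P ∪ Q)ᶜ).card + 1 = r) :
    ∃ col : V → Fin 4, G ≤ suspGraph col ∧
      (HasSuspSizes col P.card Q.card r ∨ HasSuspSizes col Q.card P.card r) := by
  have hPi := h.left_indep hm hk hfree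
  have hQi := h.symm.left_indep hm hk hfree
  by_cases hQ : ∀ w ∈ (P ∪ Q)ᶜ, ∃ b ∈ Q, G.Adj w b
  · obtain ⟨col, h1, h2⟩ := h.exists_le_suspGraph_of_right hm hk hfree hr hcol hL hO hQ
    exact ⟨col, h1, .inl h2⟩
  by_cases hP : ∀ w ∈ (P ∪ Q)ᶜ, ∃ b ∈ P, G.Adj w b
  · obtain ⟨col, h1, h2⟩ := h.symm.exists_le_suspGraph_of_right hm hk hfree hr hcol hL'
      (by rwa [union_comm]) (by rwa [union_comm])
    exact ⟨col, h1, .inr h2⟩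
  exfalso
  have hpair : ∀ w ∈ (P ∪ Q)ᶜ, ∀ w' ∈ (P ∪ Q)ᶜ, w ≠ w' → (∀ v ∈ Q, ¬ G.Adj w v) →
      (∀ v ∈ P, ¬ G.Adj w' v) → False := by
    intro w hw w' hw' hne h1 h2
    refine hcol ((colorable_of_indep (forall_insert_not_adj hPi h2)
      (forall_insert_not_adj hQi h1) (j := r - 3) ?_).mono (by omega))
    have h3 : (((P ∪ Q)ᶜ.erase w).erase w').card = r - 3 := by
      rw [card_erase_of_mem (by simp only [mem_erase]; exact ⟨hne.symm, hw'⟩),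
        card_erase_of_mem hw]
      omega
    rw [← h3]
    refine card_le_card fun x hx => ?_
    simp only [mem_erase, mem_compl, mem_union, mem_insert, not_or] at hx ⊢
    tauto
  push Not at hQ hP
  obtain ⟨w, hw, hwQ⟩ := hQ
  obtain ⟨w', hw', hwP⟩ := hP
  by_cases hne : w = w'
  · subst hne
    obtain ⟨u, hu, huw⟩ := exists_mem_ne (show 1 < ((P ∪ Q)ᶜ).card by omega) w
    by_cases huP : ∀ v ∈ P, ¬ G.Adj u v
    · exact hpair w hw u hu huw.symm hwQ huP
    · push Not at huP
      obtain ⟨a, ha, hua⟩ := huP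
      refine hpair u hu w hw huw (fun v hv huv => ?_) hwP
      exact h.not_adj_both hm hk hfree ha hv hua huv
  · exact hpair w hw w' hw' hne hwQ hwP

end IsCore
end Structure

section Main

lemma IsCore.eigenvalue_le {V : Type*} [Fintype V] [DecidableEq V] {G : SimpleGraph V}
    {m k r n : ℕ} {P Q : Finset V} (h : IsCore G m P Q) (hm : 2 * k + 8 ≤ m) (hk : 2 ≤ k)
    (hfree : G.CycleFree (2 * k + 1)) (hn : Fintype.card V = n) (hr : r ≤ 2 * k)
    (hkn : 712 * k ≤ n) (hPQ : (n - 0.037 * n : ℝ) ≤ P.card + Q.card)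
    (hQ : (Q.card : ℝ) ≤ 0.584 * n)
    (hP' : (0.395 * n : ℝ) ≤ P.card) (hQ' : (0.395 * n : ℝ) ≤ Q.card)
    (hout : ∀ v, v ∉ P ∪ Q → ((nbrIn G v P).card : ℝ) ≤ 0.3 * n ∧
        ((nbrIn G v Q).card : ℝ) ≤ 0.3 * n)
    (hO : r ≤ ((P ∪ Q)ᶜ).card)
    (hL : (attached G P Q).card + (attached G Q P).card + 2 * r ≤ 2 * ((P ∪ Q)ᶜ).card + 2)
    {μ : ℝ} {x : V → ℝ} (hx : IsEigPair G μ x) : μ ≤ (n - r + 1 : ℝ) / 2 - 1 / 40 := by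
  obtain ⟨R, hR⟩ : ∃ R, R = (P ∪ Q)ᶜ \ (attached G P Q ∪ attached G Q P) := ⟨_, rfl⟩
  have hdisj := h.disjoint_attached hm hk hfree
  have hsub : attached G P Q ∪ attached G Q P ⊆ (P ∪ Q)ᶜ := by
    intro w hw
    simp only [mem_union, mem_attached] at hw
    simp only [mem_compl, mem_union]
    tauto
  have hLR : Disjoint (attached G P Q ∪ attached G Q P) R := by rw [hR]; exact disjoint_sdiff
  have hOeq : (P ∪ Q)ᶜ = attached G P Q ∪ attached G Q P ∪ R := by
    rw [hR, union_sdiff_of_subset hsub]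
  have hOcard : ((P ∪ Q)ᶜ).card = (attached G P Q).card + (attached G Q P).card + R.card := by
    rw [hOeq, card_union_of_disjoint hLR, card_union_of_disjoint hdisj]
  have hsum : P.card + Q.card + ((P ∪ Q)ᶜ).card = n := by
    rw [← card_union_of_disjoint h.disj, card_add_card_compl, hn]
  have hsum' : (P.card : ℝ) + Q.card + ((P ∪ Q)ᶜ).card = n := by exact_mod_cast hsum
  have hOcard' : (((P ∪ Q)ᶜ).card : ℝ) =
      (attached G P Q).card + (attached G Q P).card + R.card := by exact_mod_cast hOcard
  have hO' : (r : ℝ) ≤ ((P ∪ Q)ᶜ).card := by exact_mod_cast hO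
  have hL' : ((attached G P Q).card : ℝ) + (attached G Q P).card + 2 * r ≤
      2 * ((P ∪ Q)ᶜ).card + 2 := by exact_mod_cast hL
  have hkn' : (712 : ℝ) * k ≤ n := by exact_mod_cast hkn
  have hk' : (2 : ℝ) ≤ k := by exact_mod_cast hk
  have hr' : (r : ℝ) ≤ 2 * k := by exact_mod_cast hr
  obtain ⟨M, hM⟩ : ∃ M, M = (n - r + 1 : ℝ) / 2 - 1 / 40 := ⟨_, rfl⟩
  have hM0 : 0 < M := by linarith
  obtain ⟨X, η, hX0, hη0, hX, hη, e1, e2, e3, e4, e5⟩ :=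
    exists_weights (n := n) (M := M) (p := P.card) (q := Q.card) (lp := (attached G P Q).card)
      (lq := (attached G Q P).card) (t := R.card) (g := ((P ∪ Q)ᶜ).card - r + 1)
      (by linarith) (by linarith) (by linarith) (Nat.cast_nonneg _) (Nat.cast_nonneg _)
      (Nat.cast_nonneg _) (by linarith) (by linarith) (by linarith) hP' hQ' hQ
  rw [← hM]
  have hrn : (0 : ℝ) ≤ r := Nat.cast_nonneg _
  have hr1 : (1 : ℝ) ≤ n := by linarith
  have hMn : M ≤ 0.605 * n := by linarith
  refine hx.le_of_partition h.disj hdisj hLR hOeq (h.left_indep hm hk hfree)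
    (h.symm.left_indep hm hk hfree) (h.not_adj_of_mem_attached hm hk hfree)
    (h.symm.not_adj_of_mem_attached hm hk hfree) ?_ hM0 hX0 (a := 0.75 * M) (b := 0.75 * X)
    (by positivity) (by positivity) hη0 hX hMn (W := 0.45375 * n) (by linarith) (by linarith) hη
    (D := 0.3 * n) ?_ ?_ e1 e2 e3 e4 e5
  · intro w hw
    rw [hR] at hw
    simp only [mem_sdiff, mem_compl, mem_union, not_or] at hw
    exact h.card_nbrIn_le_one hm hk hfree hw.1.1 hw.1.2 hw.2.1 hw.2.2
  · intro w hw
    exact (hout w (mem_compl.1 (hsub (mem_union_left _ hw)))).2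
  · intro w hw
    exact (hout w (mem_compl.1 (hsub (mem_union_right _ hw)))).1

/-- A vertex set whose edge cut is large, from an eigenvalue. -/
lemma IsEigPair.exists_le_sum_compl {V : Type*} [Fintype V] [DecidableEq V] {G : SimpleGraph V}
    {k n : ℕ} (hk : 1 ≤ k) (hfree : G.CycleFree (2 * k + 1)) (hn : Fintype.card V = n)
    {μ : ℝ} {x : V → ℝ} (hx : IsEigPair G μ x) (hμ : 0 ≤ μ) :
    ∃ A : Finset V, μ ^ 2 - 4 * k * n ≤ ∑ v ∈ A, ((nbrIn G v Aᶜ).card : ℝ) := by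
  obtain ⟨u, hu⟩ := hx.exists_sq_le hμ
  refine ⟨nbrIn G u univ, ?_⟩
  set A := nbrIn G u univ with hA
  have h1 := hfree.sum_nbrIn_card_le hk u A fun v hv => (mem_nbrIn.1 hv).2
  have h2 : (∑ v ∈ A, ((nbrIn G v A).card : ℝ)) ≤ 4 * k * A.card := by exact_mod_cast h1
  have h3 : (A.card : ℝ) ≤ n := by rw [← hn]; exact_mod_cast card_le_univ A
  have h4 : (4 * k * A.card : ℝ) ≤ 4 * k * n := mul_le_mul_of_nonneg_left h3 (by positivity)
  have h5 : ∀ v ∈ A, ((nbrIn G v univ).card : ℝ) =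
      (nbrIn G v A).card + (nbrIn G v Aᶜ).card := fun v _ => by
    rw [← union_compl A, nbrIn_union_card v disjoint_compl_right]
    push_cast
    rfl
  rw [sum_congr rfl h5, sum_add_distrib] at hu
  linarith

/-- The classes of the vertices of `turanSuspAt n q 0`. -/
def turanClass (n q : ℕ) (i : Fin n) : Fin 4 :=
  if (i : ℕ) = 0 then 0 else if (i : ℕ) < q / 2 then 1 else if (i : ℕ) < q then 2 else 3

lemma turanSuspAt_zero_eq_suspGraph {n q : ℕ} (hq : 2 ≤ q) :
    turanSuspAt n q 0 = suspGraph (turanClass n q) := by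
  ext i j
  simp only [turanSuspAt, SimpleGraph.fromRel_adj, suspGraph, suspRel, turanClass]
  refine and_congr_right fun _ => ?_
  split_ifs <;> simp <;> omega

lemma hasSuspSizes_turanClass {n q r : ℕ} (hq : 2 ≤ q) (hr : 1 ≤ r) (hn : q + r = n + 1) :
    HasSuspSizes (turanClass n q) (q - q / 2) (q / 2) r := by
  have key : ∀ (j : Fin 4) (a b : ℕ), b ≤ n →
      (∀ i : Fin n, turanClass n q i = j ↔ a ≤ (i : ℕ) ∧ (i : ℕ) < b) →
      (univ.filter fun i => turanClass n q i = j).card = b - a := by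
    intro j a b hb hj
    rw [← Nat.card_Ico, ← card_map Fin.valEmbedding]
    congr 1
    ext x
    simp only [mem_map, mem_filter, mem_univ, true_and, hj, Fin.valEmbedding_apply, mem_Ico]
    exact ⟨by rintro ⟨i, hi, rfl⟩; exact hi, fun hx => ⟨⟨x, by omega⟩, hx, rfl⟩⟩
  refine ⟨?_, ?_, ?_, ?_⟩
  · rw [key 0 0 1 (by omega)]
    intro i
    simp only [turanClass]
    split_ifs <;> simp <;> omega
  · rw [key 1 1 (q / 2) (by omega)]
    · omega
    intro i
    simp only [turanClass]
    split_ifs <;> simp <;> omega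
  · rw [key 2 (q / 2) q (by omega)]
    intro i
    simp only [turanClass]
    split_ifs <;> simp <;> omega
  · rw [key 3 q n le_rfl]
    · omega
    intro i
    simp only [turanClass]
    split_ifs <;> simp <;> omega

lemma HasSuspSizes.iso_of_le {V W : Type*} [Fintype V] [Fintype W] {G : SimpleGraph V}
    {col : V → Fin 4} {col' : W → Fin 4} {a b a' b' r : ℕ} (h : HasSuspSizes col a b r)
    (h' : HasSuspSizes col' a' b' r) (hG : G ≤ suspGraph col) (hab : a + b = a' + b')
    (h1 : b' ≤ a') (h2 : a' ≤ b' + 1) (hr : 2 ≤ r) (ha : 1 ≤ a) (hb : 1 ≤ b) {t : ℝ}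
    (ht : (r : ℝ) ≤ t) (hroot : suspPoly a' b' r t = 0) {μ : ℝ} {x : V → ℝ}
    (hx : IsEigPair G μ x) (hμ : t ≤ μ) : Nonempty (G ≃g suspGraph col') := by
  obtain ⟨hpoly, hpoly'⟩ := suspPoly_nonneg hab h1 h2 hr ht hroot
  obtain ⟨heq, hrow⟩ := hx.eq_of_le_connected hG (h.connected ha) hμ
    (z := fun v => suspWeight b r t (col v))
    (fun v => suspWeight_pos (by exact_mod_cast hb) (by exact_mod_cast (by omega : 1 ≤ r)) ht _)
    fun v => by
      rw [h.sum_nbrIn_weight]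
      split_ifs <;> linarith
  obtain ⟨v, hv⟩ : ∃ v, col v = 0 := by
    obtain ⟨v, hv⟩ := card_pos.1 (h.zero.symm ▸ one_pos)
    exact ⟨v, by simpa using hv⟩
  have h3 := hrow v
  rw [h.sum_nbrIn_weight, hv] at h3
  have haa : a = a' := hpoly' (by simpa using h3)
  obtain rfl := haa
  obtain rfl : b = b' := by omega
  rw [heq]
  exact h.nonempty_iso h'

end Main

section Extremal

lemma nonempty_iso_of_root_le_specRad {k r n : ℕ} (hk : 2 ≤ k) (hr3 : 3 ≤ r) (hr : r ≤ 2 * k)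
    (hn : 712 * k ≤ n) {G : SimpleGraph (Fin n)} (hfree : G.CycleFree (2 * k + 1))
    (hcol : ¬ G.Colorable (r - 1)) {a b : ℕ} (hab : a + b + r = n + 1) (hba : b ≤ a)
    (hba' : a ≤ b + 1) {t : ℝ} (htab : (a * b : ℝ) < t ^ 2) (ht : (r : ℝ) ≤ t)
    (hroot : suspPoly a b r t = 0) (htG : t ≤ G.specRad) {W : Type*} [Fintype W]
    {col : W → Fin 4} (hcol' : HasSuspSizes col a b r) : Nonempty (G ≃g suspGraph col) := by
  have hr0 : (3 : ℝ) ≤ r := by exact_mod_cast hr3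
  have hr' : (r : ℝ) ≤ 2 * k := by exact_mod_cast hr
  have hk' : (2 : ℝ) ≤ k := by exact_mod_cast hk
  have hn' : (712 : ℝ) * k ≤ n := by exact_mod_cast hn
  have hab' : (a : ℝ) + b + r = n + 1 := by exact_mod_cast hab
  have h1 : (b : ℝ) ≤ a := by exact_mod_cast hba
  have h2 : (a : ℝ) ≤ b + 1 := by exact_mod_cast hba'
  have ht0 : 0 < t := by linarith
  obtain ⟨x, hx⟩ := exists_isEigPair_specRad (ht0.trans_le htG)
  have hcardV : Fintype.card (Fin n) = n := Fintype.card_fin n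
  obtain ⟨A, hA⟩ := hx.exists_le_sum_compl (by omega) hfree hcardV (ht0.le.trans htG)
  have h4ab : (n : ℝ) ^ 2 - 4 * k * n ≤ 4 * (a * b) := by
    have h3 : (a - b : ℝ) ^ 2 ≤ 1 := by nlinarith only [h1, h2]
    have h4 : (n - 2 * k + 1 : ℝ) ^ 2 ≤ (a + b) ^ 2 :=
      pow_le_pow_left₀ (by linarith) (by linarith) 2
    nlinarith only [h3, h4, hk', hn']
  have hsq : t ^ 2 ≤ G.specRad ^ 2 := pow_le_pow_left₀ ht0.le htG 2
  have hA' : 0.24297 * (n : ℝ) ^ 2 ≤ ∑ v ∈ A, ((nbrIn G v Aᶜ).card : ℝ) := by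
    have : (712 : ℝ) * (k * n) ≤ n ^ 2 := by nlinarith only [hk', hn']
    nlinarith only [this, hA, h4ab, hsq, htab]
  obtain ⟨P, Q, hdis, hPQ, hP1, hQ1, hP2, hQ2, hPd, hQd, hout⟩ :=
    exists_dense_pair n hcardV A hA' (by omega)
  have hPn : P.Nonempty := card_pos.1 (by exact_mod_cast (by linarith : (0 : ℝ) < P.card))
  have hQn : Q.Nonempty := card_pos.1 (by exact_mod_cast (by linarith : (0 : ℝ) < Q.card))
  have hcore : IsCore G (2 * k + 8) P Q :=
    isCore_of_dense hdis hP1 hQ1 hPd hQd hPn hQn (by push_cast; linarith)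
  rcases hcore.card_compl_dichotomy le_rfl hk hfree hr3 hcol with ⟨hL, hL', hO⟩ | ⟨hO, hL⟩
  · obtain ⟨c, hGc, hc⟩ := hcore.exists_le_suspGraph le_rfl hk hfree hr3 hcol hL hL' hO
    have hsum : P.card + Q.card + ((P ∪ Q)ᶜ).card = n := by
      rw [← card_union_of_disjoint hdis, card_add_card_compl, hcardV]
    have hP0 := card_pos.2 hPn
    have hQ0 := card_pos.2 hQn
    rcases hc with hc | hc
    · exact hc.iso_of_le hcol' hGc (by omega) hba hba' (by omega) hP0 hQ0 ht hroot hx htG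
    · exact hc.iso_of_le hcol' hGc (by omega) hba hba' (by omega) hQ0 hP0 ht hroot hx htG
  · exfalso
    have := hcore.eigenvalue_le le_rfl hk hfree hcardV hr hn hPQ hQ1 hP2 hQ2 hout hO hL hx
    have h3 : t ≤ (n - r + 1 : ℝ) / 2 - 1 / 40 := htG.trans this
    have h4 : t ^ 2 ≤ ((n - r + 1 : ℝ) / 2 - 1 / 40) ^ 2 := pow_le_pow_left₀ ht0.le h3 2
    have h5 : (n - r + 1 : ℝ) = a + b := by linarith
    rw [h5] at h4
    have h6 : (a - b : ℝ) ^ 2 ≤ 1 := by nlinarith only [h1, h2]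
    have h7 : (20 : ℝ) ≤ a + b := by linarith
    nlinarith only [h4, h6, h7, htab]

end Extremal

/-- Corollary: spectral extremal `C_{2k+1}`-free graphs with high
chromatic number. If `k ≥ 2`, `3 ≤ r ≤ 2k`, `n ≥ 712 k`, and `G` is an `n`-vertex
`C_{2k+1}`-free graph with `χ(G) ≥ r`, then `λ(G) ≤ λ(T_{n-r+1,2} ∘ K_r)`, with equality
iff `G = T_{n-r+1,2} ∘ K_r`. -/
theorem stmt_4 (k r n : ℕ) (hk : 2 ≤ k) (hr3 : 3 ≤ r) (hr : r ≤ 2 * k)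
    (hn : 712 * k ≤ n) (G : SimpleGraph (Fin n))
    (hfree : G.CycleFree (2 * k + 1))
    (hchi : (r : ℕ∞) ≤ G.chromaticNumber) :
    G.specRad ≤ (turanSuspAt n (n - r + 1) 0).specRad ∧
    (G.specRad = (turanSuspAt n (n - r + 1) 0).specRad ↔
      Nonempty (G ≃g turanSuspAt n (n - r + 1) 0)) := by
  obtain ⟨q, hq⟩ : ∃ q, q = n - r + 1 := ⟨_, rfl⟩
  rw [← hq]
  have hsizes : HasSuspSizes (turanClass n q) (q - q / 2) (q / 2) r :=
    hasSuspSizes_turanClass (by omega) (by omega) (by omega)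
  have hrab : r * r ≤ (q - q / 2) * (q / 2) := Nat.mul_le_mul (by omega) (by omega)
  obtain ⟨t, htab, ht, hroot⟩ := exists_suspPoly_root (a := q - q / 2) (b := q / 2) (r := r)
    (by omega) (by omega) (by omega) (Real.le_sqrt_of_sq_le (by rw [sq]; exact_mod_cast hrab))
  have hT : (turanSuspAt n q 0).specRad = t := by
    rw [turanSuspAt_zero_eq_suspGraph (by omega)]
    exact hsizes.specRad_eq_of_root (by omega) (by omega) ht hroot
  have hcol : ¬ G.Colorable (r - 1) := fun h => by
    have := hchi.trans h.chromaticNumber_le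
    have : r ≤ r - 1 := by exact_mod_cast this
    omega
  have hiso : t ≤ G.specRad → Nonempty (G ≃g turanSuspAt n q 0) := fun h => by
    rw [turanSuspAt_zero_eq_suspGraph (by omega)]
    exact nonempty_iso_of_root_le_specRad hk hr3 hr hn hfree hcol (by omega) (by omega)
      (by omega) htab ht hroot h hsizes
  rw [hT]
  refine ⟨?_, fun h => hiso h.ge, fun ⟨e⟩ => (specRad_congr e).trans hT⟩
  by_contra! hlt
  obtain ⟨e⟩ := hiso hlt.le
  exact hlt.ne' ((specRad_congr e).trans hT)
end

section
/- Let k ≥ 2, n ≥ 100k and 3 ≤ r ≤ 10k be integers. If G belongs to the family 𝒢*_{n,r}, then λ(G) ≤ λ(T_{n−r+2,2}∘K_{r−1}), with equality if and only if G is isomorphic to T_{n−r+2,2}∘K_{r−1}. -/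
namespace SimpleGraph

open Finset

variable {V : Type*} [Fintype V] (G : SimpleGraph V)

/-- The set of real eigenvalues of the adjacency matrix, written through neighbour sums. -/
def realEigenvalues [DecidableRel G.Adj] : Set ℝ :=
  {μ | ∃ x : V → ℝ, x ≠ 0 ∧ ∀ v, ∑ u ∈ G.neighborFinset v, x u = μ * x v}

theorem specRad_eq_sSup_realEigenvalues [DecidableRel G.Adj] :
    G.specRad = sSup G.realEigenvalues := by
  unfold specRad realEigenvalues
  congr 1
  ext μ
  refine exists_congr fun x => and_congr_right fun _ => ?_
  rw [funext_iff]
  refine forall_congr' fun v => ?_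
  simp only [adjMatrix_mulVec_apply, Pi.smul_apply, smul_eq_mul]
  convert Iff.rfl

theorem finite_realEigenvalues [DecidableRel G.Adj] : G.realEigenvalues.Finite := by
  classical
  refine (Module.End.finite_hasEigenvalue (Matrix.toLin' (G.adjMatrix ℝ))).subset ?_
  rintro μ ⟨x, hx, h⟩
  refine Module.End.hasEigenvalue_of_hasEigenvector (x := x) ⟨?_, hx⟩
  rw [Module.End.mem_eigenspace_iff, Matrix.toLin'_apply]
  ext v
  simpa [adjMatrix_mulVec_apply] using h v

theorem le_specRad_of_eigenvector [DecidableRel G.Adj] {μ : ℝ} {x : V → ℝ} (hx : x ≠ 0)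
    (h : ∀ v, ∑ u ∈ G.neighborFinset v, x u = μ * x v) : μ ≤ G.specRad := by
  rw [specRad_eq_sSup_realEigenvalues]
  exact le_csSup G.finite_realEigenvalues.bddAbove ⟨x, hx, h⟩

/-- If the spectral radius is positive, it admits a nonnegative nonzero vector on which the
adjacency operator dominates multiplication by the spectral radius. -/
theorem exists_nonneg_specRad_mul_le [DecidableRel G.Adj] (h : 0 < G.specRad) :
    ∃ x : V → ℝ, (∀ v, 0 ≤ x v) ∧ (∃ v, 0 < x v) ∧
      ∀ v, G.specRad * x v ≤ ∑ u ∈ G.neighborFinset v, x u := by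
  have hne : G.realEigenvalues.Nonempty := by
    by_contra hne
    rw [Set.not_nonempty_iff_eq_empty] at hne
    rw [specRad_eq_sSup_realEigenvalues, hne, Real.sSup_empty] at h
    exact lt_irrefl _ h
  have hmem : G.specRad ∈ G.realEigenvalues := by
    rw [specRad_eq_sSup_realEigenvalues]
    exact hne.csSup_mem G.finite_realEigenvalues
  obtain ⟨x, hx, hxe⟩ := hmem
  refine ⟨fun v => |x v|, fun v => abs_nonneg _, ?_, fun v => ?_⟩
  · obtain ⟨v, hv⟩ := Function.ne_iff.mp hx
    exact ⟨v, abs_pos.mpr hv⟩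
  · calc G.specRad * |x v| = |∑ u ∈ G.neighborFinset v, x u| := by
          rw [hxe v, abs_mul, abs_of_pos h]
      _ ≤ _ := abs_sum_le_sum_abs _ _

variable {G}

theorem Iso.realEigenvalues_subset {V' : Type*} [Fintype V'] {G' : SimpleGraph V'}
    [DecidableRel G.Adj] [DecidableRel G'.Adj] (e : G ≃g G') :
    G.realEigenvalues ⊆ G'.realEigenvalues := by
  rintro μ ⟨x, hx, h⟩
  refine ⟨x ∘ e.symm, fun h0 => hx ?_, fun v => ?_⟩
  · ext u
    simpa using congrFun h0 (e u)
  · rw [Function.comp_apply, ← h (e.symm v)]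
    refine Finset.sum_equiv e.symm.toEquiv (fun u => ?_) (fun u _ => rfl)
    simp only [mem_neighborFinset]
    exact e.symm.map_rel_iff.symm

theorem Iso.specRad_eq {V' : Type*} [Fintype V'] {G' : SimpleGraph V'} (e : G ≃g G') :
    G.specRad = G'.specRad := by
  classical
  rw [specRad_eq_sSup_realEigenvalues, specRad_eq_sSup_realEigenvalues]
  exact congrArg sSup (Set.Subset.antisymm e.realEigenvalues_subset e.symm.realEigenvalues_subset)

end SimpleGraph

/-- The gain in the squared spectral radius, per vertex of the opposite part, caused by suspending
a clique with `m` new vertices. -/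
noncomputable def suspGain (m t : ℝ) : ℝ := m / ((t + 1) * (t - m))

theorem suspGain_pos {m t : ℝ} (hm : 0 < m) (ht : m < t) : 0 < suspGain m t :=
  div_pos hm (mul_pos (by linarith) (by linarith))

theorem suspGain_lt_one {m t : ℝ} (hm : 0 < m) (ht : 2 * m ≤ t) : suspGain m t < 1 := by
  unfold suspGain
  rw [div_lt_one (mul_pos (by linarith) (by linarith))]
  nlinarith

theorem suspGain_le_suspGain {m s t : ℝ} (hm : 0 < m) (hs : m < s) (hst : s ≤ t) :
    suspGain m t ≤ suspGain m s := by
  unfold suspGain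
  have h1 : 0 < s + 1 := by linarith
  have h2 : 0 < s - m := by linarith
  gcongr
  linarith

theorem exists_sq_eq_add_mul_suspGain {m L H : ℝ} (hm : 0 < m) (hL : 2 * m ≤ L) (hLH : L ≤ H) :
    ∃ t, L ≤ t ∧ t ^ 2 = L * H + H * suspGain m t := by
  have hcont : ContinuousOn (fun t : ℝ => t ^ 2 - (L * H + H * suspGain m t))
      (Set.Icc L (H + 1)) := by
    unfold suspGain
    refine ContinuousOn.sub (by fun_prop) (ContinuousOn.add (by fun_prop)
      (ContinuousOn.mul (by fun_prop) (ContinuousOn.div (by fun_prop) (by fun_prop) ?_)))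
    intro t ht
    have := ht.1
    exact (mul_pos (by linarith) (by linarith)).ne'
  have h1 := suspGain_pos hm (show m < L by linarith)
  have h2 := suspGain_lt_one hm (show 2 * m ≤ H + 1 by linarith)
  obtain ⟨t, ht, h0⟩ := intermediate_value_Icc (by linarith) hcont (Set.mem_Icc.mpr
    ⟨show L ^ 2 - (L * H + H * suspGain m L) ≤ 0 by nlinarith,
      show 0 ≤ (H + 1) ^ 2 - (L * H + H * suspGain m (H + 1)) by nlinarith⟩)
  exact ⟨t, ht.1, by linarith⟩

theorem mul_add_suspGain_le {m t a b NA NB : ℝ} (hA : 0 ≤ NA) (hB : 0 ≤ NB) (hAB : NA + NB = m)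
    (hm : 0 < m) (ht : 2 * m ≤ t) {M : ℝ} (haM : a ≤ M) (hbM : b ≤ M) (hM : 1 ≤ M) :
    (a + NA / ((t - m + 1) * t - NA)) * (b + NB / ((t - m + 1) * t - NB)) ≤
      a * b + M * suspGain m t := by
  have hD : (t - m + 1) * t - m = (t + 1) * (t - m) := by ring
  rw [suspGain, ← hD]
  have hpos : 0 < (t - m + 1) * t - m := hD ▸ mul_pos (by linarith) (by linarith)
  generalize (t - m + 1) * t = D at hpos
  have hDA : 0 < D - NA := by linarith
  have hDB : 0 < D - NB := by linarith
  have hg : NA / (D - NA) + NB / (D - NB) + NA / (D - NA) * (NB / (D - NB)) ≤ m / (D - m) := by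
    rw [div_add_div _ _ hDA.ne' hDB.ne', div_mul_div_comm, ← add_div,
      div_le_div_iff₀ (mul_pos hDA hDB) hpos]
    subst hAB
    nlinarith [mul_nonneg hA hB, mul_nonneg (mul_nonneg hA hB) (show 0 ≤ D by linarith)]
  have hgA : 0 ≤ NA / (D - NA) := div_nonneg hA hDA.le
  have hgB : 0 ≤ NB / (D - NB) := div_nonneg hB hDB.le
  nlinarith [mul_nonneg hgA hgB, mul_le_mul_of_nonneg_left hg (show 0 ≤ M by linarith),
    mul_nonneg hgA (sub_nonneg.mpr hbM), mul_nonneg hgB (sub_nonneg.mpr haM),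
    mul_nonneg (mul_nonneg hgA hgB) (sub_nonneg.mpr hM)]

theorem mul_add_max_mul_le {L H a b : ℕ} (hLH : L ≤ H) (hHL : H ≤ L + 1) (hab : a + b = L + H)
    {γ : ℝ} (hγ1 : γ ≤ 1) :
    (a * b + (max a b : ℕ) * γ : ℝ) ≤ L * H + H * γ := by
  wlog h : a ≤ b generalizing a b
  · have := this (a := b) (b := a) (by omega) (by omega)
    rwa [max_comm, mul_comm (b : ℝ)] at this
  rw [max_eq_right h]
  obtain ⟨t, rfl⟩ : ∃ t, b = H + t := ⟨b - H, by omega⟩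
  obtain rfl : L = a + t := by omega
  have hLH' : (a + t : ℝ) ≤ H := by exact_mod_cast hLH
  have ht : (t : ℝ) ≤ t ^ 2 := by exact_mod_cast Nat.le_self_pow two_ne_zero t
  push_cast
  nlinarith [mul_nonneg (sub_nonneg.mpr hLH') (Nat.cast_nonneg (α := ℝ) t),
    mul_nonneg (sub_nonneg.mpr hγ1) (Nat.cast_nonneg (α := ℝ) t)]

theorem eq_of_le_mul_add_mul {L H a b : ℕ} (hLH : L ≤ H) (hHL : H ≤ L + 1) (hab : a + b = L + H)
    {γ : ℝ} (hγ0 : 0 < γ) (hγ1 : γ < 1) (h : (L * H + H * γ : ℝ) ≤ a * b + b * γ) : b = H := by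
  rcases lt_trichotomy b H with hb | hb | hb
  · exfalso
    obtain ⟨s, rfl⟩ : ∃ s, H = b + s := ⟨H - b, by omega⟩
    obtain rfl : a = L + s := by omega
    have hs : (1 : ℝ) ≤ s := by exact_mod_cast (show 1 ≤ s by omega)
    have hHL' : (b + s : ℝ) ≤ L + 1 := by exact_mod_cast hHL
    push_cast at h
    nlinarith [mul_nonneg (sub_nonneg.mpr hHL') (show (0 : ℝ) ≤ s by linarith),
      mul_pos hγ0 (show (0 : ℝ) < s by linarith)]
  · exact hb
  · exfalso
    obtain ⟨t, rfl⟩ : ∃ t, b = H + t := ⟨b - H, by omega⟩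
    obtain rfl : L = a + t := by omega
    have ht : (1 : ℝ) ≤ t := by exact_mod_cast (show 1 ≤ t by omega)
    have hLH' : (a + t : ℝ) ≤ H := by exact_mod_cast hLH
    push_cast at h
    nlinarith [mul_nonneg (sub_nonneg.mpr hLH') (show (0 : ℝ) ≤ t by linarith),
      mul_pos (sub_pos.mpr hγ1) (show (0 : ℝ) < t by linarith)]

/-- Adjacency between the four classes of vertices of a complete bipartite graph with a suspended
clique: `0` is the attaching vertex, `1` the rest of its part, `2` the other part, and `3` the new
vertices of the clique. -/
def suspPattern (c d : Fin 4) : Prop :=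
  (c ≤ 1 ∧ d = 2) ∨ (c = 2 ∧ d ≤ 1) ∨ ((c = 0 ∨ c = 3) ∧ (d = 0 ∨ d = 3))

instance : DecidableRel suspPattern := fun c d => by unfold suspPattern; infer_instance

/-- `col` exhibits `G` as a complete bipartite graph with parts of sizes `L` and `H`, and a clique
with `m` new vertices suspended at a vertex of the first part. -/
structure IsSuspColoring {V : Type*} [Fintype V] (G : SimpleGraph V) (L H m : ℕ)
    (col : V → Fin 4) : Prop where
  adj_iff : ∀ x y, G.Adj x y ↔ x ≠ y ∧ suspPattern (col x) (col y)
  card_zero : (Finset.univ.filter fun x => col x = 0).card = 1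
  card_one : (Finset.univ.filter fun x => col x = 1).card + 1 = L
  card_two : (Finset.univ.filter fun x => col x = 2).card = H
  card_three : (Finset.univ.filter fun x => col x = 3).card = m

namespace IsSuspColoring

variable {V V' : Type*} [Fintype V] [Fintype V'] {G : SimpleGraph V} {G' : SimpleGraph V'}
  {L H m : ℕ} {col : V → Fin 4} {col' : V' → Fin 4}

theorem nonempty_iso (h : IsSuspColoring G L H m col) (h' : IsSuspColoring G' L H m col') :
    Nonempty (G ≃g G') := by
  have hcard : ∀ c : Fin 4, Nonempty ({x // col x = c} ≃ {y // col' y = c}) := by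
    intro c
    rw [← Fintype.card_eq, Fintype.card_subtype, Fintype.card_subtype]
    have h1 := h.card_one
    have h1' := h'.card_one
    fin_cases c
    · exact h.card_zero.trans h'.card_zero.symm
    · change (Finset.univ.filter fun x => col x = 1).card =
        (Finset.univ.filter fun x => col' x = 1).card
      omega
    · exact h.card_two.trans h'.card_two.symm
    · exact h.card_three.trans h'.card_three.symm
  let e := fun c => Classical.choice (hcard c)
  refine ⟨⟨Equiv.ofFiberEquiv e, fun {x y} => ?_⟩⟩
  rw [h.adj_iff, h'.adj_iff, Equiv.ofFiberEquiv_map e, Equiv.ofFiberEquiv_map e, Ne, Ne,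
    EmbeddingLike.apply_eq_iff_eq]

theorem sum_comp_col (h : IsSuspColoring G L H m col) (f : Fin 4 → ℝ) :
    ∑ x, f (col x) = f 0 + (L - 1) * f 1 + H * f 2 + m * f 3 := by
  rw [← Finset.sum_fiberwise' Finset.univ col f]
  simp only [Finset.sum_const, nsmul_eq_mul, Fin.sum_univ_four, h.card_zero, h.card_two,
    h.card_three, ← h.card_one]
  push_cast
  ring

theorem sum_neighborFinset [DecidableRel G.Adj] (h : IsSuspColoring G L H m col)
    (f : Fin 4 → ℝ) (x : V) :
    ∑ y ∈ G.neighborFinset x, f (col y) =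
      (∑ y, if suspPattern (col x) (col y) then f (col y) else 0) -
        if suspPattern (col x) (col x) then f (col x) else 0 := by
  classical
  rw [← Finset.sum_erase_eq_sub (Finset.mem_univ x), ← Finset.sum_filter]
  refine Finset.sum_congr ?_ fun _ _ => rfl
  ext y
  simp [h.adj_iff, eq_comm]

theorem le_specRad (h : IsSuspColoring G L H m col) {t : ℝ} (hm : 0 < m) (hmL : 2 * m ≤ L)
    (hLH : L ≤ H) (hLt : L ≤ t) (ht : t ^ 2 = L * H + H * suspGain m t) : t ≤ G.specRad := by
  classical
  have hm' : (1 : ℝ) ≤ m := by exact_mod_cast hm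
  have hmL' : (2 * m : ℝ) ≤ L := by exact_mod_cast hmL
  have hLH' : (L : ℝ) ≤ H := by exact_mod_cast hLH
  have hd : 0 < t - m + 1 := by linarith
  have ht0 : 0 < t := by linarith
  have hH0 : (0 : ℝ) < H := by linarith
  have htm : 0 < t - m := by linarith
  have ht1 : 0 < t + 1 := by linarith
  set f : Fin 4 → ℝ := ![1, (t - m / (t - m + 1)) / t, (t - m / (t - m + 1)) / H,
    1 / (t - m + 1)] with hf
  obtain ⟨z, hz⟩ : (Finset.univ.filter fun x => col x = 0).Nonempty :=
    Finset.card_pos.mp (by rw [h.card_zero]; exact one_pos)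
  refine G.le_specRad_of_eigenvector (x := fun x => f (col x)) (fun h0 => ?_) fun x => ?_
  · have := congrFun h0 z
    simp [hf, (Finset.mem_filter.mp hz).2] at this
  rw [h.sum_neighborFinset, h.sum_comp_col fun c => if suspPattern (col x) c then f c else 0]
  unfold suspGain at ht
  generalize col x = c
  fin_cases c
  · simp [suspPattern, hf]
    field_simp
    ring
  · simp [suspPattern, hf]
    field_simp
  · simp [suspPattern, hf]
    field_simp at ht ⊢
    linear_combination -ht
  · simp [suspPattern, hf]
    field_simp
    ring

end IsSuspColoring

theorem card_filter_le_val_lt {n a b : ℕ} (hb : b ≤ n) :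
    (Finset.univ.filter fun i : Fin n => a ≤ (i : ℕ) ∧ (i : ℕ) < b).card = b - a := by
  rw [← Nat.card_Ico, ← Finset.card_map Fin.valEmbedding]
  congr 1
  ext j
  simp only [Finset.mem_map, Finset.mem_filter, Finset.mem_univ, true_and, Fin.valEmbedding_apply,
    Finset.mem_Ico]
  exact ⟨fun ⟨i, hi, hij⟩ => hij ▸ hi, fun hj => ⟨⟨j, by omega⟩, hj, rfl⟩⟩

theorem exists_isSuspColoring_turanSuspAt {n m : ℕ} (hmn : m + 2 ≤ n) :
    ∃ col, IsSuspColoring (turanSuspAt n (n - m) 0) ((n - m) / 2) (n - m - (n - m) / 2) m col := by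
  refine ⟨fun i => if (i : ℕ) = 0 then 0 else if (i : ℕ) < (n - m) / 2 then 1 else
    if (i : ℕ) < n - m then 2 else 3, ?_, ?_, ?_, ?_, ?_⟩
  · intro x y
    simp only [turanSuspAt, SimpleGraph.fromRel_adj, Ne, suspPattern]
    refine and_congr_right fun _ => ?_
    split_ifs <;> simp <;> omega
  · have h := card_filter_le_val_lt (n := n) (a := 0) (b := 1) (by omega)
    refine Eq.trans ?_ (h.trans ?_)
    · congr 1
      ext i
      simp only [Finset.mem_filter, Finset.mem_univ, true_and]
      split_ifs <;> simp <;> omega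
    · omega
  · have h := card_filter_le_val_lt (n := n) (a := 1) (b := (n - m) / 2) (by omega)
    suffices h' : _ = _ from (congrArg (· + 1) (h'.trans h)).trans (by omega)
    congr 1
    ext i
    simp only [Finset.mem_filter, Finset.mem_univ, true_and]
    split_ifs <;> simp <;> omega
  · have h := card_filter_le_val_lt (n := n) (a := (n - m) / 2) (b := n - m) (by omega)
    refine Eq.trans ?_ (h.trans ?_)
    · congr 1
      ext i
      simp only [Finset.mem_filter, Finset.mem_univ, true_and]
      split_ifs <;> simp <;> omega
    · omega
  · have h := card_filter_le_val_lt (n := n) (a := n - m) (b := n) (by omega)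
    refine Eq.trans ?_ (h.trans ?_)
    · congr 1
      ext i
      simp only [Finset.mem_filter, Finset.mem_univ, true_and]
      split_ifs <;> simp <;> omega
    · omega

/-- Outside `U` the graph `G` is bipartite with one part cut out by `A`, and every vertex `w ∈ U`
belongs to a subgraph suspended at the vertex `p w`. -/
structure SuspendedBipartite {V : Type*} (G : SimpleGraph V) (U A : Finset V) (p : V → V) :
    Prop where
  anchor_notMem : ∀ w ∈ U, p w ∉ U
  eq_anchor : ∀ w ∈ U, ∀ y ∉ U, G.Adj w y → y = p w
  anchor_eq : ∀ w ∈ U, ∀ w' ∈ U, G.Adj w w' → p w = p w'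
  bipartite : ∀ x y, G.Adj x y → x ∉ U → y ∉ U → (x ∈ A ↔ y ∉ A)

namespace SuspendedBipartite

open Finset

variable {V : Type*} [DecidableEq V] {G : SimpleGraph V} {U A : Finset V} {p : V → V}

theorem sum_card_filter_anchor (h : SuspendedBipartite G U A p) :
    ∑ v ∈ A \ U, #(U.filter fun u => p u = v) = #(U.filter fun u => p u ∈ A) := by
  rw [card_eq_sum_card_fiberwise (f := p) (t := A \ U) fun u hu => ?_]
  · refine sum_congr rfl fun v hv => ?_
    congr 1
    ext u
    have := (mem_sdiff.mp hv).1
    simp only [mem_filter]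
    exact ⟨fun hu => ⟨⟨hu.1, hu.2 ▸ this⟩, hu.2⟩, fun hu => ⟨hu.1.1, hu.2⟩⟩
  · obtain ⟨huU, huA⟩ := mem_filter.mp (mem_coe.mp hu)
    exact mem_coe.mpr (mem_sdiff.mpr ⟨huA, h.anchor_notMem u huU⟩)

variable [Fintype V]

theorem compl (h : SuspendedBipartite G U A p) : SuspendedBipartite G U Aᶜ p where
  anchor_notMem := h.anchor_notMem
  eq_anchor := h.eq_anchor
  anchor_eq := h.anchor_eq
  bipartite a b hab ha hb := by
    have := h.bipartite a b hab ha hb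
    simp only [mem_compl]
    tauto

theorem isSuspColoring_of_adj (h : SuspendedBipartite G U A p) {p₀ : V} (hU : p₀ ∉ U)
    (hA : p₀ ∈ A) (hp : ∀ w ∈ U, p w = p₀)
    (hadj : ∀ a ∈ A \ U, ∀ b ∈ Aᶜ \ U, G.Adj a b) (hadjU : ∀ w ∈ U, G.Adj p₀ w)
    (hclique : ∀ w ∈ U, ∀ w' ∈ U, w ≠ w' → G.Adj w w') {L H : ℕ}
    (hL : #(A \ U) = L) (hH : #(Aᶜ \ U) = H) :
    IsSuspColoring G L H #U
      fun v => if v = p₀ then 0 else if v ∈ U then 3 else if v ∈ A then 1 else 2 := by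
  refine ⟨fun a b => ?_, ?_, ?_, ?_, ?_⟩
  · have h1 := h.bipartite a b
    have h2 := h.eq_anchor a
    have h3 := h.eq_anchor b
    have h4 := hadj a
    have h5 := hadj b
    have h6 := hclique a
    have h7 := hadjU a
    have h8 := hadjU b
    have h9 := hp a
    have h10 := hp b
    have h11 : G.Adj a b → a ≠ b := fun h => h.ne
    have h12 := G.adj_comm a b
    simp only [mem_sdiff, mem_compl] at h4 h5
    unfold suspPattern
    split_ifs <;> simp <;> grind
  · rw [card_eq_one]
    refine ⟨p₀, ?_⟩
    ext v
    simp only [mem_filter, mem_univ, true_and, mem_singleton]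
    split_ifs with h1 <;> simp [h1]
  · have hc := card_erase_add_one (mem_sdiff.mpr ⟨hA, hU⟩)
    rw [← hL, ← hc]
    congr 2
    ext v
    simp only [mem_filter, mem_univ, true_and, mem_erase, mem_sdiff]
    split_ifs with h1 h2 h3 <;> simp [*]
  · rw [← hH]
    congr 1
    ext v
    simp only [mem_filter, mem_univ, true_and, mem_sdiff, mem_compl]
    split_ifs with h1 h2 h3 <;> simp [*]
  · congr 1
    ext v
    simp only [mem_filter, mem_univ, true_and]
    split_ifs with h1 h2 h3 <;> simp [*]

variable [DecidableRel G.Adj] {x : V → ℝ} {lam : ℝ}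

theorem neighborFinset_subset_of_mem (h : SuspendedBipartite G U A p) {w : V} (hw : w ∈ U) :
    G.neighborFinset w ⊆ insert (p w) ((U.filter fun u => p u = p w).erase w) := by
  intro u hu
  rw [SimpleGraph.mem_neighborFinset] at hu
  rw [mem_insert, mem_erase, mem_filter]
  by_cases huU : u ∈ U
  · exact Or.inr ⟨hu.ne', huU, (h.anchor_eq w hw u huU hu).symm⟩
  · exact Or.inl (h.eq_anchor w hw u huU hu)

theorem neighborFinset_subset_of_notMem (h : SuspendedBipartite G U A p) {v : V}
    (hv : v ∈ A \ U) : G.neighborFinset v ⊆ (Aᶜ \ U) ∪ U.filter fun u => p u = v := by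
  intro u hu
  rw [SimpleGraph.mem_neighborFinset] at hu
  rw [mem_sdiff] at hv
  rw [mem_union, mem_sdiff, mem_filter, mem_compl]
  by_cases huU : u ∈ U
  · exact Or.inr ⟨huU, (h.eq_anchor u huU v hv.2 hu.symm).symm⟩
  · exact Or.inl ⟨(h.bipartite v u hu hv.2 huU).mp hv.1, huU⟩

theorem weight_le (h : SuspendedBipartite G U A p) (hx : ∀ v, 0 ≤ x v)
    (hlam : ∀ v, lam * x v ≤ ∑ u ∈ G.neighborFinset v, x u) (hd : 0 < lam - #U + 1)
    {w : V} (hw : w ∈ U) : x w ≤ x (p w) / (lam - #U + 1) := by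
  obtain ⟨z, hz, hmax⟩ := exists_max_image (U.filter fun u => p u = p w) x
    ⟨w, mem_filter.mpr ⟨hw, rfl⟩⟩
  obtain ⟨hzU, hzp⟩ := mem_filter.mp hz
  have hsum : ∑ u ∈ G.neighborFinset z, x u ≤ x (p z) + (#U - 1) * x z := by
    calc ∑ u ∈ G.neighborFinset z, x u
        ≤ ∑ u ∈ insert (p z) ((U.filter fun u => p u = p z).erase z), x u :=
          sum_le_sum_of_subset_of_nonneg (h.neighborFinset_subset_of_mem hzU) fun u _ _ => hx u
      _ = x (p z) + ∑ u ∈ (U.filter fun u => p u = p z).erase z, x u :=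
          sum_insert fun hmem =>
            h.anchor_notMem z hzU (mem_filter.mp (mem_of_mem_erase hmem)).1
      _ ≤ x (p z) + #((U.filter fun u => p u = p z).erase z) • x z := by
          gcongr
          refine sum_le_card_nsmul _ _ _ fun u hu => hmax u ?_
          rw [← hzp]
          exact mem_of_mem_erase hu
      _ ≤ x (p z) + (#U - 1) * x z := by
          have hc : #((U.filter fun u => p u = p z).erase z) ≤ #(U.erase z) :=
            card_le_card (erase_subset_erase _ (filter_subset _ _))
          rw [nsmul_eq_mul, ← cast_card_erase_of_mem hzU]
          gcongr
          exact hx z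
  have hwz := hmax w (mem_filter.mpr ⟨hw, rfl⟩)
  rw [le_div_iff₀ hd, ← hzp]
  nlinarith [hlam z]

theorem mul_weight_le (h : SuspendedBipartite G U A p) (hx : ∀ v, 0 ≤ x v)
    (hlam : ∀ v, lam * x v ≤ ∑ u ∈ G.neighborFinset v, x u) (hd : 0 < lam - #U + 1)
    {v : V} (hv : v ∈ A \ U) :
    lam * x v ≤ ∑ u ∈ Aᶜ \ U, x u + #(U.filter fun u => p u = v) * (x v / (lam - #U + 1)) := by
  have hdisj : Disjoint (Aᶜ \ U) (U.filter fun u => p u = v) :=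
    disjoint_sdiff_self_left.mono_right (filter_subset _ _)
  calc lam * x v ≤ ∑ u ∈ G.neighborFinset v, x u := hlam v
    _ ≤ ∑ u ∈ (Aᶜ \ U) ∪ U.filter fun u => p u = v, x u :=
        sum_le_sum_of_subset_of_nonneg (h.neighborFinset_subset_of_notMem hv) fun u _ _ => hx u
    _ = ∑ u ∈ Aᶜ \ U, x u + ∑ u ∈ U.filter fun u => p u = v, x u := sum_union hdisj
    _ ≤ _ := by
        gcongr
        rw [← nsmul_eq_mul]
        refine sum_le_card_nsmul _ _ _ fun u hu => ?_
        obtain ⟨huU, rfl⟩ := mem_filter.mp hu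
        exact h.weight_le hx hlam hd huU

theorem weight_div_le (h : SuspendedBipartite G U A p) (hx : ∀ v, 0 ≤ x v)
    (hlam : ∀ v, lam * x v ≤ ∑ u ∈ G.neighborFinset v, x u) (hd : 0 < lam - #U + 1)
    (hD : 0 < (lam - #U + 1) * lam - #U) {v : V} (hv : v ∈ A \ U) :
    x v / (lam - #U + 1) ≤
      (∑ u ∈ Aᶜ \ U, x u) / ((lam - #U + 1) * lam - #(U.filter fun u => p u ∈ A)) := by
  have hN : (#(U.filter fun u => p u ∈ A) : ℝ) ≤ #U := by
    exact_mod_cast card_le_card (filter_subset _ _)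
  have hNv : (#(U.filter fun u => p u = v) : ℝ) ≤ #(U.filter fun u => p u ∈ A) := by
    rw [← h.sum_card_filter_anchor]
    exact_mod_cast single_le_sum (f := fun v => #(U.filter fun u => p u = v))
      (fun _ _ => Nat.zero_le _) hv
  have hle := h.mul_weight_le hx hlam hd hv
  have hxv : x v = (lam - #U + 1) * (x v / (lam - #U + 1)) := by field_simp
  have hy : 0 ≤ x v / (lam - #U + 1) := div_nonneg (hx v) hd.le
  rw [le_div_iff₀ (by linarith)]
  generalize x v / (lam - #U + 1) = y at *
  rw [hxv] at hle
  nlinarith [mul_le_mul_of_nonneg_right hNv hy]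

theorem sum_bound_le (h : SuspendedBipartite G U A p) (hx : ∀ v, 0 ≤ x v)
    (hlam : ∀ v, lam * x v ≤ ∑ u ∈ G.neighborFinset v, x u) (hd : 0 < lam - #U + 1)
    (hD : 0 < (lam - #U + 1) * lam - #U) :
    ∑ v ∈ A \ U,
        (∑ u ∈ Aᶜ \ U, x u + #(U.filter fun u => p u = v) * (x v / (lam - #U + 1))) ≤
      (∑ u ∈ Aᶜ \ U, x u) * (#(A \ U) + #(U.filter fun u => p u ∈ A) /
        ((lam - #U + 1) * lam - #(U.filter fun u => p u ∈ A))) := by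
  rw [sum_add_distrib, sum_const, nsmul_eq_mul, mul_add, mul_comm (#(A \ U) : ℝ)]
  gcongr
  calc ∑ v ∈ A \ U, #(U.filter fun u => p u = v) * (x v / (lam - #U + 1))
      ≤ ∑ v ∈ A \ U, #(U.filter fun u => p u = v) * ((∑ u ∈ Aᶜ \ U, x u) /
          ((lam - #U + 1) * lam - #(U.filter fun u => p u ∈ A))) := by
        refine sum_le_sum fun v hv => ?_
        exact mul_le_mul_of_nonneg_left (h.weight_div_le hx hlam hd hD hv) (Nat.cast_nonneg _)
    _ = _ := by
        rw [← sum_mul, ← h.sum_card_filter_anchor]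
        push_cast
        ring

theorem sum_weight_pos (h : SuspendedBipartite G U A p) (hx : ∀ v, 0 ≤ x v)
    (hpos : ∃ v, 0 < x v)
    (hlam : ∀ v, lam * x v ≤ ∑ u ∈ G.neighborFinset v, x u) (hd : 0 < lam - #U + 1)
    (hD : 0 < (lam - #U + 1) * lam - #U) : 0 < ∑ u ∈ Aᶜ \ U, x u := by
  refine (sum_nonneg fun u _ => hx u).lt_of_ne fun h0 => ?_
  have hout : ∀ v ∉ U, x v = 0 := by
    intro v hv
    by_cases hvA : v ∈ A
    · have hle := h.weight_div_le hx hlam hd hD (mem_sdiff.mpr ⟨hvA, hv⟩)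
      rw [← h0, zero_div, div_le_iff₀ hd, zero_mul] at hle
      exact hle.antisymm (hx v)
    · exact (sum_eq_zero_iff_of_nonneg fun u _ => hx u).mp h0.symm v
        (mem_sdiff.mpr ⟨mem_compl.mpr hvA, hv⟩)
  obtain ⟨v, hv⟩ := hpos
  by_cases hvU : v ∈ U
  · have hle := h.weight_le hx hlam hd hvU
    rw [hout _ (h.anchor_notMem v hvU), zero_div] at hle
    linarith
  · linarith [hout v hvU]

/-- The parameters of the extremal graph with part sizes `L` and `H` and `m` suspended vertices,
whose spectral radius is `t`. -/
structure ExtremalParams (L H m : ℕ) (t : ℝ) : Prop where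
  le : L ≤ H
  le_succ : H ≤ L + 1
  pos : 0 < m
  two_mul_le : 2 * m ≤ L
  le_root : (L : ℝ) ≤ t
  sq_root : t ^ 2 = L * H + H * suspGain m t

theorem extremal_eq {L H : ℕ} {t : ℝ} (P : ExtremalParams L H #U t)
    (h : SuspendedBipartite G U A p) (hx : ∀ v, 0 ≤ x v) (hpos : ∃ v, 0 < x v)
    (hlam : ∀ v, lam * x v ≤ ∑ u ∈ G.neighborFinset v, x u)
    (hcard : #(A \ U) + #(Aᶜ \ U) = L + H) (ht : t ≤ lam) :
    (L * H + H * suspGain #U lam ≤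
      (#(A \ U) + #(U.filter fun u => p u ∈ A) /
        ((lam - #U + 1) * lam - #(U.filter fun u => p u ∈ A))) *
      (#(Aᶜ \ U) + #(U.filter fun u => p u ∈ Aᶜ) /
        ((lam - #U + 1) * lam - #(U.filter fun u => p u ∈ Aᶜ)))) ∧
    ∀ v ∈ A \ U, lam * x v =
      ∑ u ∈ Aᶜ \ U, x u + #(U.filter fun u => p u = v) * (x v / (lam - #U + 1)) := by
  have hm1 : (1 : ℝ) ≤ #U := by exact_mod_cast P.pos
  have hmL : (2 * #U : ℝ) ≤ L := by exact_mod_cast P.two_mul_le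
  have hLH : (L : ℝ) ≤ H := by exact_mod_cast P.le
  have hLt := P.le_root
  have hd : 0 < lam - #U + 1 := by linarith
  have hD : 0 < (lam - #U + 1) * lam - #U := by
    have : (lam - #U + 1) * lam - #U = (lam + 1) * (lam - #U) := by ring
    rw [this]
    exact mul_pos (by linarith) (by linarith)
  have hsumN : #(U.filter fun u => p u ∈ A) + #(U.filter fun u => p u ∈ Aᶜ) = #U := by
    simp only [mem_compl]
    exact card_filter_add_card_filter_not _
  have hSB := h.sum_weight_pos hx hpos hlam hd hD
  have hSA := h.compl.sum_weight_pos hx hpos hlam hd hD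
  have hA := h.sum_bound_le hx hlam hd hD
  have hB := h.compl.sum_bound_le hx hlam hd hD
  have hA1 : ∀ v ∈ A \ U, _ := fun v hv => h.mul_weight_le hx hlam hd hv
  have hB1 := sum_le_sum fun v (hv : v ∈ Aᶜ \ U) => h.compl.mul_weight_le hx hlam hd hv
  have hgain := suspGain_le_suspGain (m := #U) (by linarith) (by linarith) ht
  have hmain := mul_add_suspGain_le (a := #(A \ U)) (b := #(Aᶜ \ U))
    (M := (max #(A \ U) #(Aᶜ \ U) : ℕ)) (m := #U) (t := lam)
    (Nat.cast_nonneg #(U.filter fun u => p u ∈ A))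
    (Nat.cast_nonneg #(U.filter fun u => p u ∈ Aᶜ)) (by exact_mod_cast hsumN) (by linarith)
    (by linarith) (by exact_mod_cast le_max_left _ _) (by exact_mod_cast le_max_right _ _)
    (by have := P.pos; have := P.two_mul_le; exact_mod_cast (by omega))
  have hmax := mul_add_max_mul_le P.le P.le_succ hcard
    (suspGain_lt_one (m := #U) (t := lam) (by linarith) (by linarith)).le
  rw [compl_compl] at hSA hB hB1
  rw [← mul_sum] at hB1
  have hsq : L * H + H * suspGain #U lam ≤ lam ^ 2 := by
    have := P.sq_root
    nlinarith
  have hsq' : t ^ 2 ≤ lam ^ 2 := by nlinarith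
  set α : ℝ := #(A \ U) + #(U.filter fun u => p u ∈ A) /
    ((lam - #U + 1) * lam - #(U.filter fun u => p u ∈ A))
  set β : ℝ := #(Aᶜ \ U) + #(U.filter fun u => p u ∈ Aᶜ) /
    ((lam - #U + 1) * lam - #(U.filter fun u => p u ∈ Aᶜ))
  have hαβ : α * β ≤ lam ^ 2 := by
    have := P.sq_root
    nlinarith
  have hA1s := sum_le_sum hA1
  rw [← mul_sum] at hA1s
  have hlam0 : 0 < lam := by linarith
  set SA := ∑ u ∈ A \ U, x u
  set SB := ∑ u ∈ Aᶜ \ U, x u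
  have hBs : lam * SB ≤ SA * β := hB1.trans hB
  have hlamSB : 0 < lam * SB := mul_pos hlam0 hSB
  have hSBα : 0 ≤ SB * α := (mul_pos hlam0 hSA).le.trans (hA1s.trans hA)
  have h1 := mul_le_mul_of_nonneg_right hA1s hlamSB.le
  have h2 := mul_le_mul_of_nonneg_right hA hlamSB.le
  have h3 := mul_le_mul_of_nonneg_left hBs hSBα
  have h4 := mul_le_mul_of_nonneg_left hαβ (mul_pos hSA hSB).le
  constructor
  · refine hsq.trans (le_of_mul_le_mul_left ?_ (mul_pos hSA hSB))
    linarith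
  · refine (sum_eq_sum_iff_of_le hA1).mp ?_
    rw [← mul_sum]
    refine hA1s.antisymm (le_of_mul_le_mul_right ?_ hlamSB)
    linarith

theorem adj_of_mul_weight_eq (h : SuspendedBipartite G U A p) (hx : ∀ v, 0 ≤ x v)
    (hlam : ∀ v, lam * x v ≤ ∑ u ∈ G.neighborFinset v, x u) (hd : 0 < lam - #U + 1)
    {v : V} (hv : v ∈ A \ U) (hxv : 0 < x v) (hpos : ∀ u ∈ Aᶜ \ U, 0 < x u)
    (heq : lam * x v =
      ∑ u ∈ Aᶜ \ U, x u + #(U.filter fun u => p u = v) * (x v / (lam - #U + 1))) :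
    (∀ u ∈ U.filter fun u => p u = v, x u = x v / (lam - #U + 1)) ∧
      ∀ z ∈ (Aᶜ \ U) ∪ U.filter fun u => p u = v, G.Adj v z := by
  have hdisj : Disjoint (Aᶜ \ U) (U.filter fun u => p u = v) :=
    disjoint_sdiff_self_left.mono_right (filter_subset _ _)
  have hsub := h.neighborFinset_subset_of_notMem hv
  have hle := sum_le_sum_of_subset_of_nonneg hsub fun u _ _ => hx u
  have hw : ∀ u ∈ U.filter fun u => p u = v, x u ≤ x v / (lam - #U + 1) := by
    intro u hu
    obtain ⟨huU, rfl⟩ := mem_filter.mp hu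
    exact h.weight_le hx hlam hd huU
  have hws := sum_le_sum hw
  rw [sum_union hdisj] at hle
  rw [← nsmul_eq_mul, ← sum_const] at heq
  have hlv := hlam v
  have hsuspended := (sum_eq_sum_iff_of_le hw).mp (hws.antisymm (by linarith))
  refine ⟨hsuspended, fun z hz => ?_⟩
  by_contra hadj
  have hxz : 0 < x z := by
    rcases mem_union.mp hz with hz | hz
    · exact hpos z hz
    · rw [hsuspended z hz]
      exact div_pos hxv hd
  have hlt : ∑ u ∈ G.neighborFinset v, x u < ∑ u ∈ (Aᶜ \ U) ∪ U.filter fun u => p u = v, x u :=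
    sum_lt_sum_of_subset hsub hz (by rwa [SimpleGraph.mem_neighborFinset]) hxz fun u _ _ => hx u
  rw [sum_union hdisj] at hlt
  linarith

theorem adj_of_weight_eq (h : SuspendedBipartite G U A p) (hx : ∀ v, 0 ≤ x v)
    (hlam : ∀ v, lam * x v ≤ ∑ u ∈ G.neighborFinset v, x u) (hd : 0 < lam - #U + 1)
    (hpos : ∀ u ∉ U, 0 < x u) (heq : ∀ u ∈ U, x u = x (p u) / (lam - #U + 1))
    {w w' : V} (hw : w ∈ U) (hw' : w' ∈ U) (hne : w ≠ w') : G.Adj w w' := by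
  by_contra hadj
  have hxw : 0 < x w := heq w hw ▸ div_pos (hpos _ (h.anchor_notMem w hw)) hd
  have hxp : x (p w) = (lam - #U + 1) * x w := by
    rw [heq w hw]
    field_simp
  have hsub : G.neighborFinset w ⊆
      insert (p w) (((U.filter fun u => p u = p w).erase w).erase w') := by
    intro u hu
    have hu' := h.neighborFinset_subset_of_mem hw hu
    have huw' : u ≠ w' := by
      rintro rfl
      exact hadj ((SimpleGraph.mem_neighborFinset _ _ _).mp hu)
    simp only [mem_insert, mem_erase] at hu' ⊢
    tauto
  have hsum : ∑ u ∈ G.neighborFinset w, x u ≤ x (p w) + (#U - 1 - 1) * x w := by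
    calc ∑ u ∈ G.neighborFinset w, x u
        ≤ ∑ u ∈ insert (p w) (((U.filter fun u => p u = p w).erase w).erase w'), x u :=
          sum_le_sum_of_subset_of_nonneg hsub fun u _ _ => hx u
      _ = x (p w) + ∑ u ∈ ((U.filter fun u => p u = p w).erase w).erase w', x u :=
          sum_insert fun hmem => h.anchor_notMem w hw
            (mem_filter.mp (mem_of_mem_erase (mem_of_mem_erase hmem))).1
      _ = x (p w) + #(((U.filter fun u => p u = p w).erase w).erase w') * x w := by
          rw [← nsmul_eq_mul, ← sum_const]
          congr 1
          refine sum_congr rfl fun u hu => ?_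
          obtain ⟨huU, hup⟩ := mem_filter.mp (mem_of_mem_erase (mem_of_mem_erase hu))
          rw [heq u huU, heq w hw, hup]
      _ ≤ x (p w) + (#U - 1 - 1) * x w := by
          have hc : #(((U.filter fun u => p u = p w).erase w).erase w') ≤ #((U.erase w).erase w') :=
            card_le_card (erase_subset_erase _ (erase_subset_erase _ (filter_subset _ _)))
          rw [← cast_card_erase_of_mem hw, ← cast_card_erase_of_mem (mem_erase.mpr ⟨hne.symm, hw'⟩)]
          gcongr
  nlinarith [hlam w]

/-- If the subeigenvector parameter `lam` reaches the extremal spectral radius and the suspended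
vertices adjacent to the bipartite part are anchored in `A`, then `G` is extremal. -/
theorem exists_isSuspColoring_of_anchor_mem {L H : ℕ} {t : ℝ} (P : ExtremalParams L H #U t)
    (h : SuspendedBipartite G U A p) (hx : ∀ v, 0 ≤ x v) (hpos : ∃ v, 0 < x v)
    (hlam : ∀ v, lam * x v ≤ ∑ u ∈ G.neighborFinset v, x u)
    (hcard : #(A \ U) + #(Aᶜ \ U) = L + H) (ht : t ≤ lam)
    {w₀ : V} (hw₀ : w₀ ∈ U) (hw₀A : p w₀ ∈ A) : ∃ col, IsSuspColoring G L H #U col := by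
  have hm1 : (1 : ℝ) ≤ #U := by exact_mod_cast P.pos
  have hmL : (2 * #U : ℝ) ≤ L := by exact_mod_cast P.two_mul_le
  have hLt := P.le_root
  have hlam0 : 0 < lam := by linarith
  have hd : 0 < lam - #U + 1 := by linarith
  have hDeq : (lam - #U + 1) * lam - #U = (lam + 1) * (lam - #U) := by ring
  have hD : 0 < (lam - #U + 1) * lam - #U := hDeq ▸ mul_pos (by linarith) (by linarith)
  obtain ⟨hprod, hA⟩ := h.extremal_eq P hx hpos hlam hcard ht
  have hB := (h.compl.extremal_eq P hx hpos hlam (by rw [compl_compl]; omega) ht).2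
  have hSB := h.sum_weight_pos hx hpos hlam hd hD
  have hSA := h.compl.sum_weight_pos hx hpos hlam hd hD
  have hApos : ∀ v ∈ A \ U, 0 < x v := fun v hv => by
    have h0 : 0 ≤ #(U.filter fun u => p u = v) * (x v / (lam - #U + 1)) :=
      mul_nonneg (Nat.cast_nonneg _) (div_nonneg (hx v) hd.le)
    exact pos_of_mul_pos_right (a := lam) (by linarith [hA v hv]) hlam0.le
  have hBpos : ∀ v ∈ Aᶜ \ U, 0 < x v := fun v hv => by
    have h0 : 0 ≤ #(U.filter fun u => p u = v) * (x v / (lam - #U + 1)) :=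
      mul_nonneg (Nat.cast_nonneg _) (div_nonneg (hx v) hd.le)
    exact pos_of_mul_pos_right (a := lam) (by linarith [hB v hv]) hlam0.le
  have hAadj := fun v hv => h.adj_of_mul_weight_eq hx hlam hd hv (hApos v hv) hBpos (hA v hv)
  have hBadj := fun v hv => h.compl.adj_of_mul_weight_eq hx hlam hd hv (hBpos v hv)
    (by rwa [compl_compl]) (hB v hv)
  have hside : ∀ v ∉ U, v ∈ A \ U ∨ v ∈ Aᶜ \ U := fun v hv => by
    simp only [mem_sdiff, mem_compl]
    tauto
  have hUpos : ∀ u ∉ U, 0 < x u := fun u hu => (hside u hu).elim (hApos u) (hBpos u)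
  have hUeq : ∀ u ∈ U, x u = x (p u) / (lam - #U + 1) ∧ G.Adj (p u) u := fun u hu => by
    have hmem : u ∈ U.filter fun z => p z = p u := mem_filter.mpr ⟨hu, rfl⟩
    rcases hside (p u) (h.anchor_notMem u hu) with hp | hp
    · exact ⟨(hAadj _ hp).1 u hmem, (hAadj _ hp).2 u (mem_union_right _ hmem)⟩
    · exact ⟨(hBadj _ hp).1 u hmem, (hBadj _ hp).2 u (mem_union_right _ hmem)⟩
  have hclique : ∀ w ∈ U, ∀ w' ∈ U, w ≠ w' → G.Adj w w' := fun w hw w' hw' hne =>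
    h.adj_of_weight_eq hx hlam hd hUpos (fun u hu => (hUeq u hu).1) hw hw' hne
  have hp : ∀ w ∈ U, p w = p w₀ := fun w hw => by
    by_cases hne : w = w₀
    · rw [hne]
    · exact h.anchor_eq w hw w₀ hw₀ (hclique w hw w₀ hw₀ hne)
  have hp₀ := h.anchor_notMem w₀ hw₀
  have hfA : U.filter (fun u => p u ∈ A) = U :=
    filter_true_of_mem fun u hu => by rwa [hp u hu]
  have hfB : U.filter (fun u => p u ∈ Aᶜ) = ∅ :=
    filter_false_of_mem fun u hu => by rwa [hp u hu, mem_compl, not_not]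
  rw [hfA, hfB, card_empty, Nat.cast_zero, zero_div, add_zero, hDeq, ← suspGain, add_mul,
    mul_comm (suspGain _ _)] at hprod
  have hBH := eq_of_le_mul_add_mul P.le P.le_succ hcard
    (suspGain_pos (m := #U) (t := lam) (by linarith) (by linarith))
    (suspGain_lt_one (m := #U) (t := lam) (by linarith) (by linarith)) hprod
  refine ⟨_, h.isSuspColoring_of_adj hp₀ hw₀A hp (fun a ha b hb => ?_) (fun w hw => ?_) hclique
    (by omega) hBH⟩
  · exact (hAadj a ha).2 b (mem_union_left _ hb)
  · exact hp w hw ▸ (hUeq w hw).2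

end SuspendedBipartite

theorem FamilyGStar.exists_suspendedBipartite {n r : ℕ} {G : SimpleGraph (Fin n)}
    (hG : FamilyGStar n r G) : ∃ U A p, SuspendedBipartite G U A p ∧ U.card = r - 2 := by
  classical
  obtain ⟨s, W, v, hdisj, hcard, hv, ⟨A, hA⟩, hW, hWv⟩ := hG
  have hex : ∀ w, ∃ y, ∀ i, w ∈ W i → y = v i := fun w => by
    by_cases hw : ∃ i, w ∈ W i
    · obtain ⟨i, hi⟩ := hw
      refine ⟨v i, fun j hj => ?_⟩
      by_contra hne
      exact Finset.disjoint_left.mp (hdisj i j fun hij => hne (by rw [hij])) hi hj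
    · exact ⟨w, fun i hi => absurd ⟨i, hi⟩ hw⟩
  choose p hp using hex
  refine ⟨Finset.univ.biUnion W, Finset.univ.filter (· ∈ A), p, ⟨?_, ?_, ?_, ?_⟩, hcard⟩
  · intro w hw
    obtain ⟨i, -, hi⟩ := Finset.mem_biUnion.mp hw
    exact hp w i hi ▸ hv i
  · intro w hw y hy hwy
    obtain ⟨i, -, hi⟩ := Finset.mem_biUnion.mp hw
    rw [hp w i hi]
    exact hWv i w hi y hwy hy
  · intro w hw w' hw' hww'
    obtain ⟨i, -, hi⟩ := Finset.mem_biUnion.mp hw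
    obtain ⟨j, -, hj⟩ := Finset.mem_biUnion.mp hw'
    have hij : i = j := by
      by_contra hij
      exact hW i j hij w hi w' hj hww'
    rw [hp w i hi, hp w' j hj, hij]
  · intro x y hxy hx hy
    have := hA x y hxy hx hy
    simp only [Finset.mem_filter, Finset.mem_univ, true_and]
    tauto

theorem SuspendedBipartite.exists_isSuspColoring {V : Type*} [Fintype V] [DecidableEq V]
    {G : SimpleGraph V} {U A : Finset V} {p : V → V} (h : SuspendedBipartite G U A p)
    {L H : ℕ} {t : ℝ} (P : ExtremalParams L H U.card t)
    (hcard : (A \ U).card + (Aᶜ \ U).card = L + H) (ht : t ≤ G.specRad) :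
    ∃ col, IsSuspColoring G L H U.card col := by
  classical
  have hpos : 0 < G.specRad := by
    have h1 : (0 : ℝ) < L := by
      have := P.pos
      have := P.two_mul_le
      exact_mod_cast (by omega)
    linarith [P.le_root]
  obtain ⟨x, hx, hx0, hlam⟩ := G.exists_nonneg_specRad_mul_le hpos
  obtain ⟨w₀, hw₀⟩ := Finset.card_pos.mp P.pos
  by_cases hA : p w₀ ∈ A
  · exact h.exists_isSuspColoring_of_anchor_mem P hx hx0 hlam hcard ht hw₀ hA
  · exact h.compl.exists_isSuspColoring_of_anchor_mem P hx hx0 hlam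
      (by rw [compl_compl]; omega) ht hw₀ (Finset.mem_compl.mpr hA)

theorem card_sdiff_add_card_compl_sdiff {V : Type*} [Fintype V] [DecidableEq V]
    (U A : Finset V) : (A \ U).card + (Aᶜ \ U).card = Fintype.card V - U.card := by
  rw [← Finset.card_compl, ← Finset.card_union_of_disjoint
    (disjoint_compl_right.mono Finset.sdiff_subset Finset.sdiff_subset),
    ← Finset.union_sdiff_distrib, Finset.union_compl, Finset.compl_eq_univ_sdiff]

/-- Lemma A.1. If `n ≥ 100 k`, `3 ≤ r ≤ 10 k` and `G ∈ 𝒢*_{n,r}`, then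
`λ(G) ≤ λ(T_{n-r+2,2} ∘ K_{r-1})`, with equality iff `G = T_{n-r+2,2} ∘ K_{r-1}`. -/
theorem stmt_5 (k r n : ℕ) (hk : 2 ≤ k) (hn : 100 * k ≤ n) (hr3 : 3 ≤ r)
    (hr : r ≤ 10 * k) (G : SimpleGraph (Fin n)) (hG : FamilyGStar n r G) :
    G.specRad ≤ (turanSuspAt n (n - r + 2) 0).specRad ∧
    (G.specRad = (turanSuspAt n (n - r + 2) 0).specRad ↔
      Nonempty (G ≃g turanSuspAt n (n - r + 2) 0)) := by
  obtain ⟨U, A, p, h, hU⟩ := hG.exists_suspendedBipartite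
  have hq : n - r + 2 = n - U.card := by omega
  rw [hq]
  obtain ⟨col, hcol⟩ := exists_isSuspColoring_turanSuspAt (n := n) (m := U.card) (by omega)
  have hm : 0 < U.card := by omega
  have hmL : 2 * U.card ≤ (n - U.card) / 2 := by omega
  have hLH : (n - U.card) / 2 ≤ n - U.card - (n - U.card) / 2 := by omega
  obtain ⟨t, hLt, ht⟩ := exists_sq_eq_add_mul_suspGain (m := U.card) (by exact_mod_cast hm)
    (by exact_mod_cast hmL) (Nat.cast_le (α := ℝ).mpr hLH)
  have htT := hcol.le_specRad hm hmL hLH hLt ht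
  by_cases hGt : t ≤ G.specRad
  · obtain ⟨col', hcol'⟩ := h.exists_isSuspColoring ⟨hLH, by omega, hm, hmL, hLt, ht⟩
      (by rw [card_sdiff_add_card_compl_sdiff, Fintype.card_fin]; omega) hGt
    obtain ⟨e⟩ := hcol'.nonempty_iso hcol
    exact ⟨e.specRad_eq.le, fun _ => ⟨e⟩, fun _ => e.specRad_eq⟩
  · push Not at hGt
    exact ⟨(hGt.trans_le htT).le, fun heq => absurd heq (hGt.trans_le htT).ne,
      fun ⟨e⟩ => e.specRad_eq⟩
end

section
/- Let k ≥ 2, n ≥ 100k and 3 ≤ r < s ≤ 10k be integers. Then λ(T_{n−s+2,2}∘K_{s−1}) < λ(T_{n−r+2,2}∘K_{r−1}). -/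
/-- A real eigenvalue of a graph with a positive vector `x` satisfying `A x ≤ μ x` is at
most `μ`. -/
theorem SimpleGraph.eigenvalue_le_of_mulVec_le {V : Type*} [Fintype V] (G : SimpleGraph V)
    [DecidableRel G.Adj] {x y : V → ℝ} {μ ν : ℝ} (hx : ∀ i, 0 < x i)
    (hA : ∀ i, (G.adjMatrix ℝ).mulVec x i ≤ μ * x i) (hy : y ≠ 0)
    (hev : (G.adjMatrix ℝ).mulVec y = ν • y) : ν ≤ μ := by
  classical
  obtain ⟨j, hj⟩ := Function.ne_iff.mp hy
  have : Nonempty V := ⟨j⟩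
  obtain ⟨i, -, hi⟩ := Finset.exists_max_image Finset.univ (fun i => |y i| / x i)
    Finset.univ_nonempty
  set m := |y i| / x i with hm
  have hm0 : 0 < m := lt_of_lt_of_le (div_pos (abs_pos.mpr hj) (hx j)) (hi j (Finset.mem_univ j))
  have hle : ∀ l, |y l| ≤ m * x l := fun l =>
    (div_le_iff₀ (hx l)).mp (hi l (Finset.mem_univ l))
  have heq : |y i| = m * x i := by rw [hm, div_mul_cancel₀ _ (hx i).ne']
  have h1 : |ν| * (m * x i) ≤ m * (μ * x i) := by
    calc |ν| * (m * x i) = |(G.adjMatrix ℝ).mulVec y i| := by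
          rw [hev, ← heq, Pi.smul_apply, smul_eq_mul, abs_mul]
      _ ≤ ∑ l ∈ G.neighborFinset i, |y l| := by
          rw [SimpleGraph.adjMatrix_mulVec_apply]
          exact Finset.abs_sum_le_sum_abs _ _
      _ ≤ ∑ l ∈ G.neighborFinset i, m * x l := Finset.sum_le_sum fun l _ => hle l
      _ = m * (G.adjMatrix ℝ).mulVec x i := by
          rw [SimpleGraph.adjMatrix_mulVec_apply, Finset.mul_sum]
      _ ≤ m * (μ * x i) := mul_le_mul_of_nonneg_left (hA i) hm0.le
  have h2 : |ν| ≤ μ := by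
    have : 0 < m * x i := mul_pos hm0 (hx i)
    refine le_of_mul_le_mul_right ?_ this
    linarith
  exact (le_abs_self ν).trans h2

theorem SimpleGraph.specRad_le_of_mulVec_le {V : Type*} [Fintype V] (G : SimpleGraph V)
    [DecidableRel G.Adj] {x : V → ℝ} {μ : ℝ} (hμ : 0 ≤ μ) (hx : ∀ i, 0 < x i)
    (hA : ∀ i, (G.adjMatrix ℝ).mulVec x i ≤ μ * x i) : G.specRad ≤ μ := by
  unfold SimpleGraph.specRad
  refine Real.sSup_le ?_ hμ
  rintro ν ⟨y, hy, hev⟩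
  refine G.eigenvalue_le_of_mulVec_le hx hA hy ?_
  convert hev

theorem SimpleGraph.eigenvalue_le_specRad {V : Type*} [Fintype V] (G : SimpleGraph V)
    [DecidableRel G.Adj] {y : V → ℝ} {ν : ℝ} (hy : y ≠ 0)
    (hev : (G.adjMatrix ℝ).mulVec y = ν • y) : ν ≤ G.specRad := by
  unfold SimpleGraph.specRad
  refine le_csSup ⟨Fintype.card V, ?_⟩ ⟨y, hy, by convert hev⟩
  rintro κ ⟨z, hz, hκ⟩
  let _ : DecidableRel G.Adj := Classical.decRel _
  refine G.eigenvalue_le_of_mulVec_le (x := fun _ => 1) (fun _ => one_pos) (fun i => ?_) hz hκ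
  rw [SimpleGraph.adjMatrix_mulVec_apply]
  simpa using (G.neighborFinset i).card_le_univ

theorem SimpleGraph.dotProduct_mulVec_le_specRad {V : Type*} [Fintype V] (G : SimpleGraph V)
    [DecidableRel G.Adj] (x : V → ℝ) :
    x ⬝ᵥ (G.adjMatrix ℝ).mulVec x ≤ G.specRad * (x ⬝ᵥ x) := by
  classical
  have hH : (G.specRad • (1 : Matrix V V ℝ) - G.adjMatrix ℝ).IsHermitian := by
    ext i j
    simp [Matrix.one_apply, SimpleGraph.adjMatrix_apply, G.adj_comm, eq_comm]
  have hP : (G.specRad • (1 : Matrix V V ℝ) - G.adjMatrix ℝ).PosSemidef := by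
    rw [hH.posSemidef_iff_eigenvalues_nonneg]
    intro i
    have h := hH.mulVec_eigenvectorBasis i
    rw [Matrix.sub_mulVec, Matrix.smul_mulVec, Matrix.one_mulVec] at h
    have hne : (hH.eigenvectorBasis i).ofLp ≠ 0 := by
      intro h0
      exact hH.eigenvectorBasis.orthonormal.ne_zero i (by ext l; exact congrFun h0 l)
    have := G.eigenvalue_le_specRad (ν := G.specRad - hH.eigenvalues i) hne (by
      rw [sub_smul, ← h]; abel)
    simp only [Pi.zero_apply]
    linarith
  have := hP.dotProduct_mulVec_nonneg x
  rw [Matrix.sub_mulVec, Matrix.smul_mulVec, Matrix.one_mulVec, dotProduct_sub,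
    dotProduct_smul] at this
  simpa using this

theorem SimpleGraph.le_specRad_of_le_mulVec {V : Type*} [Fintype V] (G : SimpleGraph V)
    [DecidableRel G.Adj] {x : V → ℝ} {μ : ℝ} (hx : ∀ i, 0 ≤ x i) (hx0 : x ≠ 0)
    (hA : ∀ i, μ * x i ≤ (G.adjMatrix ℝ).mulVec x i) : μ ≤ G.specRad := by
  have h1 := G.dotProduct_mulVec_le_specRad x
  have h2 : μ * (x ⬝ᵥ x) ≤ x ⬝ᵥ (G.adjMatrix ℝ).mulVec x := by
    simp only [dotProduct, Finset.mul_sum]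
    refine Finset.sum_le_sum fun i _ => ?_
    nlinarith [mul_le_mul_of_nonneg_left (hA i) (hx i)]
  have h3 : 0 < x ⬝ᵥ x := by
    refine lt_of_le_of_ne (Finset.sum_nonneg fun i _ => mul_self_nonneg (x i)) ?_
    exact fun h => hx0 (dotProduct_self_eq_zero.mp h.symm)
  exact le_of_mul_le_mul_right (h2.trans h1) h3

theorem Fin.sum_ite_interval {n l h : ℕ} (hlh : l ≤ h) (hn : h ≤ n) (c : ℝ) :
    ∑ j : Fin n, (if l ≤ (j : ℕ) ∧ (j : ℕ) < h then c else 0) = ((h : ℝ) - l) * c := by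
  rw [Fin.sum_univ_eq_sum_range (fun j => if l ≤ j ∧ j < h then c else 0) n,
    ← Finset.sum_filter]
  have : (Finset.range n).filter (fun j => l ≤ j ∧ j < h) = Finset.Ico l h := by
    ext j
    simp only [Finset.mem_filter, Finset.mem_range, Finset.mem_Ico]
    omega
  rw [this, Finset.sum_const, Nat.card_Ico, nsmul_eq_mul, Nat.cast_sub hlh]

theorem turanSuspAt_zero_adj {n q : ℕ} (i j : Fin n) :
    (turanSuspAt n q 0).Adj i j ↔ (i : ℕ) ≠ j ∧
      (((i : ℕ) < q / 2 ∧ q / 2 ≤ (j : ℕ) ∧ (j : ℕ) < q) ∨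
        ((j : ℕ) < q / 2 ∧ q / 2 ≤ (i : ℕ) ∧ (i : ℕ) < q) ∨
        (((i : ℕ) = 0 ∨ q ≤ (i : ℕ)) ∧ ((j : ℕ) = 0 ∨ q ≤ (j : ℕ)))) := by
  simp only [turanSuspAt, SimpleGraph.fromRel_adj, ne_eq, Fin.ext_iff]
  tauto

theorem mulVec_turanSuspAt_zero {n q : ℕ} [DecidableRel (turanSuspAt n q 0).Adj]
    (x : Fin n → ℝ) (i : Fin n) :
    ((turanSuspAt n q 0).adjMatrix ℝ).mulVec x i = ∑ j : Fin n,
      if (i : ℕ) ≠ j ∧ (((i : ℕ) < q / 2 ∧ q / 2 ≤ (j : ℕ) ∧ (j : ℕ) < q) ∨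
        ((j : ℕ) < q / 2 ∧ q / 2 ≤ (i : ℕ) ∧ (i : ℕ) < q) ∨
        (((i : ℕ) = 0 ∨ q ≤ (i : ℕ)) ∧ ((j : ℕ) = 0 ∨ q ≤ (j : ℕ)))) then x j else 0 := by
  simp only [Matrix.mulVec, dotProduct, SimpleGraph.adjMatrix_apply, turanSuspAt_zero_adj,
    ite_mul, one_mul, zero_mul]

/-- The suspension contains the complete bipartite graph `T_{q,2}`. -/
theorem sqrt_le_specRad_turanSuspAt {n a b : ℕ} (ha : 0 < a) (hab : (a + b) / 2 = a)
    (hn : a + b ≤ n) : √((a : ℝ) * b) ≤ (turanSuspAt n (a + b) 0).specRad := by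
  classical
  have ha' : (0 : ℝ) < √a := Real.sqrt_pos.mpr (by exact_mod_cast ha)
  have hb' : (0 : ℝ) < √b := Real.sqrt_pos.mpr (by exact_mod_cast (by omega : 0 < b))
  have haa : √(a : ℝ) * √a = a := Real.mul_self_sqrt (Nat.cast_nonneg a)
  have hbb : √(b : ℝ) * √b = b := Real.mul_self_sqrt (Nat.cast_nonneg b)
  refine (turanSuspAt n (a + b) 0).le_specRad_of_le_mulVec
    (x := fun j => if (j : ℕ) < a then √b else if (j : ℕ) < a + b then √a else 0) ?_ ?_ ?_
  · intro i
    split_ifs <;> positivity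
  · intro h
    have := congrFun h ⟨0, by omega⟩
    simp [ha] at this
    omega
  · intro i
    rw [mulVec_turanSuspAt_zero, Real.sqrt_mul (Nat.cast_nonneg a), hab]
    by_cases h1 : (i : ℕ) < a
    · refine le_trans (le_of_eq ?_) (Finset.sum_le_sum (f := fun j : Fin n =>
        if a ≤ (j : ℕ) ∧ (j : ℕ) < a + b then √(a : ℝ) else 0) fun j _ => ?_)
      · rw [Fin.sum_ite_interval (by omega) hn, if_pos h1]
        push_cast
        linear_combination √(a : ℝ) * hbb
      · split_ifs <;> first | omega | positivity | exact le_rfl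
    by_cases h2 : (i : ℕ) < a + b
    · refine le_trans (le_of_eq ?_) (Finset.sum_le_sum (f := fun j : Fin n =>
        if 0 ≤ (j : ℕ) ∧ (j : ℕ) < a then √(b : ℝ) else 0) fun j _ => ?_)
      · rw [Fin.sum_ite_interval (by omega) (by omega), if_neg h1, if_pos h2]
        push_cast
        linear_combination √(b : ℝ) * haa
      · split_ifs <;> first | omega | positivity | exact le_rfl
    · rw [if_neg h1, if_neg h2, mul_zero]
      refine Finset.sum_nonneg fun j _ => ?_
      split_ifs <;> positivity

/-- A small suspended clique raises the squared spectral radius of `T_{q,2}` by at most one. -/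
theorem specRad_turanSuspAt_le_sqrt {n a b c : ℕ} (ha : 0 < a) (hab : (a + b) / 2 = a)
    (hn : n = a + b + c) (hc : 2 * c ≤ a) :
    (turanSuspAt n (a + b) 0).specRad ≤ √((a : ℝ) * b + 1) := by
  classical
  set μ := √((a : ℝ) * b + 1) with hμ
  have hsq : μ * μ = a * b + 1 := Real.mul_self_sqrt (by positivity)
  have hμ0 : 0 < μ := Real.sqrt_pos.mpr (by positivity)
  have hba : (a : ℝ) ≤ b ∧ (b : ℝ) ≤ a + 1 := by
    constructor
    · exact_mod_cast (by omega : a ≤ b)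
    · exact_mod_cast (by omega : b ≤ a + 1)
  have ha0 : (0 : ℝ) < a := by exact_mod_cast ha
  have hμa : (a : ℝ) ≤ μ := Real.le_sqrt_of_sq_le (by nlinarith [hba.1])
  have hc' : 2 * (c : ℝ) ≤ a := by exact_mod_cast hc
  refine (turanSuspAt n (a + b) 0).specRad_le_of_mulVec_le
    (x := fun j => if (j : ℕ) < 1 then (b : ℝ) + 1 else if (j : ℕ) < a then (b : ℝ) else
      if (j : ℕ) < a + b then μ else 2) hμ0.le ?_ ?_
  · intro i
    have : (0 : ℝ) < b := ha0.trans_le hba.1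
    split_ifs <;> positivity
  · intro i
    rw [mulVec_turanSuspAt_zero, hab]
    by_cases h0 : (i : ℕ) < 1
    · refine le_trans (Finset.sum_le_sum (g := fun j : Fin n =>
        (if a ≤ (j : ℕ) ∧ (j : ℕ) < a + b then μ else 0) +
          (if a + b ≤ (j : ℕ) ∧ (j : ℕ) < n then (2 : ℝ) else 0)) fun j _ => ?_) ?_
      · have := j.isLt
        split_ifs <;> first | omega | linarith
      · rw [Finset.sum_add_distrib, Fin.sum_ite_interval (by omega) (by omega),
          Fin.sum_ite_interval (by omega) le_rfl, if_pos h0, hn]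
        push_cast
        linarith
    by_cases h1 : (i : ℕ) < a
    · refine le_trans (Finset.sum_le_sum (g := fun j : Fin n =>
        (if a ≤ (j : ℕ) ∧ (j : ℕ) < a + b then μ else 0)) fun j _ => ?_) ?_
      · have := j.isLt
        split_ifs <;> first | omega | linarith
      · rw [Fin.sum_ite_interval (by omega) (by omega), if_neg h0, if_pos h1]
        push_cast
        linarith
    by_cases h2 : (i : ℕ) < a + b
    · refine le_trans (Finset.sum_le_sum (g := fun j : Fin n =>
        (if 0 ≤ (j : ℕ) ∧ (j : ℕ) < 1 then (b : ℝ) + 1 else 0) +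
          (if 1 ≤ (j : ℕ) ∧ (j : ℕ) < a then (b : ℝ) else 0)) fun j _ => ?_) ?_
      · have := j.isLt
        split_ifs <;> first | omega | linarith
      · rw [Finset.sum_add_distrib, Fin.sum_ite_interval (by omega) (by omega),
          Fin.sum_ite_interval (by omega) (by omega), if_neg h0, if_neg h1, if_pos h2]
        push_cast
        linarith
    · have hi := i.isLt
      refine le_trans (Finset.sum_le_sum (g := fun j : Fin n =>
        (if 0 ≤ (j : ℕ) ∧ (j : ℕ) < 1 then (b : ℝ) + 1 else 0) +
          (if a + b ≤ (j : ℕ) ∧ (j : ℕ) < n then (2 : ℝ) else 0) +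
          (if (i : ℕ) ≤ (j : ℕ) ∧ (j : ℕ) < i + 1 then (-2 : ℝ) else 0)) fun j _ => ?_) ?_
      · have := j.isLt
        split_ifs <;> first | omega | linarith
      · rw [Finset.sum_add_distrib, Finset.sum_add_distrib,
          Fin.sum_ite_interval (by omega) (by omega),
          Fin.sum_ite_interval (by omega) le_rfl, Fin.sum_ite_interval (by omega) (by omega),
          if_neg h0, if_neg h1, if_neg h2]
        have hn' : (n : ℝ) = a + b + c := by exact_mod_cast hn
        push_cast
        rw [hn']
        linarith

/-- Lemma A.2. If `n ≥ 100 k` and `3 ≤ r < s ≤ 10 k`, then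
`λ(T_{n-s+2,2} ∘ K_{s-1}) < λ(T_{n-r+2,2} ∘ K_{r-1})`. -/
theorem stmt_6 (k r s n : ℕ) (hk : 2 ≤ k) (hn : 100 * k ≤ n) (hr3 : 3 ≤ r)
    (hrs : r < s) (hs : s ≤ 10 * k) :
    (turanSuspAt n (n - s + 2) 0).specRad < (turanSuspAt n (n - r + 2) 0).specRad := by
  obtain ⟨a, b, hab, hq⟩ : ∃ a b, (a + b) / 2 = a ∧ n - s + 2 = a + b :=
    ⟨(n - s + 2) / 2, (n - s + 2) - (n - s + 2) / 2, by omega, by omega⟩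
  obtain ⟨a', b', hab', hq'⟩ : ∃ a b, (a + b) / 2 = a ∧ n - r + 2 = a + b :=
    ⟨(n - r + 2) / 2, (n - r + 2) - (n - r + 2) / 2, by omega, by omega⟩
  rw [hq, hq']
  refine (specRad_turanSuspAt_le_sqrt (c := s - 2) (by omega) hab (by omega) (by omega)).trans_lt
    (lt_of_lt_of_le ?_ (sqrt_le_specRad_turanSuspAt (by omega) hab' (by omega)))
  refine Real.sqrt_lt_sqrt (by positivity) ?_
  have key : a * b + 1 < a' * b' := by
    have ha2 : 2 ≤ a := by omega
    rcases (by omega : a' ≥ a + 1 ∧ b' ≥ b ∨ a' ≥ a ∧ b' ≥ b + 1) with ⟨h1, h2⟩ | ⟨h1, h2⟩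
    · have := Nat.mul_le_mul h1 h2
      have hb : a ≤ b := by omega
      nlinarith
    · have := Nat.mul_le_mul h1 h2
      nlinarith
  exact_mod_cast key
end

section
/- Let k ≥ 2 and n ≥ 100k be integers, and let G be an n-vertex bipartite simple graph with bipartition V(G) = V_1 ⊔ V_2 (every edge of G joins V_1 to V_2) whose minimum degree exceeds 2n/5. Then for any two distinct vertices u and v lying in the same part V_i, and for every odd integer h with 3 ≤ h ≤ 2k+1, there exists a path in G from v to u with exactly h vertices. -/
/-- If any two (possibly equal) vertices on the same side of a bipartite graph have at least `D`
common neighbours, then distinct vertices on the same side are joined by a path of each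
small even length which avoids a given small set of vertices. -/
theorem SimpleGraph.exists_isPath_even_avoiding {V : Type*} (G : SimpleGraph V) (A : Set V)
    (hbip : ∀ ⦃x y : V⦄, G.Adj x y → (x ∈ A ↔ y ∉ A)) (D : ℕ)
    (hD : ∀ x y : V, (x ∈ A ↔ y ∈ A) → D ≤ (G.neighborSet x ∩ G.neighborSet y).ncard)
    (m : ℕ) (S : Finset V) (hS : S.card + 2 * m + 1 ≤ D) (u v : V) (huv : u ≠ v)
    (huS : u ∉ S) (hvS : v ∉ S) (hsame : v ∈ A ↔ u ∈ A) :
    ∃ p : G.Walk v u, p.IsPath ∧ p.length = 2 * (m + 1) ∧ ∀ x ∈ p.support, x ∉ S := by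
  classical
  have common : ∀ x y : V, (x ∈ A ↔ y ∈ A) → ∀ T : Finset V, T.card < D →
      ∃ c, G.Adj x c ∧ G.Adj y c ∧ c ∉ T := by
    intro x y hxy T hT
    obtain ⟨c, ⟨hxc, hyc⟩, hcT⟩ := Set.exists_mem_notMem_of_ncard_lt_ncard
      (s := (T : Set V)) (t := G.neighborSet x ∩ G.neighborSet y)
      (by rw [Set.ncard_coe_finset]; exact hT.trans_le (hD x y hxy))
    exact ⟨c, hxc, hyc, by simpa using hcT⟩
  induction m generalizing S v with
  | zero =>
    obtain ⟨c, hvc, huc, hcS⟩ := common v u hsame S (by omega)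
    refine ⟨.cons hvc (.cons huc.symm .nil), ?_, by simp, ?_⟩
    · simp [SimpleGraph.Walk.isPath_def, hvc.ne, huc.ne.symm, huv.symm]
    · simp [hvS, hcS, huS]
  | succ m ih =>
    obtain ⟨c, hvc, -, hcS⟩ := common v v Iff.rfl S (by omega)
    obtain ⟨w, hcw, -, hwT⟩ := common c c Iff.rfl (insert u (insert v S)) (by
      grind [Finset.card_insert_le])
    simp only [Finset.mem_insert, not_or] at hwT
    obtain ⟨hwu, hwv, hwS⟩ := hwT
    have hcA := hbip hvc
    have hwA := hbip hcw
    have huc : u ≠ c := by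
      rintro rfl
      tauto
    obtain ⟨p, hp, hlen, havoid⟩ := ih (insert c (insert v S))
      (by grind [Finset.card_insert_le]) w (Ne.symm hwu)
      (by simp [huc, huv, huS]) (by simp [hcw.ne.symm, hwv, hwS]) (by tauto)
    have hcp : c ∉ p.support := fun hc => havoid c hc (by simp)
    have hvp : v ∉ p.support := fun hv => havoid v hv (by simp)
    refine ⟨.cons hvc (.cons hcw p), ?_, by simp [hlen]; ring, ?_⟩
    · simp [SimpleGraph.Walk.cons_isPath_iff, hp, hcp, hvp, hvc.ne]
    · intro x hx
      simp only [SimpleGraph.Walk.support_cons, List.mem_cons] at hx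
      rcases hx with rfl | rfl | hx
      · exact hvS
      · exact hcS
      · exact fun hxS => havoid x hx (by simp [hxS])

/-- In a bipartite graph with minimum degree above two fifths of the number of vertices, vertices
on the same side have more than one fifth of all vertices as common neighbours. -/
theorem SimpleGraph.card_lt_five_mul_ncard_common_neighborSet {V : Type*} [Fintype V]
    (G : SimpleGraph V) (A : Set V) (hbip : ∀ ⦃x y : V⦄, G.Adj x y → (x ∈ A ↔ y ∉ A))
    (hdeg : ∀ v : V, 2 * Fintype.card V < 5 * (G.neighborSet v).ncard)
    (x y : V) (hxy : x ∈ A ↔ y ∈ A) :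
    Fintype.card V < 5 * (G.neighborSet x ∩ G.neighborSet y).ncard := by
  have hx := hdeg x
  have hy := hdeg y
  obtain ⟨c, hxc⟩ : (G.neighborSet x).Nonempty :=
    Set.nonempty_of_ncard_ne_zero (by omega)
  have hc := hdeg c
  have hdisj : Disjoint (G.neighborSet x ∪ G.neighborSet y) (G.neighborSet c) := by
    rw [Set.disjoint_left]
    rintro z (hz | hz) hcz <;>
    · have h1 := hbip hz
      have h2 := hbip hcz
      have h3 := hbip hxc
      tauto
  have hle : ((G.neighborSet x ∪ G.neighborSet y) ∪ G.neighborSet c).ncard ≤ Fintype.card V := by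
    rw [← Nat.card_eq_fintype_card]
    exact Set.ncard_le_card _
  rw [Set.ncard_union_eq hdisj] at hle
  have := Set.ncard_union_add_ncard_inter (G.neighborSet x) (G.neighborSet y)
  omega

/-- Lemma 3.1(a). Let `k ≥ 2`, `n ≥ 100 k`, and let `G` be an `n`-vertex
bipartite graph with bipartition `V1 ⊔ V2` and minimum degree exceeding `2n/5`. Then any
two distinct vertices `u, v` in the same part are joined by a path of order `h` for every
odd `3 ≤ h ≤ 2k+1`. -/
theorem stmt_7 {V : Type*} [Fintype V] (k n : ℕ) (hk : 2 ≤ k) (hn : 100 * k ≤ n)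
    (hcard : Fintype.card V = n) (G : SimpleGraph V) (V1 V2 : Set V)
    (hunion : V1 ∪ V2 = Set.univ) (hdisj : Disjoint V1 V2)
    (hbip : ∀ ⦃x y : V⦄, G.Adj x y → (x ∈ V1 ∧ y ∈ V2) ∨ (x ∈ V2 ∧ y ∈ V1))
    (hdeg : ∀ v : V, 2 * n < 5 * (G.neighborSet v).ncard)
    (u v : V) (huv : u ≠ v)
    (hsame : (u ∈ V1 ∧ v ∈ V1) ∨ (u ∈ V2 ∧ v ∈ V2))
    (h : ℕ) (hodd : Odd h) (h3 : 3 ≤ h) (hh : h ≤ 2 * k + 1) :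
    ∃ p : G.Walk v u, p.IsPath ∧ p.length + 1 = h := by
  subst hcard
  have hV2 : ∀ x, x ∈ V2 ↔ x ∉ V1 := fun x =>
    ⟨fun h2 h1 => Set.disjoint_left.mp hdisj h1 h2, fun h1 =>
      ((Set.mem_union x V1 V2).mp (hunion ▸ Set.mem_univ x)).resolve_left h1⟩
  simp only [hV2] at hbip hsame
  have hbip' : ∀ ⦃x y : V⦄, G.Adj x y → (x ∈ V1 ↔ y ∉ V1) := fun x y hxy => by
    have := hbip hxy
    tauto
  obtain ⟨m, rfl⟩ := hodd
  obtain ⟨m, rfl⟩ : ∃ j, m = j + 1 := ⟨m - 1, by omega⟩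
  obtain ⟨p, hp, hlen, -⟩ := G.exists_isPath_even_avoiding V1 hbip' (20 * k)
    (fun x y hxy => by
      have := G.card_lt_five_mul_ncard_common_neighborSet V1 hbip' hdeg x y hxy
      omega)
    m ∅ (by simp; omega) u v huv (by simp) (by simp) (by tauto)
  exact ⟨p, hp, by omega⟩
end

section
/- Let k ≥ 2 and n ≥ 100k be integers, and let G be an n-vertex bipartite simple graph with bipartition V(G) = V_1 ⊔ V_2 (every edge of G joins V_1 to V_2) whose minimum degree exceeds 2n/5. Then for any vertex v ∈ V_1 and any vertex u ∈ V_2, and for every even integer s with 4 ≤ s ≤ 2k+2, there exists a path in G from v to u with exactly s vertices. -/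
namespace SimpleGraph

variable {V : Type*} [Fintype V] {G : SimpleGraph V} {n : ℕ}

/-- A vertex of degree exceeding `|T|` has a neighbor outside `T`. -/
lemma exists_adj_notMem_of_card_lt (x : V) (T : Finset V)
    (hT : T.card < (G.neighborSet x).ncard) : ∃ y, G.Adj x y ∧ y ∉ T := by
  rw [← Set.ncard_coe_finset] at hT
  obtain ⟨y, hy, hyT⟩ := Set.exists_mem_notMem_of_ncard_lt_ncard hT
  exact ⟨y, hy, by simpa using hyT⟩

/-- In a bipartite graph of minimum degree exceeding `2n/5`, two vertices of the same part have
a common neighbor outside any set of at most `n/5` vertices. -/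
lemma exists_common_neighbor_notMem (hcard : Fintype.card V = n) {A B : Set V}
    (hdisj : Disjoint A B) (hAB : ∀ ⦃x y⦄, G.Adj x y → x ∈ A → y ∈ B)
    (hBA : ∀ ⦃x y⦄, G.Adj x y → x ∈ B → y ∈ A)
    (hdeg : ∀ v : V, 2 * n < 5 * (G.neighborSet v).ncard)
    {a x y : V} (ha : a ∈ A) (hx : x ∈ B) (hy : y ∈ B) (T : Finset V) (hT : 5 * T.card ≤ n) :
    ∃ z, G.Adj x z ∧ G.Adj y z ∧ z ∉ T := by
  have hB : (G.neighborSet a).ncard ≤ B.ncard := Set.ncard_le_ncard fun z hz => hAB hz ha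
  have hA : (G.neighborSet x ∪ G.neighborSet y).ncard ≤ A.ncard :=
    Set.ncard_le_ncard (Set.union_subset (fun z hz => hBA hz hx) (fun z hz => hBA hz hy))
  have hABcard : A.ncard + B.ncard ≤ n := by
    rw [← Set.ncard_union_eq hdisj, ← hcard, ← Nat.card_eq_fintype_card]
    exact Set.ncard_le_card _
  have hsum := Set.ncard_union_add_ncard_inter (G.neighborSet x) (G.neighborSet y)
  have hda := hdeg a
  have hdx := hdeg x
  have hdy := hdeg y
  have hlt : (T : Set V).ncard < (G.neighborSet x ∩ G.neighborSet y).ncard := by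
    rw [Set.ncard_coe_finset]
    omega
  obtain ⟨z, hz, hzT⟩ := Set.exists_mem_notMem_of_ncard_lt_ncard hlt
  exact ⟨z, hz.1, hz.2, by simpa using hzT⟩

/-- In a bipartite graph of minimum degree exceeding `2n/5`, vertices in different parts are
joined by paths of every short odd length at least `3` avoiding a given small set. -/
lemma exists_isPath_length_eq_avoiding (hcard : Fintype.card V = n) {A B : Set V}
    (hdisj : Disjoint A B) (hAB : ∀ ⦃x y⦄, G.Adj x y → x ∈ A → y ∈ B)
    (hBA : ∀ ⦃x y⦄, G.Adj x y → x ∈ B → y ∈ A)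
    (hdeg : ∀ v : V, 2 * n < 5 * (G.neighborSet v).ncard) {u : V} (hu : u ∈ B) (m : ℕ) :
    ∀ (S : Finset V) (v : V), v ∈ A → v ∉ S → u ∉ S → 10 * (S.card + 2 * m + 4) ≤ n →
      ∃ p : G.Walk v u, p.IsPath ∧ p.length = 2 * m + 3 ∧ ∀ w ∈ p.support, w ∉ S := by
  classical
  induction m with
  | zero =>
    intro S v hv hvS huS hS
    have hvu : v ≠ u := fun h => Set.disjoint_left.mp hdisj hv (h ▸ hu)
    have hcard_u := Finset.card_insert_le u S
    have hcard_v := Finset.card_insert_le v S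
    have hdv := hdeg v
    obtain ⟨x, hvx, hx⟩ := exists_adj_notMem_of_card_lt (G := G) v (insert u S) (by omega)
    obtain ⟨y, hxy, huy, hy⟩ := exists_common_neighbor_notMem hcard hdisj hAB hBA hdeg hv
      (hAB hvx hv) hu (insert v S) (by omega)
    simp only [Finset.mem_insert, not_or] at hx hy
    refine ⟨.cons hvx (.cons hxy (.cons huy.symm .nil)), ?_, rfl, ?_⟩
    · have := hvx.ne
      have := hxy.ne
      have := huy.ne
      simp only [Walk.isPath_def, Walk.support_cons, Walk.support_nil, List.nodup_cons,
        List.mem_cons, List.not_mem_nil]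
      grind
    · simp only [Walk.support_cons, Walk.support_nil, List.mem_cons, List.not_mem_nil]
      grind
  | succ m ih =>
    intro S v hv hvS huS hS
    have hvu : v ≠ u := fun h => Set.disjoint_left.mp hdisj hv (h ▸ hu)
    have hcard_u := Finset.card_insert_le u S
    have hcard_v := Finset.card_insert_le v S
    have hdv := hdeg v
    obtain ⟨x, hvx, hx⟩ := exists_adj_notMem_of_card_lt (G := G) v (insert u S) (by omega)
    have hdx := hdeg x
    obtain ⟨y, hxy, hy⟩ := exists_adj_notMem_of_card_lt (G := G) x (insert v S) (by omega)
    have hcard_x := Finset.card_insert_le x (insert v S)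
    simp only [Finset.mem_insert, not_or] at hx hy
    obtain ⟨p, hp, hlen, hpS⟩ := ih (insert x (insert v S)) y (hBA hxy (hAB hvx hv))
      (by simp [hxy.ne.symm, hy]) (by simp [Ne.symm hx.1, hvu.symm, huS]) (by omega)
    simp only [Finset.mem_insert, not_or] at hpS
    refine ⟨.cons hvx (.cons hxy p), ?_, by simp only [Walk.length_cons, hlen]; ring, ?_⟩
    · rw [Walk.cons_isPath_iff, Walk.cons_isPath_iff, Walk.support_cons, List.mem_cons]
      exact ⟨⟨hp, fun h => (hpS x h).1 rfl⟩, by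
        rintro (h | h)
        exacts [hvx.ne h, (hpS v h).2.1 rfl]⟩
    · intro w hw
      simp only [Walk.support_cons, List.mem_cons] at hw
      rcases hw with rfl | rfl | hw
      exacts [hvS, hx.2, (hpS w hw).2.2]

end SimpleGraph


/-- Lemma 3.1(b). Let `k ≥ 2`, `n ≥ 100 k`, and let `G` be an `n`-vertex
bipartite graph with bipartition `V1 ⊔ V2` and minimum degree exceeding `2n/5`. Then any
`v ∈ V1` and `u ∈ V2` are joined by a path of order `s` for every even `4 ≤ s ≤ 2k+2`. -/
theorem stmt_8 {V : Type*} [Fintype V] (k n : ℕ) (hk : 2 ≤ k) (hn : 100 * k ≤ n)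
    (hcard : Fintype.card V = n) (G : SimpleGraph V) (V1 V2 : Set V)
    (hunion : V1 ∪ V2 = Set.univ) (hdisj : Disjoint V1 V2)
    (hbip : ∀ ⦃x y : V⦄, G.Adj x y → (x ∈ V1 ∧ y ∈ V2) ∨ (x ∈ V2 ∧ y ∈ V1))
    (hdeg : ∀ v : V, 2 * n < 5 * (G.neighborSet v).ncard)
    (v u : V) (hv : v ∈ V1) (hu : u ∈ V2)
    (s : ℕ) (heven : Even s) (h4 : 4 ≤ s) (hs : s ≤ 2 * k + 2) :
    ∃ p : G.Walk v u, p.IsPath ∧ p.length + 1 = s := by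
  have hAB : ∀ ⦃x y⦄, G.Adj x y → x ∈ V1 → y ∈ V2 := fun x y h hx =>
    (hbip h).elim (·.2) fun h' => (Set.disjoint_left.mp hdisj hx h'.1).elim
  have hBA : ∀ ⦃x y⦄, G.Adj x y → x ∈ V2 → y ∈ V1 := fun x y h hx =>
    (hbip h).elim (fun h' => (Set.disjoint_left.mp hdisj h'.1 hx).elim) (·.2)
  obtain ⟨t, rfl⟩ := heven
  obtain ⟨p, hp, hlen, -⟩ := SimpleGraph.exists_isPath_length_eq_avoiding hcard hdisj hAB hBA hdeg
    hu (t - 2) ∅ v hv (Finset.notMem_empty v) (Finset.notMem_empty u)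
    (by rw [Finset.card_empty]; omega)
  exact ⟨p, hp, by omega⟩
end
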